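/- Let n₁, n₂, n₃, n₄ be nonnegative integers and N = n₁+n₂+n₃+n₄. There is a polynomial P of degree N+4 whose leading coefficient equals (6/π²)·(n₁!·n₂!·n₃!·n₄!/(N+4)!)·Σ_{a=0}^{n₁} Σ_{c=0}^{n₂} binom(n₃+1+a+c, n₃)·binom(n₄+1+n₁+n₂−a−c, n₄), such that for every ε > 0 and all t ≥ 2, Σ_{n≤t} d^{(n₁,n₂)}(n)·d^{(n₃,n₄)}(n)/n = P(log t) + O_ε(t^{−1/2+ε}). -/

import Mathlib

open Complex

/-- `d^{(μ,ν)}(n) = Σ_{ab=n} (log a)^μ (log b)^ν`. -/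
noncomputable def dGen (μ ν : ℕ) (n : ℕ) : ℝ :=
  ∑ x ∈ n.divisorsAntidiagonal, Real.log x.1 ^ μ * Real.log x.2 ^ ν

/-- A Fejér-type weight on `ℤ` whose Fourier transform is supported in `[-1/R, 1/R]`. -/
noncomputable def fejerWeight (R : ℕ) (n : ℤ) : ℝ :=
  if n = 0 then 2 * Real.pi ^ 2 / (R : ℝ) ^ 2
  else (1 - Real.cos (2 * Real.pi * n / R)) / (n : ℝ) ^ 2

lemma fejerWeight_nonneg (R : ℕ) (n : ℤ) : 0 ≤ fejerWeight R n := by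
  unfold fejerWeight
  split_ifs
  · positivity
  · have := Real.cos_le_one (2 * Real.pi * n / R)
    exact div_nonneg (by linarith) (by positivity)

lemma fejerWeight_neg (R : ℕ) (n : ℤ) : fejerWeight R (-n) = fejerWeight R n := by
  unfold fejerWeight
  by_cases h : n = 0
  · simp [h]
  · simp only [neg_eq_zero, h, if_false]
    congr 1
    · congr 1
      rw [← Real.cos_neg]
      congr 1
      push_cast
      ring
    · push_cast
      ring

lemma hasSum_cos_div_sq {x : ℝ} (hx : x ∈ Set.Icc (0 : ℝ) 1) :
    HasSum (fun n : ℕ => 1 / (n : ℝ) ^ 2 * Real.cos (2 * Real.pi * n * x))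
      (Real.pi ^ 2 * (x ^ 2 - x + 1 / 6)) := by
  have h := hasSum_one_div_nat_pow_mul_cos one_ne_zero hx
  convert! h using 1
  have : Polynomial.bernoulli 2 = Polynomial.X ^ 2 - Polynomial.X + Polynomial.C (1/6 : ℚ) := by
    rw [Polynomial.bernoulli]
    simp [Finset.sum_range_succ, bernoulli_two, bernoulli_one]
    rw [← Polynomial.C_mul_X_pow_eq_monomial, ← Polynomial.C_mul_X_pow_eq_monomial]
    simp
    ring
  rw [show 2 * 1 = 2 from rfl, this]
  simp only [Polynomial.map_add, Polynomial.map_sub, Polynomial.map_pow, Polynomial.map_X,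
    Polynomial.map_C, Polynomial.eval_add, Polynomial.eval_sub, Polynomial.eval_pow,
    Polynomial.eval_X, Polynomial.eval_C, Nat.factorial]
  simp only [eq_ratCast]
  push_cast
  ring

lemma hasSum_fejerWeight_mul_cos_nat {R : ℕ} {θ a b : ℝ}
    (hθ : θ ∈ Set.Icc (0 : ℝ) 1) (ha : a ∈ Set.Icc (0 : ℝ) 1) (hb : b ∈ Set.Icc (0 : ℝ) 1)
    (hab : ∀ n : ℕ, Real.cos (2 * Real.pi * n / R) * Real.cos (2 * Real.pi * n * θ) =
      (Real.cos (2 * Real.pi * n * a) + Real.cos (2 * Real.pi * n * b)) / 2) :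
    HasSum (fun n : ℕ => fejerWeight R n * Real.cos (2 * Real.pi * n * θ))
      (2 * Real.pi ^ 2 / (R : ℝ) ^ 2 + Real.pi ^ 2 * ((θ ^ 2 - θ) -
        ((a ^ 2 - a) + (b ^ 2 - b)) / 2)) := by
  have h := (hasSum_cos_div_sq hθ).sub
    (((hasSum_cos_div_sq ha).add (hasSum_cos_div_sq hb)).div_const 2)
  have h0 := hasSum_ite_eq (0 : ℕ) (2 * Real.pi ^ 2 / (R : ℝ) ^ 2)
  convert! h0.add h using 1
  · funext n
    by_cases hn : n = 0
    · simp [hn, fejerWeight]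
    · simp only [fejerWeight, Nat.cast_eq_zero, hn, if_false, zero_add, Int.cast_natCast]
      rw [← mul_add, mul_div_assoc (1 / (n : ℝ) ^ 2), ← hab n]
      ring
  · ring

lemma hasSum_fejerWeight_mul_cos_int {R : ℕ} {θ s : ℝ}
    (h : HasSum (fun n : ℕ => fejerWeight R n * Real.cos (2 * Real.pi * n * θ)) s) :
    HasSum (fun n : ℤ => fejerWeight R n * Real.cos (2 * Real.pi * n * θ))
      (2 * s - 2 * Real.pi ^ 2 / (R : ℝ) ^ 2) := by
  have h2 := HasSum.of_nat_of_neg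
    (f := fun n : ℤ => fejerWeight R n * Real.cos (2 * Real.pi * n * θ)) (g := s) (g' := s)
    (by simpa using h) (by simpa [fejerWeight_neg] using h)
  convert! h2 using 1
  simp [fejerWeight]
  ring

lemma hasSum_fejerWeight_mul_cos {R : ℕ} (hR : 0 < R) {θ : ℝ} (h1 : 1 / (R : ℝ) ≤ θ)
    (h2 : θ ≤ 1 - 1 / R) :
    HasSum (fun n : ℤ => fejerWeight R n * Real.cos (2 * Real.pi * n * θ)) 0 := by
  have hR' : (0 : ℝ) < 1 / R := by positivity
  have := hasSum_fejerWeight_mul_cos_int (hasSum_fejerWeight_mul_cos_nat (R := R) (θ := θ)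
    (a := θ + 1 / R) (b := θ - 1 / R) ⟨by linarith, by linarith⟩ ⟨by linarith, by linarith⟩
    ⟨by linarith, by linarith⟩ (fun n => by
      rw [show 2 * Real.pi * n * (θ + 1 / R) = 2 * Real.pi * n * θ + 2 * Real.pi * n / R by ring,
        show 2 * Real.pi * n * (θ - 1 / R) = 2 * Real.pi * n * θ - 2 * Real.pi * n / R by ring,
        Real.cos_add, Real.cos_sub]
      ring))
  convert! this using 1
  ring

lemma hasSum_fejerWeight {R : ℕ} (hR : 0 < R) :
    HasSum (fejerWeight R) (2 * Real.pi ^ 2 / R) := by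
  have hR' : (1 : ℝ) / R ≤ 1 := by
    rw [div_le_one (by positivity)]
    exact_mod_cast hR
  have hR'' : (0 : ℝ) < 1 / R := by positivity
  have := hasSum_fejerWeight_mul_cos_int (hasSum_fejerWeight_mul_cos_nat (R := R) (θ := 0)
    (a := 1 / R) (b := 1 / R) ⟨by linarith, by linarith⟩ ⟨by linarith, by linarith⟩
    ⟨by linarith, by linarith⟩ (fun n => by
      rw [show 2 * Real.pi * n * (1 / R) = 2 * Real.pi * n / R by ring]
      simp))
  simp only [mul_zero, Real.cos_zero, mul_one] at this
  convert! this using 1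
  ring

lemma hasSum_fejerWeight_mul_sin {R : ℕ} (hR : 0 < R) (θ : ℝ) :
    HasSum (fun n : ℤ => fejerWeight R n * Real.sin (2 * Real.pi * n * θ)) 0 := by
  have hs : Summable (fun n : ℤ => fejerWeight R n * Real.sin (2 * Real.pi * n * θ)) := by
    refine Summable.of_norm_bounded (hasSum_fejerWeight hR).summable (fun n => ?_)
    rw [norm_mul, Real.norm_of_nonneg (fejerWeight_nonneg R n)]
    exact mul_le_of_le_one_right (fejerWeight_nonneg R n) (Real.abs_sin_le_one _)
  have h1 := hs.hasSum
  have h2 := (Equiv.neg ℤ).hasSum_iff.mpr h1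
  have h3 := h1.add h2
  have : (fun n : ℤ => fejerWeight R n * Real.sin (2 * Real.pi * n * θ) +
      ((fun n : ℤ => fejerWeight R n * Real.sin (2 * Real.pi * n * θ)) ∘ (Equiv.neg ℤ)) n) =
      fun _ => 0 := by
    funext n
    simp [fejerWeight_neg]
  rw [this] at h3
  have h4 := h3.unique hasSum_zero
  rw [show (∑' n : ℤ, fejerWeight R n * Real.sin (2 * Real.pi * n * θ)) = 0 by linarith] at h1
  exact h1

lemma sum_range_cos_two_pi {L : ℕ} (hL : 0 < L) (m : ℤ) :
    ∑ k ∈ Finset.range L, Real.cos (2 * Real.pi * m * (k / L)) =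
      if (L : ℤ) ∣ m then (L : ℝ) else 0 := by
  set z : ℂ := Complex.exp (2 * Real.pi * I * (m / L)) with hz
  have hL' : (L : ℂ) ≠ 0 := by exact_mod_cast hL.ne'
  have hpow : ∀ k : ℕ, Real.cos (2 * Real.pi * m * (k / L)) = (z ^ k).re := by
    intro k
    rw [hz, ← Complex.exp_nat_mul, ← Complex.exp_ofReal_mul_I_re]
    congr 2
    push_cast
    ring
  rw [Finset.sum_congr rfl (fun k _ => hpow k), ← Complex.re_sum]
  have hzL : z ^ L = 1 := by
    rw [hz, ← Complex.exp_nat_mul, Complex.exp_eq_one_iff]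
    exact ⟨m, by field_simp⟩
  split_ifs with h
  · obtain ⟨q, rfl⟩ := h
    have : z = 1 := by
      rw [hz, Complex.exp_eq_one_iff]
      exact ⟨q, by push_cast; field_simp⟩
    simp [this]
  · have hz1 : z ≠ 1 := by
      intro h1
      rw [hz, Complex.exp_eq_one_iff] at h1
      obtain ⟨q, hq⟩ := h1
      apply h
      refine ⟨q, ?_⟩
      have hpi : (2 * Real.pi * I : ℂ) ≠ 0 := Complex.two_pi_I_ne_zero
      have : (m / L : ℂ) = q := by
        apply mul_left_cancel₀ hpi
        rw [hq]
        ring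
      rw [div_eq_iff hL'] at this
      have h2 : (m : ℂ) = ((L * q : ℤ) : ℂ) := by
        rw [this]
        push_cast
        ring
      exact_mod_cast h2
    rw [geom_sum_eq hz1, hzL]
    simp

/-- The weight is equidistributed over the residue classes to every modulus at most `R`. -/
lemma hasSum_fejerWeight_dvd {R L : ℕ} (hL : 0 < L) (hLR : L ≤ R) (r : ℤ) :
    HasSum (fun n : ℤ => fejerWeight R n * (if (L : ℤ) ∣ n - r then (1 : ℝ) else 0))
      (2 * Real.pi ^ 2 / R / L) := by
  have hR : 0 < R := lt_of_lt_of_le hL hLR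
  have hk : ∀ k ∈ Finset.range L, HasSum (fun n : ℤ => fejerWeight R n *
      Real.cos (2 * Real.pi * (n - r : ℤ) * (k / L))) (if k = 0 then 2 * Real.pi ^ 2 / R else 0) := by
    intro k hk
    have hkL := Finset.mem_range.mp hk
    split_ifs with h0
    · simpa [h0] using hasSum_fejerWeight hR
    · have hc : HasSum (fun n : ℤ => fejerWeight R n *
          Real.cos (2 * Real.pi * n * (k / L))) 0 := by
        apply hasSum_fejerWeight_mul_cos hR
        · rw [div_le_div_iff₀ (by positivity) (by positivity)]
          have : 1 ≤ k := Nat.one_le_iff_ne_zero.mpr h0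
          exact_mod_cast Nat.mul_le_mul this hLR
        · have h1 : (1 : ℝ) / R ≤ 1 / L := by
            apply one_div_le_one_div_of_le (by positivity)
            exact_mod_cast hLR
          have h2 : (k : ℝ) / L ≤ 1 - 1 / L := by
            rw [le_sub_iff_add_le, ← add_div, div_le_one (by positivity)]
            exact_mod_cast hkL
          linarith
      have hs := hasSum_fejerWeight_mul_sin hR (k / L)
      have := (hc.mul_right (Real.cos (2 * Real.pi * r * (k / L)))).add
        (hs.mul_right (Real.sin (2 * Real.pi * r * (k / L))))
      simp only [zero_mul, add_zero] at this
      convert! this using 1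
      funext n
      rw [show 2 * Real.pi * ((n - r : ℤ) : ℝ) * (k / L) = 2 * Real.pi * n * (k / L) -
        2 * Real.pi * r * (k / L) by push_cast; ring, Real.cos_sub]
      ring
  have h := (hasSum_sum hk).div_const (L : ℝ)
  convert! h using 1
  · funext n
    rw [← Finset.mul_sum, sum_range_cos_two_pi hL]
    split_ifs
    · field_simp
    · simp
  · rw [Finset.sum_ite_eq' (Finset.range L) 0]
    simp [hL]

lemma fejerWeight_ge {R : ℕ} (hR : 0 < R) {n : ℤ} (hn0 : 0 ≤ n) (hn : 2 * n ≤ R) :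
    8 / (R : ℝ) ^ 2 ≤ fejerWeight R n := by
  have hpi := Real.pi_gt_three
  unfold fejerWeight
  split_ifs with h
  · apply div_le_div_of_nonneg_right _ (by positivity)
    nlinarith
  · have hn1 : (0 : ℝ) < n := by exact_mod_cast lt_of_le_of_ne hn0 (Ne.symm h)
    have hRp : (0 : ℝ) < R := by exact_mod_cast hR
    have hn2 : 2 * (n : ℝ) ≤ R := by exact_mod_cast hn
    rw [show 2 * Real.pi * n / R = 2 * (Real.pi * n / R) by ring, Real.cos_two_mul,
      Real.cos_sq']
    have h1 := Real.mul_le_sin (x := Real.pi * n / R) (by positivity) (by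
      rw [div_le_div_iff₀ hRp two_pos]
      nlinarith)
    rw [show 2 / Real.pi * (Real.pi * n / R) = 2 * n / R by field_simp] at h1
    have h2 : (2 * n / R : ℝ) ^ 2 ≤ Real.sin (Real.pi * n / R) ^ 2 :=
      pow_le_pow_left₀ (by positivity) h1 2
    rw [le_div_iff₀ (by positivity)]
    calc 8 / (R : ℝ) ^ 2 * n ^ 2 = 2 * (2 * n / R : ℝ) ^ 2 := by ring
      _ ≤ _ := by linarith

/-- The number of multiples of `a` in `(m, m + h]`, minus its expected value `h / a`. -/
noncomputable def mulDisc (a h : ℕ) (m : ℤ) : ℝ :=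
  ∑ i ∈ Finset.range h, ((if (a : ℤ) ∣ m + (i + 1) then (1 : ℝ) else 0) - 1 / a)

lemma hasSum_fejerWeight_dvd_dvd {R a b : ℕ} (ha : 0 < a) (hb : 0 < b) (hab : a * b ≤ R) (i j : ℤ) :
    HasSum (fun n : ℤ => fejerWeight R n *
      ((if (a : ℤ) ∣ n + i then (1 : ℝ) else 0) * (if (b : ℤ) ∣ n + j then (1 : ℝ) else 0)))
      (2 * Real.pi ^ 2 / R / (a * b) *
        (if ((a.gcd b : ℕ) : ℤ) ∣ i - j then (a.gcd b : ℝ) else 0)) := by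
  have hg : 0 < a.gcd b := Nat.gcd_pos_of_pos_left _ ha
  split_ifs with h
  · have hl : 0 < a.lcm b := Nat.lcm_pos ha hb
    have hlR : a.lcm b ≤ R := (Nat.le_of_dvd (by positivity) (Nat.lcm_dvd_mul a b)).trans hab
    obtain ⟨r, hr1, hr2⟩ : ∃ r : ℤ, (a : ℤ) ∣ r + i ∧ (b : ℤ) ∣ r + j := by
      obtain ⟨q, hq⟩ := h
      have hbez := Nat.gcd_eq_gcd_ab a b
      refine ⟨-i + a * (a.gcdA b * q), ⟨a.gcdA b * q, by ring⟩, ⟨-(a.gcdB b * q), ?_⟩⟩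
      have : i - j = (a * a.gcdA b + b * a.gcdB b) * q := by rw [← hbez]; exact hq
      linarith
    have := hasSum_fejerWeight_dvd hl hlR r
    convert! this using 1
    · ext n
      congr 1
      have e1 : (a : ℤ) ∣ n + i ↔ (a : ℤ) ∣ n - r := by
        rw [show n + i = (n - r) + (r + i) by ring]
        exact dvd_add_left hr1
      have e2 : (b : ℤ) ∣ n + j ↔ (b : ℤ) ∣ n - r := by
        rw [show n + j = (n - r) + (r + j) by ring]
        exact dvd_add_left hr2
      have e3 : ((a.lcm b : ℕ) : ℤ) ∣ n - r ↔ (a : ℤ) ∣ n - r ∧ (b : ℤ) ∣ n - r := by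
        rw [Int.natCast_dvd, Int.natCast_dvd, Int.natCast_dvd]
        exact Nat.lcm_dvd_iff
      rw [if_congr e1 rfl rfl, if_congr e2 rfl rfl, if_congr e3 rfl rfl, ite_and]
      split_ifs <;> simp
    · have : (a.gcd b : ℝ) * (a.lcm b : ℝ) = a * b := by exact_mod_cast Nat.gcd_mul_lcm a b
      rw [← this]
      have hl' : (a.lcm b : ℝ) ≠ 0 := by positivity
      have hg' : (a.gcd b : ℝ) ≠ 0 := by positivity
      have hR : (R : ℝ) ≠ 0 := by
        have : 0 < R := by nlinarith
        positivity
      field_simp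
  · rw [mul_zero]
    refine hasSum_zero.congr_fun (fun n => ?_)
    rw [mul_eq_zero]
    right
    split_ifs with h1 h2
    · exfalso
      apply h
      have ga : ((a.gcd b : ℕ) : ℤ) ∣ a := by exact_mod_cast Nat.gcd_dvd_left a b
      have gb : ((a.gcd b : ℕ) : ℤ) ∣ b := by exact_mod_cast Nat.gcd_dvd_right a b
      have := dvd_sub (ga.trans h1) (gb.trans h2)
      rwa [show n + i - (n + j) = i - j by ring] at this
    all_goals simp

lemma hasSum_fejerWeight_mulDisc {R a b : ℕ} (ha : 0 < a) (hb : 0 < b) (hab : a * b ≤ R) (h : ℕ) :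
    HasSum (fun n : ℤ => fejerWeight R n * (mulDisc a h n * mulDisc b h n))
      (2 * Real.pi ^ 2 / R / (a * b) * ∑ i ∈ Finset.range h, ∑ j ∈ Finset.range h,
        ((if ((a.gcd b : ℕ) : ℤ) ∣ (i : ℤ) - j then (a.gcd b : ℝ) else 0) - 1)) := by
  have hR : 0 < R := by nlinarith
  have key : ∀ i ∈ Finset.range h, ∀ j ∈ Finset.range h, HasSum (fun n : ℤ => fejerWeight R n *
      (((if (a : ℤ) ∣ n + (i + 1) then (1 : ℝ) else 0) - 1 / a) *
       ((if (b : ℤ) ∣ n + (j + 1) then (1 : ℝ) else 0) - 1 / b)))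
      (2 * Real.pi ^ 2 / R / (a * b) *
        ((if ((a.gcd b : ℕ) : ℤ) ∣ (i : ℤ) - j then (a.gcd b : ℝ) else 0) - 1)) := by
    intro i _ j _
    have h1 := hasSum_fejerWeight_dvd_dvd ha hb hab (i + 1) (j + 1)
    have h2 := (hasSum_fejerWeight_dvd ha (by nlinarith : a ≤ R) (-(i + 1))).mul_right (1 / (b : ℝ))
    have h3 := (hasSum_fejerWeight_dvd hb (by nlinarith : b ≤ R) (-(j + 1))).mul_right (1 / (a : ℝ))
    have h4 := (hasSum_fejerWeight hR).mul_right (1 / (a : ℝ) * (1 / b))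
    have := ((h1.sub h2).sub h3).add h4
    convert! this using 1
    · ext n
      simp only [sub_neg_eq_add]
      ring
    · rw [show (i : ℤ) + 1 - (j + 1) = i - j by ring]
      have : (a : ℝ) ≠ 0 := by positivity
      have : (b : ℝ) ≠ 0 := by positivity
      field_simp
      ring
  have := hasSum_sum (fun i hi => hasSum_sum (fun j hj => key i hi j hj))
  convert! this using 1
  · ext n
    unfold mulDisc
    rw [Finset.sum_mul_sum, Finset.mul_sum]
    refine Finset.sum_congr rfl (fun i _ => ?_)
    rw [Finset.mul_sum]
  · rw [Finset.mul_sum]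
    refine Finset.sum_congr rfl (fun i _ => ?_)
    rw [Finset.mul_sum]

lemma abs_sum_dvd_sub_le {g : ℕ} (hg : 0 < g) (h : ℕ) (r : ℤ) :
    |∑ j ∈ Finset.range h, ((if (g : ℤ) ∣ r - j then (g : ℝ) else 0) - 1)| ≤ g := by
  have hg' : (0 : ℤ) < g := by exact_mod_cast hg
  have hgr : (0 : ℝ) < g := by exact_mod_cast hg
  have hcard : ((Finset.range h).filter (fun j : ℕ => (g : ℤ) ∣ r - j)).card =
      ((Finset.Ico (0:ℤ) h).filter (fun x => x ≡ r [ZMOD g])).card := by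
    refine Finset.card_bij (fun j _ => (j : ℤ)) ?_ ?_ ?_
    · intro j hj
      simp only [Finset.mem_filter, Finset.mem_range, Finset.mem_Ico] at hj ⊢
      refine ⟨⟨by positivity, by exact_mod_cast hj.1⟩, ?_⟩
      exact Int.modEq_iff_dvd.mpr hj.2
    · intro j _ j' _ hjj
      exact_mod_cast hjj
    · intro x hx
      simp only [Finset.mem_filter, Finset.mem_Ico] at hx
      refine ⟨x.toNat, ?_, by simp [hx.1.1]⟩
      simp only [Finset.mem_filter, Finset.mem_range]
      refine ⟨by omega, ?_⟩
      rw [Int.toNat_of_nonneg hx.1.1]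
      exact Int.modEq_iff_dvd.mp hx.2
  have hc2 := Int.Ico_filter_modEq_card 0 (h : ℤ) hg' r
  have hsum : ∑ j ∈ Finset.range h, ((if (g : ℤ) ∣ r - j then (g : ℝ) else 0) - 1) =
      g * (((Finset.range h).filter (fun j : ℕ => (g : ℤ) ∣ r - j)).card : ℝ) - h := by
    rw [Finset.sum_sub_distrib, ← Finset.sum_filter]
    simp
    ring
  rw [hsum, hcard]
  set N := ((Finset.Ico (0:ℤ) h).filter (fun x => x ≡ r [ZMOD g])).card
  have c1 := Int.le_ceil (((h : ℤ) - r : ℚ) / (g : ℤ))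
  have c2 := Int.ceil_lt_add_one (((h : ℤ) - r : ℚ) / (g : ℤ))
  have c3 := Int.le_ceil (((0 : ℤ) - r : ℚ) / (g : ℤ))
  have c4 := Int.ceil_lt_add_one (((0 : ℤ) - r : ℚ) / (g : ℤ))
  have hgq : (0 : ℚ) < g := by exact_mod_cast hg
  set u := ⌈((h : ℤ) - r : ℚ) / (g : ℤ)⌉
  set v := ⌈((0 : ℤ) - r : ℚ) / (g : ℤ)⌉
  have hN : (N : ℤ) = u - v := by
    rw [hc2]
    apply max_eq_left
    have : v ≤ u := Int.ceil_mono (by push_cast; gcongr; positivity)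
    omega
  push_cast at c1 c2 c3 c4
  rw [div_le_iff₀ hgq] at c1 c3
  rw [← sub_lt_iff_lt_add, lt_div_iff₀ hgq] at c2 c4
  have h1 : (g : ℚ) * N - h ≤ g := by
    have : (N : ℚ) = u - v := by exact_mod_cast hN
    rw [this]; nlinarith
  have h2 : -(g : ℚ) ≤ (g : ℚ) * N - h := by
    have : (N : ℚ) = u - v := by exact_mod_cast hN
    rw [this]; nlinarith
  rw [abs_le]
  constructor
  · exact_mod_cast h2
  · exact_mod_cast h1

lemma sum_gcd_div_le (A : ℕ) :
    ∑ a ∈ Finset.Icc 1 A, ∑ b ∈ Finset.Icc 1 A, (a.gcd b : ℝ) / (a * b) ≤ (1 + Real.log A) ^ 3 := by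
  have hle : ∀ a ∈ Finset.Icc 1 A, ∀ b ∈ Finset.Icc 1 A, (a.gcd b : ℝ) / (a * b) ≤
      ∑ d ∈ Finset.Icc 1 A, (d : ℝ) * ((if d ∣ a then 1 / (a : ℝ) else 0) *
        (if d ∣ b then 1 / (b : ℝ) else 0)) := by
    intro a ha b hb
    simp only [Finset.mem_Icc] at ha hb
    have hg : a.gcd b ∈ Finset.Icc 1 A := by
      simp only [Finset.mem_Icc]
      exact ⟨Nat.gcd_pos_of_pos_left _ (by omega), (Nat.gcd_le_left _ (by omega)).trans ha.2⟩
    refine le_trans (le_of_eq ?_) (Finset.single_le_sum (f := fun d : ℕ => (d : ℝ) *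
      ((if d ∣ a then 1 / (a : ℝ) else 0) * (if d ∣ b then 1 / (b : ℝ) else 0))) ?_ hg)
    · simp only [Nat.gcd_dvd_left, Nat.gcd_dvd_right, if_true]
      have : (a : ℝ) ≠ 0 := by have := ha.1; positivity
      have : (b : ℝ) ≠ 0 := by have := hb.1; positivity
      field_simp
    · intro d _
      split_ifs <;> positivity
  have hinner : ∀ d ∈ Finset.Icc 1 A, ∑ a ∈ Finset.Icc 1 A, (if d ∣ a then 1 / (a : ℝ) else 0) ≤
      1 / d * (1 + Real.log A) := by
    intro d hd
    simp only [Finset.mem_Icc] at hd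
    have hd0 : (0 : ℝ) < d := by have := hd.1; positivity
    rw [← Finset.sum_filter]
    have : ∑ a ∈ (Finset.Icc 1 A).filter (d ∣ ·), 1 / (a : ℝ) ≤
        ∑ q ∈ Finset.Icc 1 A, 1 / ((d * q : ℕ) : ℝ) := by
      rw [← Finset.sum_image (f := fun a : ℕ => 1 / (a : ℝ)) (g := fun q => d * q)
        (s := Finset.Icc 1 A) (fun x _ y _ hxy => Nat.eq_of_mul_eq_mul_left hd.1 hxy)]
      apply Finset.sum_le_sum_of_subset_of_nonneg
      · intro a ha
        simp only [Finset.mem_filter, Finset.mem_Icc, Finset.mem_image] at ha ⊢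
        obtain ⟨⟨h1, h2⟩, q, rfl⟩ := ha
        refine ⟨q, ⟨Nat.pos_of_ne_zero (by rintro rfl; simp at h1), ?_⟩, rfl⟩
        exact (Nat.le_mul_of_pos_left _ hd.1).trans h2
      · intro i _ _
        positivity
    refine this.trans ?_
    have hh := harmonic_le_one_add_log A
    rw [harmonic_eq_sum_Icc] at hh
    push_cast at hh
    have : ∑ q ∈ Finset.Icc 1 A, 1 / ((d * q : ℕ) : ℝ) = 1 / d * ∑ q ∈ Finset.Icc 1 A, (q : ℝ)⁻¹ := by
      rw [Finset.mul_sum]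
      refine Finset.sum_congr rfl (fun q _ => ?_)
      push_cast
      rw [one_div, mul_inv, one_div]
    rw [this]
    gcongr
  have hlog : 0 ≤ 1 + Real.log A := by
    have := Real.log_natCast_nonneg A
    linarith
  calc _ ≤ ∑ a ∈ Finset.Icc 1 A, ∑ b ∈ Finset.Icc 1 A, ∑ d ∈ Finset.Icc 1 A, (d : ℝ) *
        ((if d ∣ a then 1 / (a : ℝ) else 0) * (if d ∣ b then 1 / (b : ℝ) else 0)) :=
        Finset.sum_le_sum (fun a ha => Finset.sum_le_sum (fun b hb => hle a ha b hb))
    _ = ∑ d ∈ Finset.Icc 1 A, (d : ℝ) * ((∑ a ∈ Finset.Icc 1 A, (if d ∣ a then 1 / (a : ℝ) else 0)) *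
        (∑ b ∈ Finset.Icc 1 A, (if d ∣ b then 1 / (b : ℝ) else 0))) := by
        simp_rw [Finset.sum_mul_sum, Finset.mul_sum]
        rw [Finset.sum_comm (s := Finset.Icc 1 A) (t := Finset.Icc 1 A)
          (f := fun d a => ∑ b ∈ Finset.Icc 1 A, (d : ℝ) *
            ((if d ∣ a then 1 / (a : ℝ) else 0) * (if d ∣ b then 1 / (b : ℝ) else 0)))]
        refine Finset.sum_congr rfl (fun a _ => ?_)
        rw [Finset.sum_comm]
    _ ≤ ∑ d ∈ Finset.Icc 1 A, (d : ℝ) * ((1 / d * (1 + Real.log A)) * (1 / d * (1 + Real.log A))) := by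
        refine Finset.sum_le_sum (fun d hd => ?_)
        have hn : 0 ≤ ∑ a ∈ Finset.Icc 1 A, (if d ∣ a then 1 / (a : ℝ) else 0) :=
          Finset.sum_nonneg (fun a _ => by split_ifs <;> positivity)
        have := hinner d hd
        gcongr
    _ = (∑ d ∈ Finset.Icc 1 A, (d : ℝ)⁻¹) * (1 + Real.log A) ^ 2 := by
        rw [Finset.sum_mul]
        refine Finset.sum_congr rfl (fun d hd => ?_)
        simp only [Finset.mem_Icc] at hd
        have : (d : ℝ) ≠ 0 := by have := hd.1; positivity
        field_simp
    _ ≤ (1 + Real.log A) * (1 + Real.log A) ^ 2 := by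
        have hh := harmonic_le_one_add_log A
        rw [harmonic_eq_sum_Icc] at hh
        push_cast at hh
        gcongr
    _ = _ := by ring

/-- A large-sieve type inequality for the discrepancies `mulDisc`. -/
lemma sum_sq_mulDisc_le {R A M h : ℕ} (hR : 0 < R) (hA : A * A ≤ R) (hM : 2 * M ≤ R) (c : ℕ → ℝ)
    {L : ℝ} (hc : ∀ a ∈ Finset.Icc 1 A, |c a| ≤ L) :
    ∑ m ∈ Finset.range (M + 1), (∑ a ∈ Finset.Icc 1 A, c a * mulDisc a h m) ^ 2 ≤
      3 * R * h * (1 + Real.log A) ^ 3 * L ^ 2 := by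
  have hs : HasSum (fun n : ℤ => fejerWeight R n * (∑ a ∈ Finset.Icc 1 A, c a * mulDisc a h n) ^ 2)
      (∑ a ∈ Finset.Icc 1 A, ∑ b ∈ Finset.Icc 1 A, c a * c b *
        (2 * Real.pi ^ 2 / R / (a * b) * ∑ i ∈ Finset.range h, ∑ j ∈ Finset.range h,
        ((if ((a.gcd b : ℕ) : ℤ) ∣ (i : ℤ) - j then (a.gcd b : ℝ) else 0) - 1))) := by
    have := hasSum_sum (s := Finset.Icc 1 A) (fun a ha => hasSum_sum (s := Finset.Icc 1 A)
      (fun b hb => (hasSum_fejerWeight_mulDisc (R := R) (a := a) (b := b)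
        (Finset.mem_Icc.mp ha).1 (Finset.mem_Icc.mp hb).1
        ((Nat.mul_le_mul (Finset.mem_Icc.mp ha).2 (Finset.mem_Icc.mp hb).2).trans hA) h).mul_left
          (c a * c b)))
    convert! this using 1
    ext n
    rw [pow_two, Finset.sum_mul_sum, Finset.mul_sum]
    refine Finset.sum_congr rfl (fun a _ => ?_)
    rw [Finset.mul_sum]
    refine Finset.sum_congr rfl (fun b _ => ?_)
    ring
  have hupper : (∑ a ∈ Finset.Icc 1 A, ∑ b ∈ Finset.Icc 1 A, c a * c b *
        (2 * Real.pi ^ 2 / R / (a * b) * ∑ i ∈ Finset.range h, ∑ j ∈ Finset.range h,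
        ((if ((a.gcd b : ℕ) : ℤ) ∣ (i : ℤ) - j then (a.gcd b : ℝ) else 0) - 1))) ≤
      L ^ 2 * (2 * Real.pi ^ 2 / R * h) * (1 + Real.log A) ^ 3 := by
    calc _ ≤ ∑ a ∈ Finset.Icc 1 A, ∑ b ∈ Finset.Icc 1 A, L ^ 2 * (2 * Real.pi ^ 2 / R * h) *
          ((a.gcd b : ℝ) / (a * b)) := by
          refine Finset.sum_le_sum (fun a ha => Finset.sum_le_sum (fun b hb => ?_))
          have hL : 0 ≤ L := (abs_nonneg _).trans (hc a ha)
          refine (le_abs_self _).trans ?_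
          rw [abs_mul, abs_mul, abs_mul]
          have e1 : |2 * Real.pi ^ 2 / R / (a * b)| = 2 * Real.pi ^ 2 / R / (a * b) :=
            abs_of_nonneg (by positivity)
          rw [e1]
          have hg : 0 < a.gcd b := Nat.gcd_pos_of_pos_left _ (Finset.mem_Icc.mp ha).1
          have e2 : |∑ i ∈ Finset.range h, ∑ j ∈ Finset.range h,
              ((if ((a.gcd b : ℕ) : ℤ) ∣ (i : ℤ) - j then (a.gcd b : ℝ) else 0) - 1)| ≤
              h * (a.gcd b) := by
            refine (Finset.abs_sum_le_sum_abs _ _).trans ?_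
            refine (Finset.sum_le_sum (g := fun _ => (a.gcd b : ℝ))
              (fun (i : ℕ) _ => abs_sum_dvd_sub_le hg h (i : ℤ))).trans ?_
            simp
          calc _ ≤ L * L * (2 * Real.pi ^ 2 / R / (a * b) * (h * (a.gcd b))) := by
                gcongr
                · exact hc a ha
                · exact hc b hb
            _ = _ := by ring
      _ = L ^ 2 * (2 * Real.pi ^ 2 / R * h) *
          ∑ a ∈ Finset.Icc 1 A, ∑ b ∈ Finset.Icc 1 A, (a.gcd b : ℝ) / (a * b) := by
          simp_rw [Finset.mul_sum]
      _ ≤ _ := by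
          gcongr
          exact sum_gcd_div_le A
  have hlow : ∑ m ∈ Finset.range (M + 1), fejerWeight R (m : ℤ) *
      (∑ a ∈ Finset.Icc 1 A, c a * mulDisc a h m) ^ 2 ≤
      (∑ a ∈ Finset.Icc 1 A, ∑ b ∈ Finset.Icc 1 A, c a * c b *
        (2 * Real.pi ^ 2 / R / (a * b) * ∑ i ∈ Finset.range h, ∑ j ∈ Finset.range h,
        ((if ((a.gcd b : ℕ) : ℤ) ∣ (i : ℤ) - j then (a.gcd b : ℝ) else 0) - 1))) := by
    have := sum_le_hasSum ((Finset.range (M + 1)).map Nat.castEmbedding)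
      (fun n _ => mul_nonneg (fejerWeight_nonneg R n) (sq_nonneg _)) hs
    rw [Finset.sum_map] at this
    exact this
  have hR0 : (0 : ℝ) < R := by exact_mod_cast hR
  have h8 : 8 / (R : ℝ) ^ 2 * ∑ m ∈ Finset.range (M + 1),
      (∑ a ∈ Finset.Icc 1 A, c a * mulDisc a h m) ^ 2 ≤
      ∑ m ∈ Finset.range (M + 1), fejerWeight R (m : ℤ) *
      (∑ a ∈ Finset.Icc 1 A, c a * mulDisc a h m) ^ 2 := by
    rw [Finset.mul_sum]
    refine Finset.sum_le_sum (fun m hm => ?_)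
    gcongr
    have hm' := Finset.mem_range.mp hm
    exact fejerWeight_ge hR (by positivity) (by omega)
  have hfin := h8.trans (hlow.trans hupper)
  rw [div_mul_eq_mul_div, div_le_iff₀ (by positivity)] at hfin
  have hpi : Real.pi ^ 2 ≤ 12 := by
    have := Real.pi_lt_d2
    have := Real.pi_pos
    nlinarith
  have hlog : 0 ≤ 1 + Real.log A := by
    have := Real.log_natCast_nonneg A
    linarith
  have e : L ^ 2 * (2 * Real.pi ^ 2 / R * h) * (1 + Real.log A) ^ 3 * (R : ℝ) ^ 2 =
      2 * Real.pi ^ 2 * (L ^ 2 * h * (1 + Real.log A) ^ 3 * R) := by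
    field_simp
  rw [e] at hfin
  have hnn : 0 ≤ L ^ 2 * h * (1 + Real.log A) ^ 3 * R := by positivity
  nlinarith

lemma pow_le_const_mul_exp (i : ℕ) {ε : ℝ} (hε : 0 < ε) {σ : ℝ} (hσ : 0 ≤ σ) :
    σ ^ i ≤ (Nat.factorial i / ε ^ i) * Real.exp (ε * σ) := by
  have h := Real.pow_div_factorial_le_exp (ε * σ) (by positivity) i
  rw [div_le_iff₀ (by positivity), mul_pow] at h
  rw [div_mul_eq_mul_div, le_div_iff₀ (by positivity)]
  linarith

lemma log_pow_le_const_mul_rpow (i : ℕ) {ε : ℝ} (hε : 0 < ε) {y : ℝ} (hy : 1 ≤ y) :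
    Real.log y ^ i ≤ (Nat.factorial i / ε ^ i) * y ^ ε := by
  have := pow_le_const_mul_exp i hε (Real.log_nonneg hy)
  rwa [Real.rpow_def_of_pos (by linarith), mul_comm (Real.log y)]

/-- First-order Euler–Maclaurin estimate, localised at the left endpoint. -/
lemma abs_sum_sub_integral_sub_le {g g' : ℝ → ℝ} {a b : ℝ} (ha : 0 ≤ a) (hab : a ≤ b)
    (hg : ∀ t ∈ Set.Icc a b, HasDerivAt g (g' t) t) (hg' : ContinuousOn g' (Set.Icc a b)) :
    |∑ n ∈ Finset.Ioc ⌊a⌋₊ ⌊b⌋₊, g n - (∫ t in a..b, g t) -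
      g a * (((⌊b⌋₊ : ℝ) - ⌊a⌋₊) - (b - a))| ≤ 2 * ∫ t in a..b, |g' t| := by
  have hu : Set.uIcc a b = Set.Icc a b := Set.uIcc_of_le hab
  have hInt : IntervalIntegrable g' MeasureTheory.volume a b :=
    ContinuousOn.intervalIntegrable (by rwa [hu])
  have hderiv : ∀ t ∈ Set.Icc a b, deriv g t = g' t := fun t ht => (hg t ht).deriv
  have habel := sum_mul_eq_sub_sub_integral_mul (fun _ => (1 : ℝ)) ha hab
    (fun t ht => (hg t ht).differentiableAt)
    ((hg'.integrableOn_Icc).congr_fun (fun t ht => (hderiv t ht).symm) measurableSet_Icc)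
  simp only [mul_one] at habel
  have hcard : ∀ t : ℝ, ∑ k ∈ Finset.Icc 0 ⌊t⌋₊, (1 : ℝ) = ⌊t⌋₊ + 1 := by
    intro t; simp
  simp only [hcard] at habel
  have hparts := intervalIntegral.integral_mul_deriv_eq_deriv_mul (a := a) (b := b)
    (u := g) (v := fun t => t) (u' := g') (v' := fun _ => 1) (by rw [hu]; exact hg)
    (fun t _ => hasDerivAt_id t) hInt intervalIntegrable_const
  simp only [mul_one] at hparts
  have hmeas : Measurable (fun t : ℝ => (⌊t⌋₊ : ℝ) + 1) := by
    exact (measurable_from_nat.comp Nat.measurable_floor).add_const 1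
  have hi1 : IntervalIntegrable (fun t => g' t * ((⌊t⌋₊ : ℝ) + 1)) MeasureTheory.volume a b := by
    rw [intervalIntegrable_iff_integrableOn_Ioc_of_le hab]
    have h0 := (intervalIntegrable_iff_integrableOn_Ioc_of_le hab).mp hInt
    refine MeasureTheory.Integrable.mul_bdd (c := b + 1) h0 hmeas.aestronglyMeasurable ?_
    refine (MeasureTheory.ae_restrict_iff' measurableSet_Ioc).mpr (.of_forall fun t ht => ?_)
    rw [Real.norm_of_nonneg (by positivity)]
    have := Nat.floor_le (ha.trans ht.1.le)
    linarith [ht.2]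
  have hi2 : IntervalIntegrable (fun t => g' t * t) MeasureTheory.volume a b :=
    hInt.mul_continuousOn continuousOn_id
  have habel2 : ∫ t in Set.Ioc a b, deriv g t * ((⌊t⌋₊ : ℝ) + 1) =
      ∫ t in a..b, g' t * ((⌊t⌋₊ : ℝ) + 1) := by
    rw [intervalIntegral.integral_of_le hab]
    refine MeasureTheory.setIntegral_congr_fun measurableSet_Ioc (fun t ht => ?_)
    simp only [hderiv t ⟨ht.1.le, ht.2⟩]
  rw [habel2] at habel
  have hftc : ∫ t in a..b, g' t = g b - g a :=
    intervalIntegral.integral_eq_sub_of_hasDerivAt (by rw [hu]; exact hg) hInt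
  have hsub : ∫ t in a..b, g' t * ((⌊t⌋₊ : ℝ) + 1 - t) =
      (∫ t in a..b, g' t * ((⌊t⌋₊ : ℝ) + 1)) - ∫ t in a..b, g' t * t := by
    rw [← intervalIntegral.integral_sub hi1 hi2]
    congr 1; ext t; ring
  have hfl : ∀ t : ℝ, 0 ≤ t → |(⌊t⌋₊ : ℝ) + 1 - t| ≤ 1 := by
    intro t ht
    have h1 := Nat.floor_le ht
    have h2 := Nat.lt_floor_add_one t
    rw [abs_le]; constructor <;> linarith
  have hb1 : |∫ t in a..b, g' t * ((⌊t⌋₊ : ℝ) + 1 - t)| ≤ ∫ t in a..b, |g' t| := by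
    have := intervalIntegral.norm_integral_le_of_norm_le (μ := MeasureTheory.volume) hab
      (f := fun t => g' t * ((⌊t⌋₊ : ℝ) + 1 - t)) (g := fun t => |g' t|)
      (.of_forall fun t ht => by
        rw [norm_mul, Real.norm_eq_abs, Real.norm_eq_abs]
        exact mul_le_of_le_one_right (abs_nonneg _) (hfl t (ha.trans ht.1.le))) hInt.abs
    simpa [Real.norm_eq_abs] using this
  have hb2 : |(g b - g a) * ((⌊b⌋₊ : ℝ) + 1 - b)| ≤ ∫ t in a..b, |g' t| := by
    rw [← hftc, abs_mul]
    refine (mul_le_of_le_one_right (abs_nonneg _) (hfl b (ha.trans hab))).trans ?_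
    exact intervalIntegral.abs_integral_le_integral_abs hab
  have heq : ∑ n ∈ Finset.Ioc ⌊a⌋₊ ⌊b⌋₊, g n - (∫ t in a..b, g t) -
      g a * (((⌊b⌋₊ : ℝ) - ⌊a⌋₊) - (b - a)) =
      (g b - g a) * ((⌊b⌋₊ : ℝ) + 1 - b) - ∫ t in a..b, g' t * ((⌊t⌋₊ : ℝ) + 1 - t) := by
    rw [habel, hparts, hsub]
    ring
  rw [heq]
  calc _ ≤ |(g b - g a) * ((⌊b⌋₊ : ℝ) + 1 - b)| + |∫ t in a..b, g' t * ((⌊t⌋₊ : ℝ) + 1 - t)| :=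
        abs_sub _ _
    _ ≤ _ := by linarith

lemma hasDerivAt_log_pow_div (i : ℕ) {t : ℝ} (ht : t ≠ 0) :
    HasDerivAt (fun t => Real.log t ^ i / t)
      ((i * Real.log t ^ (i - 1) - Real.log t ^ i) / t ^ 2) t := by
  have := ((Real.hasDerivAt_log ht).pow i).div (hasDerivAt_id t) ht
  convert! this using 1
  simp
  field_simp

lemma integral_log_pow_div (i : ℕ) {a b : ℝ} (ha : 0 < a) (hab : a ≤ b) :
    ∫ t in a..b, Real.log t ^ i / t =
      Real.log b ^ (i + 1) / (i + 1) - Real.log a ^ (i + 1) / (i + 1) := by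
  have hu : Set.uIcc a b = Set.Icc a b := Set.uIcc_of_le hab
  have h0 : ∀ t ∈ Set.uIcc a b, t ≠ 0 := by
    intro t ht; rw [hu] at ht; linarith [ht.1]
  refine intervalIntegral.integral_eq_sub_of_hasDerivAt
    (f := fun t => Real.log t ^ (i + 1) / (i + 1)) (fun t ht => ?_) ?_
  · have := ((Real.hasDerivAt_log (h0 t ht)).pow (i + 1)).div_const ((i : ℝ) + 1)
    convert! this using 1
    have : (i : ℝ) + 1 ≠ 0 := by positivity
    simp
    field_simp
  · apply ContinuousOn.intervalIntegrable
    exact ((Real.continuousOn_log.mono (fun t ht => h0 t ht)).pow i).div continuousOn_id h0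

/-- `Σ_{n ≤ y} (log n)^i / n`. -/
noncomputable def logDivSum (i : ℕ) (y : ℝ) : ℝ :=
  ∑ n ∈ Finset.Icc 1 ⌊y⌋₊, Real.log n ^ i / n

lemma integral_abs_deriv_log_pow_div_le (i : ℕ) {ε : ℝ} (hε : 0 < ε) (hε1 : ε ≤ 1 / 2) :
    ∃ K : ℝ, 0 < K ∧ ∀ σ δ : ℝ, 0 ≤ σ → 0 ≤ δ →
      ∫ t in Real.exp σ..Real.exp (σ + δ), |(i * Real.log t ^ (i - 1) - Real.log t ^ i) / t ^ 2| ≤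
        K * min δ 1 * Real.exp (-(1 - ε) * σ) := by
  refine ⟨2 * (i * (Nat.factorial (i - 1) / ε ^ (i - 1)) + Nat.factorial i / ε ^ i),
    by positivity, fun σ δ hσ hδ => ?_⟩
  set C := i * (Nat.factorial (i - 1) / ε ^ (i - 1)) + Nat.factorial i / ε ^ i with hC
  have hC0 : 0 < C := by positivity
  have hab : Real.exp σ ≤ Real.exp (σ + δ) := Real.exp_le_exp.mpr (by linarith)
  have ha1 : 1 ≤ Real.exp σ := Real.one_le_exp hσ
  have hu : Set.uIcc (Real.exp σ) (Real.exp (σ + δ)) = Set.Icc (Real.exp σ) (Real.exp (σ + δ)) :=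
    Set.uIcc_of_le hab
  have hpos : ∀ t ∈ Set.uIcc (Real.exp σ) (Real.exp (σ + δ)), 1 ≤ t := by
    intro t ht; rw [hu] at ht; linarith [ht.1]
  have h0 : ∀ t ∈ Set.uIcc (Real.exp σ) (Real.exp (σ + δ)), t ≠ 0 := by
    intro t ht; linarith [hpos t ht]
  have hlogc : ContinuousOn Real.log (Set.uIcc (Real.exp σ) (Real.exp (σ + δ))) :=
    Real.continuousOn_log.mono (fun t ht => h0 t ht)
  have hle : ∫ t in Real.exp σ..Real.exp (σ + δ),
      |(i * Real.log t ^ (i - 1) - Real.log t ^ i) / t ^ 2| ≤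
      ∫ t in Real.exp σ..Real.exp (σ + δ), C * t ^ (ε - 2) := by
    apply intervalIntegral.integral_mono_on hab
    · apply ContinuousOn.intervalIntegrable
      refine ContinuousOn.abs (ContinuousOn.div ?_ (by fun_prop) (fun t ht => pow_ne_zero 2 (h0 t ht)))
      exact (continuousOn_const.mul (hlogc.pow _)).sub (hlogc.pow _)
    · apply ContinuousOn.intervalIntegrable
      refine continuousOn_const.mul ?_
      exact continuousOn_id.rpow_const (fun t ht => Or.inl (h0 t ht))
    · intro t ht
      have ht1 : 1 ≤ t := ha1.trans ht.1
      have hl := Real.log_nonneg ht1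
      have e1 := log_pow_le_const_mul_rpow i hε ht1
      have e2 := log_pow_le_const_mul_rpow (i - 1) hε ht1
      rw [abs_div, abs_of_pos (by positivity : 0 < t ^ 2), Real.rpow_sub (by linarith)]
      have : t ^ (2 : ℝ) = t ^ 2 := by norm_cast
      rw [this, ← mul_div_assoc]
      gcongr
      refine (abs_sub _ _).trans ?_
      rw [abs_of_nonneg (by positivity), abs_of_nonneg (by positivity), hC, add_mul]
      refine add_le_add ?_ e1
      rw [mul_assoc]
      gcongr
  refine hle.trans ?_
  rw [intervalIntegral.integral_const_mul, integral_rpow (Or.inr ⟨by linarith, by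
    intro h; exact absurd rfl (h0 0 h)⟩)]
  rw [← Real.exp_mul, ← Real.exp_mul, show ε - 2 + 1 = -(1 - ε) by ring]
  have hs : Real.exp ((σ + δ) * -(1 - ε)) = Real.exp (-(1 - ε) * σ) * Real.exp (-(1 - ε) * δ) := by
    rw [← Real.exp_add]; congr 1; ring
  rw [hs, show Real.exp (σ * -(1 - ε)) = Real.exp (-(1 - ε) * σ) by congr 1; ring]
  have h1 : 1 - δ ≤ Real.exp (-(1 - ε) * δ) := by
    have := Real.add_one_le_exp (-(1 - ε) * δ)
    nlinarith
  have h2 := Real.exp_pos (-(1 - ε) * δ)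
  set E := Real.exp (-(1 - ε) * σ)
  have hE : 0 < E := Real.exp_pos _
  set F := Real.exp (-(1 - ε) * δ)
  have hmin : 1 - F ≤ min δ 1 := le_min (by linarith) (by linarith)
  have e3 : (E * F - E) / -(1 - ε) = E * (1 - F) / (1 - ε) := by
    rw [div_neg, ← neg_div]; ring
  rw [e3]
  have h1ε : 0 < 1 - ε := by linarith
  have e4 : E * (1 - F) / (1 - ε) ≤ 2 * (E * min δ 1) := by
    rw [div_le_iff₀ h1ε]
    have hm0 : 0 ≤ min δ 1 := le_min hδ (by norm_num)
    have : E * (1 - F) ≤ E * min δ 1 := by gcongr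
    have : 0 ≤ E * min δ 1 := by positivity
    nlinarith
  calc _ ≤ C * (2 * (E * min δ 1)) := by gcongr
    _ = _ := by ring

lemma logDivSum_local (i : ℕ) {ε : ℝ} (hε : 0 < ε) (hε1 : ε ≤ 1 / 2) :
    ∃ K : ℝ, 0 < K ∧ ∀ σ δ : ℝ, 0 ≤ σ → 0 ≤ δ →
      |(logDivSum i (Real.exp (σ + δ)) - (σ + δ) ^ (i + 1) / (i + 1)) -
        (logDivSum i (Real.exp σ) - σ ^ (i + 1) / (i + 1)) -
        σ ^ i / Real.exp σ * (((⌊Real.exp (σ + δ)⌋₊ : ℝ) - ⌊Real.exp σ⌋₊) -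
          (Real.exp (σ + δ) - Real.exp σ))| ≤ K * min δ 1 * Real.exp (-(1 - ε) * σ) := by
  obtain ⟨K, hK, h⟩ := integral_abs_deriv_log_pow_div_le i hε hε1
  refine ⟨2 * K, by positivity, fun σ δ hσ hδ => ?_⟩
  have hab : Real.exp σ ≤ Real.exp (σ + δ) := Real.exp_le_exp.mpr (by linarith)
  have h0 : ∀ t ∈ Set.Icc (Real.exp σ) (Real.exp (σ + δ)), t ≠ 0 := by
    intro t ht; linarith [ht.1, Real.exp_pos σ]
  have hlogc : ContinuousOn Real.log (Set.Icc (Real.exp σ) (Real.exp (σ + δ))) :=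
    Real.continuousOn_log.mono (fun t ht => h0 t ht)
  have := abs_sum_sub_integral_sub_le (g := fun t => Real.log t ^ i / t) (Real.exp_pos σ).le hab
    (fun t ht => hasDerivAt_log_pow_div i (h0 t ht))
    (((continuousOn_const.mul (hlogc.pow _)).sub (hlogc.pow _)).div (by fun_prop)
      (fun t ht => pow_ne_zero 2 (h0 t ht)))
  rw [integral_log_pow_div i (Real.exp_pos σ) hab, Real.log_exp, Real.log_exp] at this
  have hsum : logDivSum i (Real.exp (σ + δ)) - logDivSum i (Real.exp σ) =
      ∑ n ∈ Finset.Ioc ⌊Real.exp σ⌋₊ ⌊Real.exp (σ + δ)⌋₊, Real.log n ^ i / (n : ℝ) := by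
    unfold logDivSum
    have hIcc : ∀ n : ℕ, Finset.Icc 1 n = Finset.Ioc 0 n := fun n => by
      ext k
      simp only [Finset.mem_Icc, Finset.mem_Ioc]
      omega
    rw [sub_eq_iff_eq_add', hIcc, hIcc]
    exact (Finset.sum_Ioc_consecutive (fun n : ℕ => Real.log n ^ i / (n : ℝ))
      (Nat.zero_le _) (Nat.floor_mono hab)).symm
  rw [← hsum] at this
  have h2 := h σ δ hσ hδ
  refine le_trans (le_of_eq ?_) (this.trans (by linarith))
  congr 1
  ring

lemma exists_stieltjes (i : ℕ) : ∃ γ : ℝ, ∀ ε : ℝ, 0 < ε → ε ≤ 1 / 2 → ∃ K : ℝ, 0 < K ∧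
    ∀ σ : ℝ, 0 ≤ σ → |logDivSum i (Real.exp σ) - (σ ^ (i + 1) / (i + 1) + γ)| ≤
      K * Real.exp (-(1 - ε) * σ) := by
  set E : ℝ → ℝ := fun σ => logDivSum i (Real.exp σ) - σ ^ (i + 1) / (i + 1) with hE
  have hdiff : ∀ ε : ℝ, 0 < ε → ε ≤ 1 / 2 → ∃ K : ℝ, 0 < K ∧ ∀ σ δ : ℝ, 0 ≤ σ → 0 ≤ δ →
      |E (σ + δ) - E σ| ≤ K * Real.exp (-(1 - ε) * σ) := by
    intro ε hε hε1
    obtain ⟨K, hK, h⟩ := logDivSum_local i hε hε1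
    refine ⟨K + Nat.factorial i / ε ^ i, by positivity, fun σ δ hσ hδ => ?_⟩
    have h1 := h σ δ hσ hδ
    have hm : K * min δ 1 * Real.exp (-(1 - ε) * σ) ≤ K * Real.exp (-(1 - ε) * σ) := by
      gcongr
      exact mul_le_of_le_one_right hK.le (min_le_right _ _)
    have hf : |((⌊Real.exp (σ + δ)⌋₊ : ℝ) - ⌊Real.exp σ⌋₊) - (Real.exp (σ + δ) - Real.exp σ)| ≤ 1 := by
      have a1 := Nat.floor_le (Real.exp_pos (σ + δ)).le
      have a2 := Nat.lt_floor_add_one (Real.exp (σ + δ))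
      have a3 := Nat.floor_le (Real.exp_pos σ).le
      have a4 := Nat.lt_floor_add_one (Real.exp σ)
      rw [abs_le]; constructor <;> linarith
    have hg : |σ ^ i / Real.exp σ * (((⌊Real.exp (σ + δ)⌋₊ : ℝ) - ⌊Real.exp σ⌋₊) -
          (Real.exp (σ + δ) - Real.exp σ))| ≤ Nat.factorial i / ε ^ i * Real.exp (-(1 - ε) * σ) := by
      rw [abs_mul]
      refine (mul_le_of_le_one_right (abs_nonneg _) hf).trans ?_
      rw [abs_of_nonneg (by positivity), div_le_iff₀ (Real.exp_pos σ), mul_assoc, ← Real.exp_add]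
      refine (pow_le_const_mul_exp i hε hσ).trans (le_of_eq ?_)
      congr 2; ring
    have : |E (σ + δ) - E σ| ≤ |E (σ + δ) - E σ - σ ^ i / Real.exp σ *
        (((⌊Real.exp (σ + δ)⌋₊ : ℝ) - ⌊Real.exp σ⌋₊) - (Real.exp (σ + δ) - Real.exp σ))| +
        |σ ^ i / Real.exp σ * (((⌊Real.exp (σ + δ)⌋₊ : ℝ) - ⌊Real.exp σ⌋₊) -
          (Real.exp (σ + δ) - Real.exp σ))| := by
      have := abs_add_le (E (σ + δ) - E σ - σ ^ i / Real.exp σ *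
        (((⌊Real.exp (σ + δ)⌋₊ : ℝ) - ⌊Real.exp σ⌋₊) - (Real.exp (σ + δ) - Real.exp σ)))
        (σ ^ i / Real.exp σ * (((⌊Real.exp (σ + δ)⌋₊ : ℝ) - ⌊Real.exp σ⌋₊) -
          (Real.exp (σ + δ) - Real.exp σ)))
      rwa [sub_add_cancel] at this
    rw [add_mul]
    linarith
  have hc : CauchySeq (fun n : ℕ => E n) := by
    obtain ⟨K, hK, h⟩ := hdiff (1 / 2) (by norm_num) le_rfl
    refine cauchySeq_of_le_tendsto_0 (fun n : ℕ => 2 * (K * Real.exp (-(1 - 1 / 2) * n))) ?_ ?_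
    · intro n m N hn hm
      have h1 := h N (n - N) (by positivity) (by simpa using hn)
      have h2 := h N (m - N) (by positivity) (by simpa using hm)
      rw [add_sub_cancel] at h1 h2
      rw [Real.dist_eq]
      have := abs_sub_le (E n) (E N) (E m)
      rw [abs_sub_comm (E N)] at this
      linarith
    · have : Filter.Tendsto (fun n : ℕ => Real.exp (-(1 - 1 / 2) * (n : ℝ))) Filter.atTop (nhds 0) := by
        apply Real.tendsto_exp_atBot.comp
        apply Filter.Tendsto.const_mul_atTop_of_neg (by norm_num) tendsto_natCast_atTop_atTop
      have := (this.const_mul K).const_mul 2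
      simpa using this
  obtain ⟨γ, hγ⟩ := cauchySeq_tendsto_of_complete hc
  refine ⟨γ, fun ε hε hε1 => ?_⟩
  obtain ⟨K, hK, h⟩ := hdiff ε hε hε1
  refine ⟨K, hK, fun σ hσ => ?_⟩
  rw [← sub_sub]
  have hlim : Filter.Tendsto (fun n : ℕ => |E σ - E n|) Filter.atTop (nhds |E σ - γ|) :=
    (hγ.const_sub _).abs
  refine le_of_tendsto hlim ?_
  filter_upwards [Filter.eventually_ge_atTop ⌈σ⌉₊] with n hn
  have hn' : σ ≤ n := (Nat.le_ceil σ).trans (by exact_mod_cast hn)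
  have := h σ (n - σ) hσ (by linarith)
  rw [add_sub_cancel] at this
  rwa [abs_sub_comm]

/-- The constant term in the asymptotic expansion of `logDivSum i`. -/
noncomputable def stieltjesConst (i : ℕ) : ℝ := (exists_stieltjes i).choose

/-- The smooth part of `logDivSum i (exp σ)`. -/
noncomputable def logDivMain (i : ℕ) (σ : ℝ) : ℝ := σ ^ (i + 1) / (i + 1) + stieltjesConst i

/-- The error term `logDivSum i (exp σ) - logDivMain i σ`. -/
noncomputable def logDivErr (i : ℕ) (σ : ℝ) : ℝ := logDivSum i (Real.exp σ) - logDivMain i σ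

lemma abs_logDivErr_le (i : ℕ) {ε : ℝ} (hε : 0 < ε) (hε1 : ε ≤ 1 / 2) : ∃ K : ℝ, 0 < K ∧
    ∀ σ : ℝ, 0 ≤ σ → |logDivErr i σ| ≤ K * Real.exp (-(1 - ε) * σ) :=
  (exists_stieltjes i).choose_spec ε hε hε1

lemma logDivErr_local (i : ℕ) {ε : ℝ} (hε : 0 < ε) (hε1 : ε ≤ 1 / 2) : ∃ K : ℝ, 0 < K ∧
    ∀ σ δ : ℝ, 0 ≤ σ → 0 ≤ δ →
      |logDivErr i (σ + δ) - logDivErr i σ -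
        σ ^ i / Real.exp σ * (((⌊Real.exp (σ + δ)⌋₊ : ℝ) - ⌊Real.exp σ⌋₊) -
          (Real.exp (σ + δ) - Real.exp σ))| ≤ K * δ * Real.exp (-(1 - ε) * σ) := by
  obtain ⟨K, hK, h⟩ := logDivSum_local i hε hε1
  refine ⟨K, hK, fun σ δ hσ hδ => ?_⟩
  refine le_trans (le_of_eq ?_) ((h σ δ hσ hδ).trans ?_)
  · unfold logDivErr logDivMain
    congr 1
    ring
  · gcongr
    exact min_le_left _ _

lemma sum_Icc_divisorsAntidiagonal (φ : ℕ × ℕ → ℝ) (N : ℕ) :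
    ∑ n ∈ Finset.Icc 1 N, ∑ x ∈ n.divisorsAntidiagonal, φ x =
      ∑ a ∈ Finset.Icc 1 N, ∑ b ∈ Finset.Icc 1 (N / a), φ (a, b) := by
  rw [Finset.sum_sigma', Finset.sum_sigma']
  refine Finset.sum_bij' (fun x _ => ⟨x.2.1, x.2.2⟩) (fun x _ => ⟨x.1 * x.2, (x.1, x.2)⟩) ?_ ?_ ?_ ?_ ?_
  · rintro ⟨n, a, b⟩ h
    simp only [Finset.mem_sigma, Finset.mem_Icc, Nat.mem_divisorsAntidiagonal] at h ⊢
    obtain ⟨⟨h1, h2⟩, h3, h4⟩ := h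
    have ha : 0 < a := Nat.pos_of_ne_zero (by rintro rfl; simp at h3; omega)
    have hb : 0 < b := Nat.pos_of_ne_zero (by rintro rfl; simp at h3; omega)
    refine ⟨⟨ha, ?_⟩, hb, ?_⟩
    · nlinarith
    · rw [Nat.le_div_iff_mul_le ha]; nlinarith
  · rintro ⟨a, b⟩ h
    simp only [Finset.mem_sigma, Finset.mem_Icc, Nat.mem_divisorsAntidiagonal] at h ⊢
    obtain ⟨⟨h1, h2⟩, h3, h4⟩ := h
    rw [Nat.le_div_iff_mul_le h1] at h4
    exact ⟨⟨Nat.mul_pos h1 h3, by nlinarith⟩, trivial, (Nat.mul_pos h1 h3).ne'⟩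
  · rintro ⟨n, a, b⟩ h
    simp only [Finset.mem_sigma, Finset.mem_Icc, Nat.mem_divisorsAntidiagonal] at h ⊢
    obtain ⟨_, rfl, _⟩ := h
    rfl
  · rintro ⟨a, b⟩ h
    rfl
  · rintro ⟨n, a, b⟩ h
    rfl

/-- The summatory function of `F` in logarithmic scale. -/
noncomputable def expSum (F : ℕ → ℝ) (σ : ℝ) : ℝ := ∑ n ∈ Finset.Icc 1 ⌊Real.exp σ⌋₊, F n

/-- The Dirichlet convolution of `F` and `G`. -/
noncomputable def dirConv (F G : ℕ → ℝ) (n : ℕ) : ℝ := ∑ x ∈ n.divisorsAntidiagonal, F x.1 * G x.2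

lemma floor_exp_sub_log {a : ℕ} (ha : 0 < a) (T : ℝ) :
    ⌊Real.exp (T - Real.log a)⌋₊ = ⌊Real.exp T⌋₊ / a := by
  rw [Real.exp_sub, Real.exp_log (by exact_mod_cast ha), Nat.floor_div_natCast]

lemma log_le_iff_le_floor_exp {a : ℕ} (ha : 0 < a) (σ : ℝ) :
    Real.log a ≤ σ ↔ a ≤ ⌊Real.exp σ⌋₊ := by
  rw [Real.log_le_iff_le_exp (by exact_mod_cast ha), Nat.le_floor_iff (Real.exp_pos _).le]

lemma expSum_dirConv (F G : ℕ → ℝ) (T : ℝ) :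
    expSum (dirConv F G) T = ∑ a ∈ Finset.Icc 1 ⌊Real.exp T⌋₊, F a * expSum G (T - Real.log a) := by
  unfold expSum dirConv
  rw [sum_Icc_divisorsAntidiagonal (fun x => F x.1 * G x.2)]
  refine Finset.sum_congr rfl (fun a ha => ?_)
  rw [floor_exp_sub_log (Finset.mem_Icc.mp ha).1, Finset.mul_sum]

lemma expSum_eq_zero (F : ℕ → ℝ) {σ : ℝ} (hσ : σ < 0) : expSum F σ = 0 := by
  unfold expSum
  rw [Nat.floor_eq_zero.mpr (by rw [Real.exp_lt_one_iff]; exact hσ)]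
  simp

lemma expSum_mono {F : ℕ → ℝ} (hF : ∀ n, 0 ≤ F n) : Monotone (expSum F) := by
  intro a b hab
  unfold expSum
  refine Finset.sum_le_sum_of_subset_of_nonneg (Finset.Icc_subset_Icc_right
    (Nat.floor_mono (Real.exp_le_exp.mpr hab))) (fun i _ _ => hF i)

lemma measurable_expSum (F : ℕ → ℝ) : Measurable (expSum F) :=
  (measurable_from_nat (f := fun N => ∑ n ∈ Finset.Icc 1 N, F n)).comp
    (Nat.measurable_floor.comp Real.measurable_exp)

/-- The Dirichlet hyperbola method. -/
lemma expSum_dirConv_hyperbola (F G : ℕ → ℝ) {T y : ℝ} (hy : 0 ≤ y) (hyT : y ≤ T) :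
    expSum (dirConv F G) T =
      ∑ a ∈ Finset.Icc 1 ⌊Real.exp y⌋₊, F a * expSum G (T - Real.log a) +
      ∑ b ∈ Finset.Icc 1 ⌊Real.exp (T - y)⌋₊, G b * expSum F (T - Real.log b) -
      expSum F y * expSum G (T - y) := by
  set N := ⌊Real.exp T⌋₊
  set A := ⌊Real.exp y⌋₊ with hA
  set B := ⌊Real.exp (T - y)⌋₊ with hB
  have hAN : A ≤ N := Nat.floor_mono (Real.exp_le_exp.mpr hyT)
  have hBN : B ≤ N := Nat.floor_mono (Real.exp_le_exp.mpr (by linarith))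
  have hprod : Real.exp y * Real.exp (T - y) = Real.exp T := by
    rw [← Real.exp_add]; congr 1; ring
  have hAB : ∀ a b : ℕ, a ≤ A → b ≤ B → a * b ≤ N := by
    intro a b ha hb
    apply Nat.le_floor
    have h1 := (Nat.le_floor_iff (Real.exp_pos y).le).mp ha
    have h2 := (Nat.le_floor_iff (Real.exp_pos (T - y)).le).mp hb
    push_cast
    rw [← hprod]
    gcongr
  have hAB' : ∀ a b : ℕ, A < a → B < b → ¬ a * b ≤ N := by
    intro a b ha hb h
    have h1 := (Nat.floor_lt (Real.exp_pos y).le).mp ha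
    have h2 := (Nat.floor_lt (Real.exp_pos (T - y)).le).mp hb
    have h3 := (Nat.le_floor_iff (Real.exp_pos T).le).mp h
    push_cast at h3
    rw [← hprod] at h3
    have := mul_lt_mul'' h1 h2 (Real.exp_pos _).le (Real.exp_pos _).le
    linarith
  have hrow : ∀ (F G : ℕ → ℝ) (S : ℕ), S ≤ N →
      ∑ a ∈ Finset.Icc 1 S, F a * expSum G (T - Real.log a) =
      ∑ a ∈ Finset.Icc 1 N, ∑ b ∈ Finset.Icc 1 N,
        if a ≤ S ∧ a * b ≤ N then F a * G b else 0 := by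
    intro F G S hS
    have : Finset.Icc 1 S = (Finset.Icc 1 N).filter (· ≤ S) := by
      ext a; simp only [Finset.mem_Icc, Finset.mem_filter]; omega
    rw [this, Finset.sum_filter]
    refine Finset.sum_congr rfl (fun a ha => ?_)
    have ha1 := (Finset.mem_Icc.mp ha).1
    by_cases h : a ≤ S
    · simp only [h, if_true, true_and]
      unfold expSum
      rw [floor_exp_sub_log ha1, ← Finset.sum_filter, Finset.mul_sum]
      refine Finset.sum_congr ?_ (fun _ _ => rfl)
      ext b
      simp only [Finset.mem_Icc, Finset.mem_filter, Nat.le_div_iff_mul_le ha1]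
      constructor
      · rintro ⟨h1, h2⟩; exact ⟨⟨h1, by nlinarith⟩, by nlinarith⟩
      · rintro ⟨⟨h1, _⟩, h2⟩; exact ⟨h1, by nlinarith⟩
    · simp [h]
  have hprodsum : expSum F y * expSum G (T - y) =
      ∑ a ∈ Finset.Icc 1 N, ∑ b ∈ Finset.Icc 1 N, if a ≤ A ∧ b ≤ B then F a * G b else 0 := by
    unfold expSum
    rw [← hA, ← hB, Finset.sum_mul_sum]
    have h1 : Finset.Icc 1 A = (Finset.Icc 1 N).filter (· ≤ A) := by
      ext a; simp only [Finset.mem_Icc, Finset.mem_filter]; omega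
    have h2 : Finset.Icc 1 B = (Finset.Icc 1 N).filter (· ≤ B) := by
      ext a; simp only [Finset.mem_Icc, Finset.mem_filter]; omega
    rw [h1, Finset.sum_filter]
    refine Finset.sum_congr rfl (fun a ha => ?_)
    rw [h2, Finset.sum_filter]
    by_cases h : a ≤ A <;> simp [h]
  rw [expSum_dirConv, hrow F G N le_rfl, hrow F G A hAN, hrow G F B hBN, hprodsum,
    Finset.sum_comm (s := Finset.Icc 1 N) (t := Finset.Icc 1 N)
      (f := fun a b => if a ≤ B ∧ a * b ≤ N then G a * F b else 0),
    ← Finset.sum_add_distrib, ← Finset.sum_sub_distrib]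
  refine Finset.sum_congr rfl (fun a ha => ?_)
  rw [← Finset.sum_add_distrib, ← Finset.sum_sub_distrib]
  refine Finset.sum_congr rfl (fun b hb => ?_)
  have ha2 := (Finset.mem_Icc.mp ha).2
  rw [mul_comm b a, mul_comm (G b)]
  by_cases h1 : a ≤ A <;> by_cases h2 : b ≤ B
  · simp [h1, h2, ha2, hAB a b h1 h2]
  · simp [h1, h2, ha2]
  · simp [h1, h2, ha2]
  · simp [h1, h2, ha2, hAB' a b (by omega) (by omega)]

lemma integral_expSum_mul (F : ℕ → ℝ) {φ : ℝ → ℝ} {y : ℝ}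
    (hφ : IntervalIntegrable φ MeasureTheory.volume 0 y) (hy : 0 ≤ y) :
    ∫ σ in (0:ℝ)..y, expSum F σ * φ σ =
      ∑ a ∈ Finset.Icc 1 ⌊Real.exp y⌋₊, F a * ∫ σ in (Real.log a)..y, φ σ := by
  have h1 : ∫ σ in (0:ℝ)..y, expSum F σ * φ σ =
      ∫ σ in (0:ℝ)..y, ∑ a ∈ Finset.Icc 1 ⌊Real.exp y⌋₊,
        F a * (Set.Ici (Real.log a)).indicator φ σ := by
    refine intervalIntegral.integral_congr (fun σ hσ => ?_)
    rw [Set.uIcc_of_le hy] at hσ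
    have hfl : ⌊Real.exp σ⌋₊ ≤ ⌊Real.exp y⌋₊ := Nat.floor_mono (Real.exp_le_exp.mpr hσ.2)
    have : Finset.Icc 1 ⌊Real.exp σ⌋₊ = (Finset.Icc 1 ⌊Real.exp y⌋₊).filter (· ≤ ⌊Real.exp σ⌋₊) := by
      ext a; simp only [Finset.mem_Icc, Finset.mem_filter]; omega
    unfold expSum
    rw [this, Finset.sum_filter, Finset.sum_mul]
    refine Finset.sum_congr rfl (fun a ha => ?_)
    have hiff := log_le_iff_le_floor_exp (Finset.mem_Icc.mp ha).1 σ
    by_cases h : a ≤ ⌊Real.exp σ⌋₊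
    · simp [h, Set.indicator, hiff]
    · simp [h, Set.indicator, hiff]
  have hind : ∀ L : ℝ, IntervalIntegrable ((Set.Ici L).indicator φ) MeasureTheory.volume 0 y := by
    intro L
    rw [intervalIntegrable_iff_integrableOn_Ioc_of_le hy] at hφ ⊢
    exact hφ.indicator measurableSet_Ici
  rw [h1, intervalIntegral.integral_finsetSum (fun a _ => (hind _).const_mul _)]
  refine Finset.sum_congr rfl (fun a ha => ?_)
  rw [intervalIntegral.integral_const_mul]
  congr 1
  have ha' := Finset.mem_Icc.mp ha
  have hL0 : 0 ≤ Real.log a := Real.log_natCast_nonneg a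
  have hLy : Real.log a ≤ y := (log_le_iff_le_floor_exp ha'.1 y).mpr ha'.2
  rw [intervalIntegral.integral_of_le hy, intervalIntegral.integral_of_le hLy,
    MeasureTheory.setIntegral_indicator measurableSet_Ici]
  refine MeasureTheory.setIntegral_congr_set ?_
  have hsub : Set.Ioc (Real.log a) y ⊆ Set.Ioc 0 y ∩ Set.Ici (Real.log a) := fun x hx =>
    ⟨⟨hL0.trans_lt hx.1, hx.2⟩, hx.1.le⟩
  have hsub2 : Set.Ioc 0 y ∩ Set.Ici (Real.log a) ⊆ Set.Icc (Real.log a) y := fun x hx =>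
    ⟨hx.2, hx.1.2⟩
  have hae := MeasureTheory.Ioc_ae_eq_Icc (μ := MeasureTheory.volume) (a := Real.log a) (b := y)
  exact Filter.EventuallyLE.antisymm (hsub2.eventuallyLE.trans hae.symm.le) hsub.eventuallyLE

lemma Polynomial.abs_eval_le_const_mul_exp (p : Polynomial ℝ) {η : ℝ} (hη : 0 < η) :
    ∃ K : ℝ, 0 < K ∧ ∀ x : ℝ, |p.eval x| ≤ K * Real.exp (η * |x|) := by
  refine ⟨∑ n ∈ Finset.range (p.natDegree + 1), |p.coeff n| * (Nat.factorial n / η ^ n) + 1,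
    by positivity, fun x => ?_⟩
  rw [Polynomial.eval_eq_sum_range]
  have h1 : 0 < Real.exp (η * |x|) := Real.exp_pos _
  calc _ ≤ ∑ n ∈ Finset.range (p.natDegree + 1), |p.coeff n * x ^ n| :=
        Finset.abs_sum_le_sum_abs _ _
    _ ≤ ∑ n ∈ Finset.range (p.natDegree + 1),
          |p.coeff n| * (Nat.factorial n / η ^ n) * Real.exp (η * |x|) := by
        refine Finset.sum_le_sum (fun n _ => ?_)
        rw [abs_mul, abs_pow, mul_assoc]
        gcongr
        exact pow_le_const_mul_exp n hη (abs_nonneg x)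
    _ ≤ _ := by
        rw [← Finset.sum_mul]
        gcongr
        linarith

lemma Polynomial.abs_eval_add_sub_eval_le (p : Polynomial ℝ) {η : ℝ} (hη : 0 < η) :
    ∃ K : ℝ, 0 < K ∧ ∀ x δ : ℝ, 0 ≤ δ → δ ≤ 1 →
      |p.eval (x + δ) - p.eval x| ≤ K * δ * Real.exp (η * |x|) := by
  obtain ⟨K, hK, h⟩ := p.derivative.abs_eval_le_const_mul_exp hη
  refine ⟨K * Real.exp η, by positivity, fun x δ hδ hδ1 => ?_⟩
  have hb : ∀ t ∈ Set.Icc x (x + δ), ‖p.derivative.eval t‖ ≤ K * Real.exp η * Real.exp (η * |x|) := by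
    intro t ht
    rw [Real.norm_eq_abs, mul_assoc, ← Real.exp_add]
    refine (h t).trans ?_
    gcongr
    have : |t| ≤ |x| + 1 := by
      have := abs_add_le x (t - x)
      rw [add_sub_cancel] at this
      have h2 : |t - x| ≤ 1 := by rw [abs_le]; constructor <;> linarith [ht.1, ht.2]
      linarith
    nlinarith
  have := (convex_Icc x (x + δ)).norm_image_sub_le_of_norm_hasDerivWithin_le
    (f := fun t => p.eval t) (fun t _ => (p.hasDerivAt t).hasDerivWithinAt) hb
    (Set.left_mem_Icc.mpr (by linarith)) (Set.right_mem_Icc.mpr (by linarith))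
  rw [Real.norm_eq_abs, add_sub_cancel_left, Real.norm_of_nonneg hδ] at this
  refine this.trans (le_of_eq (by ring))

section Decay

variable {B : ℝ → ℝ} {c K : ℝ}

lemma integrableOn_Ioi_of_decay {φ : ℝ → ℝ} {z c K : ℝ} (hc : 0 < c) (hφ : Measurable φ)
    (h : ∀ σ, z < σ → |φ σ| ≤ K * Real.exp (-c * σ)) :
    MeasureTheory.IntegrableOn φ (Set.Ioi z) ∧
      |∫ σ in Set.Ioi z, φ σ| ≤ K / c * Real.exp (-c * z) := by
  have hi : MeasureTheory.IntegrableOn (fun σ => K * Real.exp (-c * σ)) (Set.Ioi z) :=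
    (integrableOn_exp_mul_Ioi (by linarith) z).const_mul K
  have hae : ∀ᵐ σ ∂(MeasureTheory.volume.restrict (Set.Ioi z)), ‖φ σ‖ ≤ K * Real.exp (-c * σ) :=
    (MeasureTheory.ae_restrict_iff' measurableSet_Ioi).mpr (.of_forall fun σ hσ => h σ hσ)
  refine ⟨hi.mono' hφ.aestronglyMeasurable hae, ?_⟩
  have := MeasureTheory.norm_integral_le_of_norm_le hi hae
  rw [MeasureTheory.integral_const_mul, integral_exp_mul_Ioi (by linarith)] at this
  rw [← Real.norm_eq_abs]
  refine this.trans (le_of_eq ?_)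
  rw [neg_div_neg_eq]
  ring

lemma decay_mul_poly (hB : ∀ σ, 0 ≤ σ → |B σ| ≤ K * Real.exp (-c * σ)) (p : Polynomial ℝ)
    {η : ℝ} (hη : 0 < η) : ∃ K' : ℝ, 0 < K' ∧ ∀ T σ : ℝ, 0 ≤ T → 0 ≤ σ →
      |B σ * p.eval (T - σ)| ≤ K' * Real.exp (η * T) * Real.exp (-(c - η) * σ) := by
  obtain ⟨M, hM, h⟩ := p.abs_eval_le_const_mul_exp hη
  have hK : 0 ≤ K := by
    have := (abs_nonneg _).trans (hB 0 le_rfl)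
    simpa using this
  refine ⟨(K + 1) * M, by positivity, fun T σ hT hσ => ?_⟩
  rw [abs_mul]
  have h1 : |p.eval (T - σ)| ≤ M * (Real.exp (η * T) * Real.exp (η * σ)) := by
    refine (h _).trans ?_
    rw [← Real.exp_add, ← mul_add]
    gcongr
    exact (abs_sub _ _).trans (by rw [abs_of_nonneg hT, abs_of_nonneg hσ])
  have h2 : |B σ| ≤ (K + 1) * Real.exp (-c * σ) := (hB σ hσ).trans (by gcongr; linarith)
  calc |B σ| * |p.eval (T - σ)| ≤ ((K + 1) * Real.exp (-c * σ)) *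
        (M * (Real.exp (η * T) * Real.exp (η * σ))) := by gcongr
    _ = (K + 1) * M * Real.exp (η * T) * (Real.exp (-c * σ) * Real.exp (η * σ)) := by ring
    _ = _ := by rw [← Real.exp_add]; congr 2; ring

lemma integrableOn_decay_mul_poly (hBm : Measurable B) (hc : 0 < c)
    (hB : ∀ σ, 0 ≤ σ → |B σ| ≤ K * Real.exp (-c * σ)) (p : Polynomial ℝ) (T : ℝ) {z : ℝ}
    (hz : 0 ≤ z) : MeasureTheory.IntegrableOn (fun σ => B σ * p.eval (T - σ)) (Set.Ioi z) := by
  obtain ⟨K', hK', h⟩ := decay_mul_poly hB (p.comp (Polynomial.X + Polynomial.C T)) (half_pos hc)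
  refine (integrableOn_Ioi_of_decay (half_pos hc) (K := K') ?_ ?_).1
  · exact hBm.mul (by fun_prop)
  · intro σ hσ
    have := h 0 σ le_rfl (hz.trans hσ.le)
    simp only [mul_zero, Real.exp_zero, mul_one, Polynomial.eval_comp, Polynomial.eval_add,
      Polynomial.eval_X, Polynomial.eval_C, zero_sub] at this
    rw [show T - σ = -σ + T by ring, show -(c / 2) = -(c - c / 2) by ring]
    exact this

lemma abs_tail_integral_le (hBm : Measurable B)
    (hB : ∀ σ, 0 ≤ σ → |B σ| ≤ K * Real.exp (-c * σ)) (p : Polynomial ℝ) {η : ℝ} (hη : 0 < η)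
    (hηc : η < c) : ∃ K' : ℝ, 0 < K' ∧ ∀ T z : ℝ, 0 ≤ T → 0 ≤ z →
      |∫ σ in Set.Ioi z, B σ * p.eval (T - σ)| ≤
        K' * Real.exp (η * T) * Real.exp (-(c - η) * z) := by
  obtain ⟨K', hK', h⟩ := decay_mul_poly hB p hη
  have hcη : 0 < c - η := by linarith
  refine ⟨K' / (c - η), by positivity, fun T z hT hz => ?_⟩
  refine (integrableOn_Ioi_of_decay hcη (K := K' * Real.exp (η * T)) (hBm.mul (by fun_prop))
    (fun σ hσ => h T σ hT (hz.trans hσ.le))).2.trans (le_of_eq (by ring))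

lemma abs_tail_integral_sub_le (hBm : Measurable B) (hc1 : c ≤ 1)
    (hB : ∀ σ, 0 ≤ σ → |B σ| ≤ K * Real.exp (-c * σ)) (p : Polynomial ℝ) {η : ℝ} (hη : 0 < η)
    (hηc : η < c) : ∃ K' : ℝ, 0 < K' ∧ ∀ T z z' δ : ℝ, 0 ≤ T → 0 ≤ z → 0 ≤ δ → δ ≤ 1 →
      z ≤ z' → z' ≤ z + δ →
      |(∫ σ in Set.Ioi z', B σ * p.eval (T + δ - σ)) - ∫ σ in Set.Ioi z, B σ * p.eval (T - σ)| ≤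
        K' * δ * Real.exp (η * T) * Real.exp (-(c - η) * z) := by
  obtain ⟨K₁, hK₁, h₁⟩ := decay_mul_poly hB p hη
  obtain ⟨K₂, hK₂, h₂⟩ := p.abs_eval_add_sub_eval_le hη
  have hcη : 0 < c - η := by linarith
  have hc : 0 < c := by linarith
  have hK : 0 ≤ K := by
    have := (abs_nonneg _).trans (hB 0 le_rfl)
    simpa using this
  refine ⟨K₁ * Real.exp η + (K + 1) * K₂ / (c - η), by positivity,
    fun T z z' δ hT hz hδ hδ1 hz1 hz2 => ?_⟩
  have hI1 := integrableOn_decay_mul_poly hBm hc hB p (T + δ) hz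
  have hI2 := integrableOn_decay_mul_poly hBm hc hB p T hz
  have hsplit : ∫ σ in Set.Ioi z, B σ * p.eval (T + δ - σ) =
      (∫ σ in Set.Ioc z z', B σ * p.eval (T + δ - σ)) +
        ∫ σ in Set.Ioi z', B σ * p.eval (T + δ - σ) := by
    rw [← Set.Ioc_union_Ioi_eq_Ioi hz1]
    exact MeasureTheory.setIntegral_union (Set.Ioc_disjoint_Ioi le_rfl) measurableSet_Ioi
      (hI1.mono_set Set.Ioc_subset_Ioi_self) (hI1.mono_set (Set.Ioi_subset_Ioi hz1))
  have hdiff : (∫ σ in Set.Ioi z, B σ * p.eval (T + δ - σ)) -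
      ∫ σ in Set.Ioi z, B σ * p.eval (T - σ) =
      ∫ σ in Set.Ioi z, B σ * (p.eval (T + δ - σ) - p.eval (T - σ)) := by
    rw [← MeasureTheory.integral_sub hI1 hI2]
    congr 1; ext σ; ring
  have hb1 : |∫ σ in Set.Ioi z, B σ * (p.eval (T + δ - σ) - p.eval (T - σ))| ≤
      ((K + 1) * K₂ * δ * Real.exp (η * T)) / (c - η) * Real.exp (-(c - η) * z) := by
    refine (integrableOn_Ioi_of_decay hcη (hBm.mul (by fun_prop)) (fun σ hσ => ?_)).2
    have hσ0 : 0 ≤ σ := hz.trans hσ.le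
    rw [Pi.mul_apply, abs_mul]
    have e1 : |p.eval (T + δ - σ) - p.eval (T - σ)| ≤
        K₂ * δ * (Real.exp (η * T) * Real.exp (η * σ)) := by
      have := h₂ (T - σ) δ hδ hδ1
      rw [show T - σ + δ = T + δ - σ by ring] at this
      refine this.trans ?_
      rw [← Real.exp_add, ← mul_add]
      gcongr
      exact (abs_sub _ _).trans (by rw [abs_of_nonneg hT, abs_of_nonneg hσ0])
    have e2 : |B σ| ≤ (K + 1) * Real.exp (-c * σ) := (hB σ hσ0).trans (by gcongr; linarith)
    calc _ ≤ ((K + 1) * Real.exp (-c * σ)) * (K₂ * δ * (Real.exp (η * T) * Real.exp (η * σ))) := by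
          gcongr
      _ = (K + 1) * K₂ * δ * Real.exp (η * T) * (Real.exp (-c * σ) * Real.exp (η * σ)) := by ring
      _ = _ := by rw [← Real.exp_add]; congr 2; ring
  have hb2 : |∫ σ in Set.Ioc z z', B σ * p.eval (T + δ - σ)| ≤
      K₁ * Real.exp η * δ * Real.exp (η * T) * Real.exp (-(c - η) * z) := by
    have hvol : (MeasureTheory.volume (Set.Ioc z z')) < ⊤ := by
      rw [Real.volume_Ioc]; exact ENNReal.ofReal_lt_top
    have := MeasureTheory.norm_setIntegral_le_of_norm_le_const (μ := MeasureTheory.volume) hvol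
      (f := fun σ => B σ * p.eval (T + δ - σ))
      (C := K₁ * Real.exp (η * (T + 1)) * Real.exp (-(c - η) * z)) (fun σ hσ => by
        refine (h₁ (T + δ) σ (by linarith) (hz.trans hσ.1.le)).trans ?_
        have := hσ.1.le
        have e1 : η * (T + δ) ≤ η * (T + 1) := by gcongr
        have e2 : -(c - η) * σ ≤ -(c - η) * z := by nlinarith
        gcongr)
    rw [MeasureTheory.measureReal_def, Real.volume_Ioc, ENNReal.toReal_ofReal (by linarith)] at this
    rw [← Real.norm_eq_abs]
    refine this.trans ?_
    rw [mul_add, Real.exp_add, mul_one]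
    calc _ ≤ K₁ * (Real.exp (η * T) * Real.exp η) * Real.exp (-(c - η) * z) * δ := by
          gcongr; linarith
      _ = _ := by ring
  have hfin : (∫ σ in Set.Ioi z', B σ * p.eval (T + δ - σ)) -
      ∫ σ in Set.Ioi z, B σ * p.eval (T - σ) =
      (∫ σ in Set.Ioi z, B σ * (p.eval (T + δ - σ) - p.eval (T - σ))) -
        ∫ σ in Set.Ioc z z', B σ * p.eval (T + δ - σ) := by
    rw [← hdiff, hsplit]; ring
  rw [hfin]
  refine (abs_sub _ _).trans ((add_le_add hb1 hb2).trans (le_of_eq (by ring)))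

lemma exists_poly_integral_Ioi (hBm : Measurable B) (hc : 0 < c)
    (hB : ∀ σ, 0 ≤ σ → |B σ| ≤ K * Real.exp (-c * σ)) (p : Polynomial ℝ) {D : ℕ}
    (hp : p.natDegree ≤ D) : ∃ P : Polynomial ℝ, P.natDegree ≤ D ∧
      ∀ T : ℝ, ∫ σ in Set.Ioi (0 : ℝ), B σ * p.eval (T - σ) = P.eval T := by
  have hInt : ∀ m : ℕ, MeasureTheory.IntegrableOn (fun σ => B σ * (-σ) ^ m) (Set.Ioi 0) := by
    intro m
    have := integrableOn_decay_mul_poly hBm hc hB (Polynomial.X ^ m) 0 le_rfl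
    simpa using this
  refine ⟨∑ n ∈ Finset.range (D + 1), ∑ k ∈ Finset.range (n + 1),
    Polynomial.C (p.coeff n * (n.choose k * ∫ σ in Set.Ioi (0:ℝ), B σ * (-σ) ^ (n - k))) *
      Polynomial.X ^ k, ?_, fun T => ?_⟩
  · refine Polynomial.natDegree_sum_le_of_forall_le _ _ (fun n hn => ?_)
    refine Polynomial.natDegree_sum_le_of_forall_le _ _ (fun k hk => ?_)
    refine (Polynomial.natDegree_C_mul_X_pow_le _ _).trans ?_
    simp only [Finset.mem_range] at hn hk
    omega
  · have : ∀ σ, B σ * p.eval (T - σ) = ∑ n ∈ Finset.range (D + 1), ∑ k ∈ Finset.range (n + 1),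
        (p.coeff n * n.choose k * T ^ k) * (B σ * (-σ) ^ (n - k)) := by
      intro σ
      rw [Polynomial.eval_eq_sum_range' (Nat.lt_succ_of_le hp), Finset.mul_sum]
      refine Finset.sum_congr rfl (fun n _ => ?_)
      rw [sub_eq_add_neg, add_pow, Finset.mul_sum, Finset.mul_sum]
      refine Finset.sum_congr rfl (fun k _ => ?_)
      ring
    simp_rw [this]
    rw [MeasureTheory.integral_finsetSum _ (fun n _ => MeasureTheory.integrable_finsetSum _
      (fun k _ => (hInt _).const_mul _)), Polynomial.eval_finsetSum]
    refine Finset.sum_congr rfl (fun n _ => ?_)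
    rw [MeasureTheory.integral_finsetSum _ (fun k _ => (hInt _).const_mul _),
      Polynomial.eval_finsetSum]
    refine Finset.sum_congr rfl (fun k _ => ?_)
    rw [MeasureTheory.integral_const_mul]
    simp
    ring

end Decay

/-- The arithmetic function `n ↦ (log n)^i / n`. -/
noncomputable def logF (i n : ℕ) : ℝ := Real.log n ^ i / n

lemma logF_nonneg (i n : ℕ) : 0 ≤ logF i n :=
  div_nonneg (pow_nonneg (Real.log_natCast_nonneg n) i) (Nat.cast_nonneg n)

lemma expSum_logF (i : ℕ) (σ : ℝ) : expSum (logF i) σ = logDivErr i σ + logDivMain i σ := by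
  unfold logDivErr
  rw [sub_add_cancel]
  rfl

lemma measurable_logDivMain (i : ℕ) : Measurable (logDivMain i) := by
  unfold logDivMain
  fun_prop

lemma continuous_logDivMain (i : ℕ) : Continuous (logDivMain i) := by
  unfold logDivMain
  fun_prop

lemma measurable_logDivErr (i : ℕ) : Measurable (logDivErr i) := by
  have : logDivErr i = fun σ => expSum (logF i) σ - logDivMain i σ := by
    ext σ; rw [expSum_logF]; ring
  rw [this]
  exact (measurable_expSum _).sub (measurable_logDivMain i)

lemma hasDerivAt_logDivMain (i : ℕ) (σ : ℝ) : HasDerivAt (logDivMain i) (σ ^ i) σ := by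
  unfold logDivMain
  have := ((hasDerivAt_pow (i + 1) σ).div_const ((i : ℝ) + 1)).add_const (stieltjesConst i)
  convert! this using 1
  have : (i : ℝ) + 1 ≠ 0 := by positivity
  push_cast
  field_simp

lemma integral_pow_mul_sub_pow (m n : ℕ) (T : ℝ) :
    ∫ σ in (0:ℝ)..T, σ ^ m * (T - σ) ^ n =
      (Nat.factorial m * Nat.factorial n / Nat.factorial (m + n + 1)) * T ^ (m + n + 1) := by
  induction n generalizing m with
  | zero =>
    simp [Nat.factorial_succ]
    field_simp
  | succ n ih =>
    have h := intervalIntegral.integral_mul_deriv_eq_deriv_mul (a := 0) (b := T)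
      (u := fun σ => (T - σ) ^ (n + 1)) (v := fun σ => σ ^ (m + 1) / ((m : ℝ) + 1))
      (u' := fun σ => -((n + 1 : ℝ) * (T - σ) ^ n)) (v' := fun σ => σ ^ m)
      (fun σ _ => by
        have := ((hasDerivAt_id σ).const_sub T).pow (n + 1)
        convert! this using 1
        simp)
      (fun σ _ => by
        have := (hasDerivAt_pow (m + 1) σ).div_const ((m : ℝ) + 1)
        convert! this using 1
        have : (m : ℝ) + 1 ≠ 0 := by positivity
        push_cast
        field_simp)
      (Continuous.intervalIntegrable (by fun_prop) _ _)
      (Continuous.intervalIntegrable (by fun_prop) _ _)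
    have e1 : ∫ σ in (0:ℝ)..T, σ ^ m * (T - σ) ^ (n + 1) =
        ∫ σ in (0:ℝ)..T, (T - σ) ^ (n + 1) * σ ^ m := by
      congr 1; ext σ; ring
    have e2 : ∫ σ in (0:ℝ)..T, -((n + 1 : ℝ) * (T - σ) ^ n) * (σ ^ (m + 1) / ((m : ℝ) + 1)) =
        -((n + 1 : ℝ) / (m + 1)) * ∫ σ in (0:ℝ)..T, σ ^ (m + 1) * (T - σ) ^ n := by
      rw [← intervalIntegral.integral_const_mul]
      congr 1; ext σ; ring
    rw [e1, h, e2, ih (m + 1)]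
    have hm : (m : ℝ) + 1 ≠ 0 := by positivity
    rw [show m + 1 + n + 1 = m + (n + 1) + 1 by ring]
    simp [Nat.factorial_succ]
    field_simp

lemma logDivMain_parts (i j : ℕ) (T y : ℝ) :
    logDivMain i y * logDivMain j (T - y) + (∫ σ in (0:ℝ)..y, logDivMain i σ * (T - σ) ^ j) +
      (∫ σ in (0:ℝ)..(T - y), logDivMain j σ * (T - σ) ^ i) =
    (Nat.factorial i * Nat.factorial j / Nat.factorial (i + j + 2)) * T ^ (i + j + 2) +
      stieltjesConst j * (T ^ (i + 1) / (i + 1)) + stieltjesConst i * (T ^ (j + 1) / (j + 1)) +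
      stieltjesConst i * stieltjesConst j := by
  have hc := continuous_logDivMain
  have h := intervalIntegral.integral_mul_deriv_eq_deriv_mul (a := 0) (b := y)
    (u := logDivMain i) (v := fun σ => -logDivMain j (T - σ))
    (u' := fun σ => σ ^ i) (v' := fun σ => (T - σ) ^ j)
    (fun σ _ => hasDerivAt_logDivMain i σ)
    (fun σ _ => by
      have := ((hasDerivAt_logDivMain j (T - σ)).comp_const_sub T σ).neg
      convert! this using 1
      rw [neg_neg])
    (Continuous.intervalIntegrable (by fun_prop) _ _)
    (Continuous.intervalIntegrable (by fun_prop) _ _)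
  have hsub : ∫ σ in (0:ℝ)..y, σ ^ i * -logDivMain j (T - σ) =
      -∫ σ in (T - y)..T, logDivMain j σ * (T - σ) ^ i := by
    have := intervalIntegral.integral_comp_sub_left (a := 0) (b := y)
      (fun σ => logDivMain j σ * (T - σ) ^ i) T
    rw [sub_zero] at this
    rw [← this, ← intervalIntegral.integral_neg]
    congr 1; ext σ; ring
  have hi : ∀ a b : ℝ, IntervalIntegrable (fun σ => logDivMain j σ * (T - σ) ^ i)
      MeasureTheory.volume a b := fun a b => by
    have := hc j
    exact Continuous.intervalIntegrable (by fun_prop) _ _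
  have hadd := intervalIntegral.integral_add_adjacent_intervals (hi 0 (T - y)) (hi (T - y) T)
  have hbeta : ∫ σ in (0:ℝ)..T, logDivMain j σ * (T - σ) ^ i =
      (Nat.factorial i * Nat.factorial j / Nat.factorial (i + j + 2)) * T ^ (i + j + 2) +
      stieltjesConst j * (T ^ (i + 1) / (i + 1)) := by
    have e : ∀ σ, logDivMain j σ * (T - σ) ^ i = (1 / ((j : ℝ) + 1)) * (σ ^ (j + 1) * (T - σ) ^ i) +
        stieltjesConst j * (σ ^ 0 * (T - σ) ^ i) := by
      intro σ; unfold logDivMain; ring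
    simp_rw [e]
    rw [intervalIntegral.integral_add (Continuous.intervalIntegrable (by fun_prop) _ _)
      (Continuous.intervalIntegrable (by fun_prop) _ _), intervalIntegral.integral_const_mul,
      intervalIntegral.integral_const_mul, integral_pow_mul_sub_pow, integral_pow_mul_sub_pow]
    rw [show j + 1 + i + 1 = i + j + 2 by ring, zero_add]
    have : (j : ℝ) + 1 ≠ 0 := by positivity
    simp [Nat.factorial_succ]
    field_simp
  rw [h, hsub]
  have h0 : logDivMain i 0 = stieltjesConst i := by simp [logDivMain]
  have hT : logDivMain j T = T ^ (j + 1) / (j + 1) + stieltjesConst j := rfl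
  rw [hbeta] at hadd
  rw [h0, sub_zero, hT]
  linear_combination hadd

lemma sum_logF_mul_logDivMain (i j : ℕ) {T y : ℝ} (hy : 0 ≤ y) :
    ∑ a ∈ Finset.Icc 1 ⌊Real.exp y⌋₊, logF i a * logDivMain j (T - Real.log a) =
      expSum (logF i) y * logDivMain j (T - y) +
        ∫ σ in (0:ℝ)..y, expSum (logF i) σ * (T - σ) ^ j := by
  rw [integral_expSum_mul _ (Continuous.intervalIntegrable (by fun_prop) _ _) hy]
  unfold expSum
  rw [Finset.sum_mul, ← Finset.sum_add_distrib]
  refine Finset.sum_congr rfl (fun a _ => ?_)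
  have := intervalIntegral.integral_eq_sub_of_hasDerivAt (a := Real.log a) (b := y)
    (f := fun σ => -logDivMain j (T - σ)) (f' := fun σ => (T - σ) ^ j)
    (fun σ _ => by
      have := ((hasDerivAt_logDivMain j (T - σ)).comp_const_sub T σ).neg
      convert! this using 1
      rw [neg_neg])
    (Continuous.intervalIntegrable (by fun_prop) _ _)
  rw [this]
  ring

lemma integral_expSum_logF_mul (i j : ℕ) {T y : ℝ} (hy : 0 ≤ y) :
    ∫ σ in (0:ℝ)..y, expSum (logF i) σ * (T - σ) ^ j =
      (∫ σ in (0:ℝ)..y, logDivMain i σ * (T - σ) ^ j) +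
      (∫ σ in Set.Ioi (0:ℝ), logDivErr i σ * (Polynomial.X ^ j : Polynomial ℝ).eval (T - σ)) -
      ∫ σ in Set.Ioi y, logDivErr i σ * (Polynomial.X ^ j : Polynomial ℝ).eval (T - σ) := by
  obtain ⟨K, hK, hB⟩ := abs_logDivErr_le i (ε := 1 / 2) (by norm_num) le_rfl
  have hI := integrableOn_decay_mul_poly (measurable_logDivErr i) (c := 1 - 1 / 2) (by norm_num) hB
    (Polynomial.X ^ j) T le_rfl
  have h1 := MeasureTheory.setIntegral_union (μ := MeasureTheory.volume)
    (f := fun σ => logDivErr i σ * (Polynomial.X ^ j : Polynomial ℝ).eval (T - σ))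
    (Set.Ioc_disjoint_Ioi (le_refl y)) measurableSet_Ioi
    (hI.mono_set (Set.Ioc_subset_Ioi_self)) (hI.mono_set (Set.Ioi_subset_Ioi hy))
  rw [Set.Ioc_union_Ioi_eq_Ioi hy] at h1
  rw [h1, add_sub_assoc, add_sub_cancel_right, ← intervalIntegral.integral_of_le hy,
    ← intervalIntegral.integral_add]
  · congr 1
    ext σ
    rw [expSum_logF]
    simp
    ring
  · have := continuous_logDivMain i
    exact Continuous.intervalIntegrable (by fun_prop) _ _
  · rw [intervalIntegrable_iff_integrableOn_Ioc_of_le hy]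
    exact hI.mono_set (Set.Ioc_subset_Ioi_self)

/-- An exact formula for the summatory function of `dGen i j n / n`, with a free parameter `y`. -/
lemma exists_pair_formula (i j : ℕ) : ∃ Q : Polynomial ℝ, Q.natDegree ≤ i + j + 2 ∧
    Q.coeff (i + j + 2) = Nat.factorial i * Nat.factorial j / Nat.factorial (i + j + 2) ∧
    ∀ T y : ℝ, 0 ≤ y → y ≤ T → expSum (dirConv (logF i) (logF j)) T = Q.eval T +
      ∑ a ∈ Finset.Icc 1 ⌊Real.exp y⌋₊, logF i a * logDivErr j (T - Real.log a) +
      ∑ b ∈ Finset.Icc 1 ⌊Real.exp (T - y)⌋₊, logF j b * logDivErr i (T - Real.log b) -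
      logDivErr i y * logDivErr j (T - y) -
      (∫ σ in Set.Ioi y, logDivErr i σ * (Polynomial.X ^ j : Polynomial ℝ).eval (T - σ)) -
      (∫ σ in Set.Ioi (T - y), logDivErr j σ * (Polynomial.X ^ i : Polynomial ℝ).eval (T - σ)) := by
  have hP : ∀ i j : ℕ, ∃ P : Polynomial ℝ, P.natDegree ≤ j ∧ ∀ T : ℝ,
      ∫ σ in Set.Ioi (0 : ℝ), logDivErr i σ * (Polynomial.X ^ j : Polynomial ℝ).eval (T - σ) =
        P.eval T := by
    intro i j
    obtain ⟨K, hK, hB⟩ := abs_logDivErr_le i (ε := 1 / 2) (by norm_num) le_rfl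
    exact exists_poly_integral_Ioi (measurable_logDivErr i) (c := 1 - 1 / 2) (by norm_num) hB
      (Polynomial.X ^ j) (Polynomial.natDegree_X_pow_le j)
  obtain ⟨P₁, hP₁, hP₁'⟩ := hP i j
  obtain ⟨P₂, hP₂, hP₂'⟩ := hP j i
  set R : Polynomial ℝ := Polynomial.C (stieltjesConst j / (i + 1)) * Polynomial.X ^ (i + 1) +
    Polynomial.C (stieltjesConst i / (j + 1)) * Polynomial.X ^ (j + 1) +
    Polynomial.C (stieltjesConst i * stieltjesConst j) + P₁ + P₂ with hR
  have hRdeg : R.natDegree ≤ i + j + 1 := by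
    refine Polynomial.natDegree_add_le_of_degree_le (Polynomial.natDegree_add_le_of_degree_le
      (Polynomial.natDegree_add_le_of_degree_le (Polynomial.natDegree_add_le_of_degree_le ?_ ?_) ?_)
      (by omega)) (by omega)
    · exact (Polynomial.natDegree_C_mul_X_pow_le _ _).trans (by omega)
    · exact (Polynomial.natDegree_C_mul_X_pow_le _ _).trans (by omega)
    · rw [Polynomial.natDegree_C]; omega
  refine ⟨Polynomial.C (Nat.factorial i * Nat.factorial j / Nat.factorial (i + j + 2) : ℝ) *
    Polynomial.X ^ (i + j + 2) + R, ?_, ?_, ?_⟩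
  · exact Polynomial.natDegree_add_le_of_degree_le (Polynomial.natDegree_C_mul_X_pow_le _ _)
      (by omega)
  · rw [Polynomial.coeff_add, Polynomial.coeff_eq_zero_of_natDegree_lt (p := R) (by omega)]
    simp
  · intro T y hy hyT
    have hTy : 0 ≤ T - y := by linarith
    rw [expSum_dirConv_hyperbola _ _ hy hyT]
    have e1 : ∀ a : ℕ, logF i a * expSum (logF j) (T - Real.log a) =
        logF i a * logDivErr j (T - Real.log a) + logF i a * logDivMain j (T - Real.log a) := by
      intro a; rw [expSum_logF]; ring
    have e2 : ∀ a : ℕ, logF j a * expSum (logF i) (T - Real.log a) =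
        logF j a * logDivErr i (T - Real.log a) + logF j a * logDivMain i (T - Real.log a) := by
      intro a; rw [expSum_logF]; ring
    simp_rw [e1, e2]
    rw [Finset.sum_add_distrib, Finset.sum_add_distrib, sum_logF_mul_logDivMain i j hy,
      sum_logF_mul_logDivMain j i hTy, integral_expSum_logF_mul i j hy,
      integral_expSum_logF_mul j i hTy, hP₁', hP₂', expSum_logF, expSum_logF,
      show T - (T - y) = y by ring]
    have := logDivMain_parts i j T y
    simp only [hR, Polynomial.eval_add, Polynomial.eval_mul, Polynomial.eval_C, Polynomial.eval_pow,
      Polynomial.eval_X] at this ⊢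
    linear_combination this

/-- The main term in the pair formula. -/
noncomputable def pairMain (i j : ℕ) : Polynomial ℝ := (exists_pair_formula i j).choose

lemma natDegree_pairMain_le (i j : ℕ) : (pairMain i j).natDegree ≤ i + j + 2 :=
  (exists_pair_formula i j).choose_spec.1

lemma coeff_pairMain (i j : ℕ) : (pairMain i j).coeff (i + j + 2) =
    Nat.factorial i * Nat.factorial j / Nat.factorial (i + j + 2) :=
  (exists_pair_formula i j).choose_spec.2.1

/-- The error term for the summatory function of `dGen i j n / n`, extended by zero. -/
noncomputable def pairErr (i j : ℕ) (τ : ℝ) : ℝ :=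
  if 0 ≤ τ then expSum (dirConv (logF i) (logF j)) τ - (pairMain i j).eval τ else 0

lemma pairErr_eq (i j : ℕ) {T y : ℝ} (hy : 0 ≤ y) (hyT : y ≤ T) : pairErr i j T =
      ∑ a ∈ Finset.Icc 1 ⌊Real.exp y⌋₊, logF i a * logDivErr j (T - Real.log a) +
      ∑ b ∈ Finset.Icc 1 ⌊Real.exp (T - y)⌋₊, logF j b * logDivErr i (T - Real.log b) -
      logDivErr i y * logDivErr j (T - y) -
      (∫ σ in Set.Ioi y, logDivErr i σ * (Polynomial.X ^ j : Polynomial ℝ).eval (T - σ)) -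
      (∫ σ in Set.Ioi (T - y), logDivErr j σ * (Polynomial.X ^ i : Polynomial ℝ).eval (T - σ)) := by
  have := (exists_pair_formula i j).choose_spec.2.2 T y hy hyT
  rw [pairErr, if_pos (hy.trans hyT), this]
  unfold pairMain
  ring

lemma measurable_pairErr (i j : ℕ) : Measurable (pairErr i j) := by
  unfold pairErr
  refine Measurable.ite measurableSet_Ici ?_ measurable_const
  exact (measurable_expSum _).sub (by fun_prop)

lemma one_add_pow_le_const_mul_exp (n : ℕ) {η : ℝ} (hη : 0 < η) : ∃ K : ℝ, 0 < K ∧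
    ∀ σ : ℝ, 0 ≤ σ → (1 + σ) ^ n ≤ K * Real.exp (η * σ) := by
  refine ⟨Nat.factorial n / η ^ n * Real.exp η, by positivity, fun σ hσ => ?_⟩
  refine (pow_le_const_mul_exp n hη (by linarith)).trans (le_of_eq ?_)
  rw [mul_assoc, ← Real.exp_add]
  congr 2; ring

lemma abs_sum_logF_mul_le (i : ℕ) {φ : ℕ → ℝ} {y T M η : ℝ} (hη : 0 ≤ η) (hy : 0 ≤ y)
    (hφ : ∀ a ∈ Finset.Icc 1 ⌊Real.exp y⌋₊, |φ a| ≤ M * Real.exp (-(1 - η) * (T - Real.log a))) :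
    |∑ a ∈ Finset.Icc 1 ⌊Real.exp y⌋₊, logF i a * φ a| ≤
      M * y ^ i * Real.exp y * Real.exp (-(1 - η) * T) := by
  have hM : 0 ≤ M := by
    have h1 : 1 ∈ Finset.Icc 1 ⌊Real.exp y⌋₊ := by
      rw [Finset.mem_Icc]
      exact ⟨le_rfl, Nat.le_floor (by simpa using Real.one_le_exp hy)⟩
    have := (abs_nonneg _).trans (hφ 1 h1)
    exact nonneg_of_mul_nonneg_left this (Real.exp_pos _)
  refine (Finset.abs_sum_le_sum_abs _ _).trans ?_
  have : ∀ a ∈ Finset.Icc 1 ⌊Real.exp y⌋₊, |logF i a * φ a| ≤ M * y ^ i * Real.exp (-(1 - η) * T) := by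
    intro a ha
    have ha' := Finset.mem_Icc.mp ha
    have ha0 : (0 : ℝ) < a := by exact_mod_cast ha'.1
    have hl0 : 0 ≤ Real.log a := Real.log_natCast_nonneg a
    have hly : Real.log a ≤ y := (log_le_iff_le_floor_exp ha'.1 y).mpr ha'.2
    rw [abs_mul, abs_of_nonneg (logF_nonneg i a)]
    have e1 : Real.exp (-(1 - η) * (T - Real.log a)) ≤ Real.exp (-(1 - η) * T) * a := by
      calc _ ≤ Real.exp (-(1 - η) * T + Real.log a) := by
            apply Real.exp_le_exp.mpr
            nlinarith
        _ = _ := by rw [Real.exp_add, Real.exp_log ha0]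
    calc logF i a * |φ a| ≤ Real.log a ^ i / a * (M * (Real.exp (-(1 - η) * T) * a)) := by
          have := hφ a ha
          have h2 := logF_nonneg i a
          unfold logF at h2 ⊢
          gcongr
          exact this.trans (by gcongr)
      _ = M * Real.log a ^ i * Real.exp (-(1 - η) * T) := by field_simp
      _ ≤ _ := by gcongr
  refine (Finset.sum_le_sum this).trans ?_
  rw [Finset.sum_const, nsmul_eq_mul, Nat.card_Icc, Nat.add_sub_cancel]
  have := Nat.floor_le (Real.exp_pos y).le
  calc _ ≤ Real.exp y * (M * y ^ i * Real.exp (-(1 - η) * T)) := by gcongr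
    _ = _ := by ring

lemma abs_pairErr_le (i j : ℕ) {ε : ℝ} (hε : 0 < ε) : ∃ K : ℝ, 0 < K ∧
    ∀ τ : ℝ, 0 ≤ τ → |pairErr i j τ| ≤ K * Real.exp (-(1 / 2 - ε) * τ) := by
  set η := min (ε / 4) (1 / 8) with hη
  have hη0 : 0 < η := lt_min (by positivity) (by norm_num)
  have hη8 : η ≤ 1 / 8 := min_le_right _ _
  have hηε : 4 * η ≤ ε := by have := min_le_left (ε / 4) (1 / 8); linarith
  obtain ⟨Ki, hKi, hi⟩ := abs_logDivErr_le i hη0 (by linarith)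
  obtain ⟨Kj, hKj, hj⟩ := abs_logDivErr_le j hη0 (by linarith)
  obtain ⟨L, hL, hLe⟩ := one_add_pow_le_const_mul_exp (i + j) hη0
  obtain ⟨M₁, hM₁, hT₁⟩ := abs_tail_integral_le (measurable_logDivErr i) hi (Polynomial.X ^ j) hη0
    (by linarith)
  obtain ⟨M₂, hM₂, hT₂⟩ := abs_tail_integral_le (measurable_logDivErr j) hj (Polynomial.X ^ i) hη0
    (by linarith)
  refine ⟨Kj * L + Ki * L + Ki * Kj + M₁ + M₂, by positivity, fun τ hτ => ?_⟩
  have hy : 0 ≤ τ / 2 := by positivity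
  rw [pairErr_eq i j hy (by linarith)]
  have hmem : ∀ a ∈ Finset.Icc 1 ⌊Real.exp (τ / 2)⌋₊, 0 ≤ τ - Real.log a := by
    intro a ha
    have := (log_le_iff_le_floor_exp (Finset.mem_Icc.mp ha).1 (τ / 2)).mpr (Finset.mem_Icc.mp ha).2
    linarith
  have h1 := abs_sum_logF_mul_le i (φ := fun a => logDivErr j (τ - Real.log a)) hη0.le hy
    (fun a ha => hj _ (hmem a ha))
  have h2 := abs_sum_logF_mul_le j (φ := fun a => logDivErr i (τ - Real.log a)) hη0.le hy
    (fun a ha => hi _ (hmem a ha))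
  have hpow : ∀ n : ℕ, n ≤ i + j → (τ / 2) ^ n ≤ L * Real.exp (η * τ) := by
    intro n hn
    refine le_trans ?_ (hLe τ hτ)
    calc (τ / 2) ^ n ≤ (1 + τ) ^ n := by gcongr; linarith
      _ ≤ _ := pow_le_pow_right₀ (by linarith) hn
  set E := Real.exp (-(1 / 2 - ε) * τ) with hE
  have hE1 : Real.exp (η * τ) * Real.exp (τ / 2) * Real.exp (-(1 - η) * τ) ≤ E := by
    rw [← Real.exp_add, ← Real.exp_add, hE]
    apply Real.exp_le_exp.mpr
    nlinarith
  have b1 : |∑ a ∈ Finset.Icc 1 ⌊Real.exp (τ / 2)⌋₊, logF i a * logDivErr j (τ - Real.log a)| ≤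
      Kj * L * E := by
    refine h1.trans ?_
    calc _ ≤ Kj * (L * Real.exp (η * τ)) * Real.exp (τ / 2) * Real.exp (-(1 - η) * τ) := by
          gcongr
          exact hpow i (by omega)
      _ = Kj * L * (Real.exp (η * τ) * Real.exp (τ / 2) * Real.exp (-(1 - η) * τ)) := by ring
      _ ≤ _ := by gcongr
  have b2 : |∑ a ∈ Finset.Icc 1 ⌊Real.exp (τ / 2)⌋₊, logF j a * logDivErr i (τ - Real.log a)| ≤
      Ki * L * E := by
    refine h2.trans ?_
    calc _ ≤ Ki * (L * Real.exp (η * τ)) * Real.exp (τ / 2) * Real.exp (-(1 - η) * τ) := by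
          gcongr
          exact hpow j (by omega)
      _ = Ki * L * (Real.exp (η * τ) * Real.exp (τ / 2) * Real.exp (-(1 - η) * τ)) := by ring
      _ ≤ _ := by gcongr
  have b3 : |logDivErr i (τ / 2) * logDivErr j (τ / 2)| ≤ Ki * Kj * E := by
    rw [abs_mul]
    calc _ ≤ (Ki * Real.exp (-(1 - η) * (τ / 2))) * (Kj * Real.exp (-(1 - η) * (τ / 2))) := by
          gcongr
          · exact hi _ hy
          · exact hj _ hy
      _ = Ki * Kj * (Real.exp (-(1 - η) * (τ / 2)) * Real.exp (-(1 - η) * (τ / 2))) := by ring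
      _ ≤ _ := by
          gcongr
          rw [← Real.exp_add, hE]
          apply Real.exp_le_exp.mpr
          nlinarith
  have hE2 : Real.exp (η * τ) * Real.exp (-(1 - η - η) * (τ / 2)) ≤ E := by
    rw [← Real.exp_add, hE]
    apply Real.exp_le_exp.mpr
    nlinarith
  have b4 := hT₁ τ (τ / 2) hτ hy
  have b5 := hT₂ τ (τ / 2) hτ hy
  rw [mul_assoc] at b4 b5
  have b4' := b4.trans (mul_le_mul_of_nonneg_left hE2 hM₁.le)
  have b5' := b5.trans (mul_le_mul_of_nonneg_left hE2 hM₂.le)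
  rw [show τ - τ / 2 = τ / 2 by ring]
  refine (abs_sub _ _).trans ?_
  refine (add_le_add ((abs_sub _ _).trans (add_le_add ((abs_sub _ _).trans (add_le_add
    ((abs_add_le _ _).trans (add_le_add b1 b2)) b3)) b4')) b5').trans (le_of_eq (by ring))

/-- The weighted sum of discrepancies with a sharp cutoff. -/
noncomputable def discSum (l M h : ℕ) (m : ℤ) : ℝ :=
  ∑ a ∈ Finset.Icc 1 M, Real.log a ^ l * mulDisc a h m

lemma mulDisc_eq (a h m : ℕ) :
    mulDisc a h m = (((m + h) / a : ℕ) : ℝ) - ((m / a : ℕ) : ℝ) - h / a := by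
  unfold mulDisc
  induction h with
  | zero => simp
  | succ h ih =>
    rw [Finset.sum_range_succ, ih, show m + (h + 1) = (m + h) + 1 from rfl, Nat.succ_div]
    have : ((a : ℤ) ∣ (m : ℤ) + ((h : ℤ) + 1)) ↔ a ∣ m + h + 1 := by
      rw [show (m : ℤ) + ((h : ℤ) + 1) = ((m + h + 1 : ℕ) : ℤ) by push_cast; ring]
      exact Int.natCast_dvd_natCast
    by_cases hd : a ∣ m + h + 1
    · simp only [this, hd, if_true]
      push_cast
      ring
    · simp only [this, hd, if_false]
      push_cast
      ring

lemma sum_Icc_one_div_le {M : ℕ} {σ : ℝ} (hσ : Real.log M ≤ σ) :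
    ∑ a ∈ Finset.Icc 1 M, (1 : ℝ) / a ≤ 1 + σ := by
  have := harmonic_le_one_add_log M
  rw [harmonic_eq_sum_Icc] at this
  push_cast at this
  simp only [one_div]
  linarith

lemma abs_sum_log_pow_mul_floor_sub_le (i j : ℕ) {σ u : ℝ} (hσ : 0 ≤ σ) {h m M : ℕ}
    (hM : Real.log M ≤ σ) (hu : |(h : ℝ) - u| ≤ 1) :
    |∑ a ∈ Finset.Icc 1 M, Real.log a ^ i * (σ - Real.log a) ^ j *
      ((((m + h) / a : ℕ) : ℝ) - ((m / a : ℕ) : ℝ) - u / a)| ≤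
      2 ^ j * (1 + σ) ^ j * ∑ l ∈ Finset.range (i + j + 1), |discSum l M h m| +
        (1 + σ) ^ (i + j + 1) := by
  have hlog : ∀ a ∈ Finset.Icc 1 M, 0 ≤ Real.log a ∧ Real.log a ≤ σ := by
    intro a ha
    obtain ⟨h1, h2⟩ := Finset.mem_Icc.mp ha
    refine ⟨Real.log_natCast_nonneg a, (Real.log_le_log (by exact_mod_cast h1)
      (by exact_mod_cast h2)).trans hM⟩
  have hsplit : ∑ a ∈ Finset.Icc 1 M, Real.log a ^ i * (σ - Real.log a) ^ j *
      ((((m + h) / a : ℕ) : ℝ) - ((m / a : ℕ) : ℝ) - u / a) =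
      ∑ s ∈ Finset.range (j + 1), (-1) ^ s * σ ^ (j - s) * (j.choose s) * discSum (i + s) M h m +
      ∑ a ∈ Finset.Icc 1 M, Real.log a ^ i * (σ - Real.log a) ^ j * (((h : ℝ) - u) / a) := by
    simp only [discSum, Finset.mul_sum]
    rw [Finset.sum_comm, ← Finset.sum_add_distrib]
    refine Finset.sum_congr rfl fun a ha => ?_
    have e : (σ - Real.log a) ^ j =
        ∑ s ∈ Finset.range (j + 1), (-Real.log a) ^ s * σ ^ (j - s) * (j.choose s) := by
      rw [← add_pow]; congr 1; ring
    have hD := mulDisc_eq a h m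
    have e2 : Real.log a ^ i * (σ - Real.log a) ^ j *
      ((((m + h) / a : ℕ) : ℝ) - ((m / a : ℕ) : ℝ) - u / a) =
      (σ - Real.log a) ^ j * (Real.log a ^ i * mulDisc a h m) +
        Real.log a ^ i * (σ - Real.log a) ^ j * (((h : ℝ) - u) / a) := by
      rw [hD]; ring
    rw [e2, add_left_inj, e, Finset.sum_mul]
    refine Finset.sum_congr rfl fun s _ => ?_
    rw [neg_pow]; ring
  rw [hsplit]
  refine (abs_add_le _ _).trans (add_le_add ?_ ?_)
  · refine (Finset.abs_sum_le_sum_abs _ _).trans ?_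
    have hle : ∀ s ∈ Finset.range (j + 1),
        |(-1) ^ s * σ ^ (j - s) * (j.choose s) * discSum (i + s) M h m| ≤
        (j.choose s) * ((1 + σ) ^ j * ∑ l ∈ Finset.range (i + j + 1), |discSum l M h m|) := by
      intro s hs
      rw [Finset.mem_range] at hs
      rw [abs_mul, abs_mul, abs_mul, abs_pow, abs_neg, abs_one, one_pow, one_mul,
        abs_of_nonneg (by positivity : 0 ≤ σ ^ (j - s)), Nat.abs_cast]
      have h1 : σ ^ (j - s) ≤ (1 + σ) ^ j :=
        (pow_le_pow_left₀ hσ (by linarith) _).trans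
          (pow_le_pow_right₀ (by linarith) (Nat.sub_le _ _))
      have h2 : |discSum (i + s) M h m| ≤ ∑ l ∈ Finset.range (i + j + 1), |discSum l M h m| :=
        Finset.single_le_sum (f := fun l => |discSum l M h m|) (fun _ _ => abs_nonneg _)
          (Finset.mem_range.mpr (by omega))
      calc _ = (j.choose s : ℝ) * (σ ^ (j - s) * |discSum (i + s) M h m|) := by ring
        _ ≤ _ := by gcongr
    refine (Finset.sum_le_sum hle).trans (le_of_eq ?_)
    rw [← Finset.sum_mul, ← Nat.cast_sum, Nat.sum_range_choose]
    push_cast; ring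
  · refine (Finset.abs_sum_le_sum_abs _ _).trans ?_
    have hle : ∀ a ∈ Finset.Icc 1 M,
        |Real.log a ^ i * (σ - Real.log a) ^ j * (((h : ℝ) - u) / a)| ≤
        (1 + σ) ^ (i + j) * (1 / a) := by
      intro a ha
      obtain ⟨h1, h2⟩ := hlog a ha
      rw [abs_mul, abs_of_nonneg (mul_nonneg (pow_nonneg h1 _) (pow_nonneg (by linarith) _)),
        abs_div, Nat.abs_cast, pow_add]
      have : 0 ≤ σ - Real.log a := by linarith
      gcongr <;> linarith
    refine (Finset.sum_le_sum hle).trans ?_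
    rw [← Finset.mul_sum, pow_succ]
    exact mul_le_mul_of_nonneg_left (sum_Icc_one_div_le hM) (by positivity)

lemma abs_sum_logF_mul_logDivErr_sub_le (i j : ℕ) {η : ℝ} (hη : 0 < η) (hη8 : η ≤ 1 / 8) :
    ∃ K : ℝ, 0 < K ∧ ∀ σ δ z : ℝ, 0 ≤ σ → 0 ≤ δ → 0 ≤ z → z ≤ σ →
    |∑ a ∈ Finset.Icc 1 ⌊Real.exp z⌋₊, logF i a * (logDivErr j (σ + δ - Real.log a) -
      logDivErr j (σ - Real.log a))| ≤ K * Real.exp (η * σ) * (Real.exp (-σ) *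
        (∑ l ∈ Finset.range (i + j + 1), |discSum l ⌊Real.exp z⌋₊
          (⌊Real.exp (σ + δ)⌋₊ - ⌊Real.exp σ⌋₊) ⌊Real.exp σ⌋₊|) + Real.exp (-σ) +
        δ * Real.exp (z - σ)) := by
  have hη2 : 0 < η / 2 := by positivity
  obtain ⟨K, hK, hloc⟩ := logDivErr_local j hη2 (by linarith)
  obtain ⟨L, hL, hLe⟩ := one_add_pow_le_const_mul_exp (i + j + 1) hη2
  refine ⟨2 ^ j * L + L + K * L, by positivity, fun σ δ z hσ hδ hz hzσ => ?_⟩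
  set m := ⌊Real.exp σ⌋₊ with hm
  set n := ⌊Real.exp (σ + δ)⌋₊ with hn
  set M := ⌊Real.exp z⌋₊ with hMdef
  set S := ∑ l ∈ Finset.range (i + j + 1), |discSum l M (n - m) m| with hS
  have hS0 : 0 ≤ S := Finset.sum_nonneg fun _ _ => abs_nonneg _
  have hmn : m ≤ n := Nat.floor_le_floor (Real.exp_le_exp.mpr (by linarith))
  have hlog : ∀ a ∈ Finset.Icc 1 M, Real.log a ≤ σ := fun a ha =>
    ((log_le_iff_le_floor_exp (Finset.mem_Icc.mp ha).1 z).mpr (Finset.mem_Icc.mp ha).2).trans hzσ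
  have hlogM : Real.log M ≤ σ := by
    have h1 : 1 ≤ M := Nat.le_floor (by simpa using Real.one_le_exp hz)
    exact hlog M (Finset.mem_Icc.mpr ⟨h1, le_rfl⟩)
  set u := Real.exp (σ + δ) - Real.exp σ with hu
  have hu1 : |((n - m : ℕ) : ℝ) - u| ≤ 1 := by
    rw [Nat.cast_sub hmn, hu]
    have h1 := Nat.floor_le (Real.exp_pos σ).le
    have h2 := Nat.floor_le (Real.exp_pos (σ + δ)).le
    have h3 := Nat.lt_floor_add_one (Real.exp σ)
    have h4 := Nat.lt_floor_add_one (Real.exp (σ + δ))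
    rw [abs_le]
    constructor <;> linarith
  have hpow : ∀ k ≤ i + j + 1, (1 + σ) ^ k ≤ L * Real.exp (η / 2 * σ) := fun k hk =>
    (pow_le_pow_right₀ (by linarith) hk).trans (hLe σ hσ)
  have hηe : Real.exp (η / 2 * σ) ≤ Real.exp (η * σ) := by
    apply Real.exp_le_exp.mpr; nlinarith
  set r : ℕ → ℝ := fun a => logDivErr j (σ + δ - Real.log a) - logDivErr j (σ - Real.log a) -
    (σ - Real.log a) ^ j * (a * Real.exp (-σ)) *
      ((((m + (n - m)) / a : ℕ) : ℝ) - ((m / a : ℕ) : ℝ) - u / a) with hr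
  have hrle : ∀ a ∈ Finset.Icc 1 M,
      |r a| ≤ (K * δ) * Real.exp (-(1 - η / 2) * (σ - Real.log a)) := by
    intro a ha
    have ha1 := (Finset.mem_Icc.mp ha).1
    have ha0 : (0 : ℝ) < a := by exact_mod_cast ha1
    refine le_trans (le_of_eq ?_) (hloc (σ - Real.log a) δ (by linarith [hlog a ha]) hδ)
    have e1 : σ - Real.log a + δ = σ + δ - Real.log a := by ring
    rw [e1, floor_exp_sub_log ha1, floor_exp_sub_log ha1, hr, Nat.add_sub_cancel' hmn,
      Real.exp_sub, Real.exp_sub, Real.exp_log ha0, ← hm, ← hn, hu, Real.exp_neg]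
    congr 1
    have := Real.exp_pos σ
    field_simp
  have hmain := abs_sum_log_pow_mul_floor_sub_le i j hσ (m := m) hlogM hu1
  have hrem := abs_sum_logF_mul_le i (φ := r) (y := z) (T := σ) hη2.le hz hrle
  have hdec : ∑ a ∈ Finset.Icc 1 M, logF i a * (logDivErr j (σ + δ - Real.log a) -
      logDivErr j (σ - Real.log a)) = Real.exp (-σ) *
      (∑ a ∈ Finset.Icc 1 M, Real.log a ^ i * (σ - Real.log a) ^ j *
      ((((m + (n - m)) / a : ℕ) : ℝ) - ((m / a : ℕ) : ℝ) - u / a)) +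
      ∑ a ∈ Finset.Icc 1 M, logF i a * r a := by
    rw [Finset.mul_sum, ← Finset.sum_add_distrib]
    refine Finset.sum_congr rfl fun a ha => ?_
    have ha0 : (0 : ℝ) < a := by exact_mod_cast (Finset.mem_Icc.mp ha).1
    simp only [hr, logF]
    field_simp
    ring
  rw [hdec]
  refine (abs_add_le _ _).trans ?_
  rw [abs_mul, abs_of_pos (Real.exp_pos _)]
  have h1 : Real.exp (-σ) * |∑ a ∈ Finset.Icc 1 M, Real.log a ^ i * (σ - Real.log a) ^ j *
      ((((m + (n - m)) / a : ℕ) : ℝ) - ((m / a : ℕ) : ℝ) - u / a)| ≤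
      Real.exp (-σ) * (2 ^ j * (L * Real.exp (η * σ)) * S + L * Real.exp (η * σ)) := by
    refine mul_le_mul_of_nonneg_left (hmain.trans ?_) (Real.exp_pos _).le
    have a1 := (hpow j (by omega)).trans (mul_le_mul_of_nonneg_left hηe hL.le)
    have a2 := (hpow (i + j + 1) le_rfl).trans (mul_le_mul_of_nonneg_left hηe hL.le)
    gcongr
  have h2 : |∑ a ∈ Finset.Icc 1 M, logF i a * r a| ≤
      K * L * Real.exp (η * σ) * (δ * Real.exp (z - σ)) := by
    refine hrem.trans ?_
    have a1 : z ^ i ≤ L * Real.exp (η / 2 * σ) :=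
      (pow_le_pow_left₀ hz (by linarith) _).trans (hpow i (by omega))
    calc _ ≤ K * δ * (L * Real.exp (η / 2 * σ)) * Real.exp z * Real.exp (-(1 - η / 2) * σ) := by
          gcongr
      _ = K * L * (Real.exp (η / 2 * σ) * Real.exp z * Real.exp (-(1 - η / 2) * σ)) * δ := by ring
      _ = K * L * (Real.exp (η * σ) * Real.exp (z - σ)) * δ := by
          simp only [← Real.exp_add]
          congr 3; ring
      _ = _ := by ring
  refine (add_le_add h1 h2).trans ?_
  have p1 := Real.exp_pos (η * σ)
  have p2 := Real.exp_pos (-σ)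
  have p3 := Real.exp_pos (z - σ)
  have q1 : 0 ≤ Real.exp (η * σ) * Real.exp (-σ) := by positivity
  have q2 : 0 ≤ Real.exp (η * σ) * (δ * Real.exp (z - σ)) := by positivity
  have q3 : 0 ≤ Real.exp (η * σ) * (Real.exp (-σ) * S) := by positivity
  have t1 : 0 ≤ (L + K * L) * (Real.exp (η * σ) * (Real.exp (-σ) * S)) := by positivity
  have t2 : 0 ≤ (2 ^ j * L + K * L) * (Real.exp (η * σ) * Real.exp (-σ)) := by positivity
  have t3 : 0 ≤ (2 ^ j * L + L) * (Real.exp (η * σ) * (δ * Real.exp (z - σ))) := by positivity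
  linarith

lemma abs_sum_Ioc_logF_mul_logDivErr_le (i j : ℕ) {η : ℝ} (hη : 0 < η) (hη8 : η ≤ 1 / 8) :
    ∃ K : ℝ, 0 < K ∧ ∀ σ δ z : ℝ, 0 ≤ σ → 0 ≤ δ → δ ≤ 1 → 0 ≤ z → z ≤ σ →
    |∑ b ∈ Finset.Ioc ⌊Real.exp z⌋₊ ⌊Real.exp (z + δ)⌋₊,
      logF j b * logDivErr i (σ + δ - Real.log b)| ≤
      K * Real.exp (η * σ) * (δ + Real.exp (-z)) * Real.exp (z - σ) := by
  have hη2 : 0 < η / 2 := by positivity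
  obtain ⟨K, hK, hB⟩ := abs_logDivErr_le i hη2 (by linarith)
  obtain ⟨L, hL, hLe⟩ := one_add_pow_le_const_mul_exp j hη2
  refine ⟨2 * K * L, by positivity, fun σ δ z hσ hδ hδ1 hz hzσ => ?_⟩
  have hle : ∀ b ∈ Finset.Ioc ⌊Real.exp z⌋₊ ⌊Real.exp (z + δ)⌋₊,
      |logF j b * logDivErr i (σ + δ - Real.log b)| ≤
      L * Real.exp (η / 2 * σ) * Real.exp (-z) * (K * Real.exp (-(1 - η / 2) * (σ - z))) := by
    intro b hb
    obtain ⟨h1, h2⟩ := Finset.mem_Ioc.mp hb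
    have hb1 : 1 ≤ b := by omega
    have hb0 : (0 : ℝ) < b := by exact_mod_cast hb1
    have hlb : z ≤ Real.log b := by
      rw [Real.le_log_iff_exp_le hb0]
      exact (Nat.lt_of_floor_lt h1).le
    have hub : Real.log b ≤ z + δ := (log_le_iff_le_floor_exp hb1 _).mpr h2
    rw [abs_mul, abs_of_nonneg (logF_nonneg j b)]
    have e1 : logF j b ≤ L * Real.exp (η / 2 * σ) * Real.exp (-z) := by
      unfold logF
      rw [div_eq_mul_inv]
      have : (b : ℝ)⁻¹ ≤ Real.exp (-z) := by
        rw [Real.exp_neg]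
        apply inv_anti₀ (Real.exp_pos _)
        rw [← Real.exp_log hb0]
        exact Real.exp_le_exp.mpr hlb
      have h3 : Real.log b ^ j ≤ L * Real.exp (η / 2 * σ) := by
        refine le_trans ?_ (hLe σ hσ)
        exact pow_le_pow_left₀ (by linarith) (by linarith) _
      gcongr
    have e2 : |logDivErr i (σ + δ - Real.log b)| ≤ K * Real.exp (-(1 - η / 2) * (σ - z)) := by
      refine (hB _ (by linarith)).trans ?_
      have : -(1 - η / 2) * (σ + δ - Real.log b) ≤ -(1 - η / 2) * (σ - z) := by nlinarith
      gcongr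
    have := logF_nonneg j b
    gcongr
  refine (Finset.abs_sum_le_sum_abs _ _).trans ((Finset.sum_le_sum hle).trans ?_)
  rw [Finset.sum_const, nsmul_eq_mul, Nat.card_Ioc]
  have hcard : ((⌊Real.exp (z + δ)⌋₊ - ⌊Real.exp z⌋₊ : ℕ) : ℝ) ≤ 2 * Real.exp z * (δ + Real.exp (-z)) := by
    rw [Nat.cast_sub (Nat.floor_le_floor (Real.exp_le_exp.mpr (by linarith)))]
    have h2 := Nat.floor_le (Real.exp_pos (z + δ)).le
    have h3 := Nat.lt_floor_add_one (Real.exp z)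
    have h4 : Real.exp δ ≤ 1 + 2 * δ := by
      have := Real.abs_exp_sub_one_le (x := δ) (by rwa [abs_of_nonneg hδ])
      rw [abs_of_nonneg hδ] at this
      linarith [le_abs_self (Real.exp δ - 1)]
    have h5 : Real.exp z * Real.exp (-z) = 1 := by rw [← Real.exp_add]; simp
    rw [Real.exp_add] at h2 ⊢
    nlinarith [Real.exp_pos z]
  calc _ ≤ (2 * Real.exp z * (δ + Real.exp (-z))) *
        (L * Real.exp (η / 2 * σ) * Real.exp (-z) * (K * Real.exp (-(1 - η / 2) * (σ - z)))) := by
        gcongr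
    _ = 2 * K * L * (Real.exp z * Real.exp (-z)) *
        (Real.exp (η / 2 * σ) * Real.exp (-(1 - η / 2) * (σ - z))) * (δ + Real.exp (-z)) := by ring
    _ ≤ 2 * K * L * 1 * (Real.exp (η * σ) * Real.exp (z - σ)) * (δ + Real.exp (-z)) := by
        have h5 : Real.exp z * Real.exp (-z) = 1 := by rw [← Real.exp_add]; simp
        rw [h5]
        have : Real.exp (η / 2 * σ) * Real.exp (-(1 - η / 2) * (σ - z)) ≤
            Real.exp (η * σ) * Real.exp (z - σ) := by
          rw [← Real.exp_add, ← Real.exp_add]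
          apply Real.exp_le_exp.mpr
          nlinarith
        gcongr
    _ = _ := by ring

set_option maxHeartbeats 1000000 in
lemma abs_pairErr_add_sub_le (i j : ℕ) {η : ℝ} (hη : 0 < η) (hη8 : η ≤ 1 / 8) :
    ∃ K : ℝ, 0 < K ∧ ∀ σ δ y : ℝ, 0 ≤ σ → 0 ≤ δ → δ ≤ 1 → 0 ≤ y → y ≤ σ → |y - σ / 2| ≤ 2 →
    |pairErr i j (σ + δ) - pairErr i j σ| ≤ K * Real.exp (η * σ) * (Real.exp (-σ) *
        (∑ l ∈ Finset.range (i + j + 1), (|discSum l ⌊Real.exp y⌋₊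
          (⌊Real.exp (σ + δ)⌋₊ - ⌊Real.exp σ⌋₊) ⌊Real.exp σ⌋₊| +
          |discSum l ⌊Real.exp (σ - y)⌋₊
          (⌊Real.exp (σ + δ)⌋₊ - ⌊Real.exp σ⌋₊) ⌊Real.exp σ⌋₊|)) + Real.exp (-σ) +
        δ * Real.exp (-σ / 2)) := by
  have hη2 : 0 < η / 2 := by positivity
  have hη4 : 0 < η / 4 := by positivity
  obtain ⟨K₁, hK₁, h₁⟩ := abs_sum_logF_mul_logDivErr_sub_le i j hη hη8
  obtain ⟨K₂, hK₂, h₂⟩ := abs_sum_logF_mul_logDivErr_sub_le j i hη hη8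
  obtain ⟨K₃, hK₃, h₃⟩ := abs_sum_Ioc_logF_mul_logDivErr_le i j hη hη8
  obtain ⟨Ki, hKi, hi⟩ := abs_logDivErr_le i hη4 (by linarith)
  obtain ⟨Kj, hKj, hj⟩ := abs_logDivErr_le j hη4 (by linarith)
  obtain ⟨M₁, hM₁, hT₁⟩ := abs_tail_integral_sub_le (measurable_logDivErr i) (by linarith) hi
    (Polynomial.X ^ j) hη4 (by linarith)
  obtain ⟨M₂, hM₂, hT₂⟩ := abs_tail_integral_sub_le (measurable_logDivErr j) (by linarith) hj
    (Polynomial.X ^ i) hη4 (by linarith)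
  set W := Real.exp 2 with hW
  have hW1 : 1 ≤ W := by rw [hW]; exact Real.one_le_exp (by norm_num)
  refine ⟨K₁ * W + K₂ * W + K₃ * W + 2 * (Ki * Kj) + M₁ * W + M₂ * W, by positivity,
    fun σ δ y hσ hδ hδ1 hy hyσ hyy => ?_⟩
  obtain ⟨hy1, hy2⟩ := abs_le.mp hyy
  rw [pairErr_eq i j hy (by linarith : y ≤ σ + δ), pairErr_eq i j hy hyσ]
  set h := ⌊Real.exp (σ + δ)⌋₊ - ⌊Real.exp σ⌋₊ with hh
  set m := ⌊Real.exp σ⌋₊ with hm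
  rw [Finset.sum_add_distrib]
  have i1 := h₁ σ δ y hσ hδ hy hyσ
  have i2 := h₂ σ δ (σ - y) hσ hδ (by linarith) (by linarith)
  rw [add_comm j i] at i2
  set S₁ := ∑ l ∈ Finset.range (i + j + 1), |discSum l ⌊Real.exp y⌋₊ h m| with hS₁
  set S₂ := ∑ l ∈ Finset.range (i + j + 1), |discSum l ⌊Real.exp (σ - y)⌋₊ h m| with hS₂
  have hS₁0 : 0 ≤ S₁ := Finset.sum_nonneg fun _ _ => abs_nonneg _
  have hS₂0 : 0 ≤ S₂ := Finset.sum_nonneg fun _ _ => abs_nonneg _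
  have i3 := h₃ σ δ (σ - y) hσ hδ hδ1 (by linarith) (by linarith)
  have i5 := hT₁ σ y y δ hσ hy hδ hδ1 le_rfl (by linarith)
  have i6 := hT₂ σ (σ - y) (σ - y + δ) δ hσ (by linarith) hδ hδ1 (by linarith) le_rfl
  rw [show σ + δ - y = σ - y + δ by ring]
  set Φ := Real.exp (η * σ) with hΦ
  set e := Real.exp (-σ) with he
  set q := δ * Real.exp (-σ / 2) with hq
  have hq0 : 0 ≤ q := by positivity
  have he0 : 0 < e := Real.exp_pos _
  have hΦ1 : 1 ≤ Φ := Real.one_le_exp (by positivity)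
  have ey : Real.exp (y - σ) ≤ W * Real.exp (-σ / 2) := by
    rw [hW, ← Real.exp_add]; apply Real.exp_le_exp.mpr; linarith
  have ey2 : Real.exp (σ - y - σ) ≤ W * Real.exp (-σ / 2) := by
    rw [hW, ← Real.exp_add]; apply Real.exp_le_exp.mpr; linarith
  have hWm : ∀ v : ℝ, 0 ≤ v → v ≤ W * v := fun v hv => le_mul_of_one_le_left hv hW1
  have j1 : |∑ a ∈ Finset.Icc 1 ⌊Real.exp y⌋₊, logF i a * (logDivErr j (σ + δ - Real.log a) -
      logDivErr j (σ - Real.log a))| ≤ K₁ * W * Φ * (e * (S₁ + S₂) + e + q) := by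
    refine i1.trans ?_
    calc K₁ * Φ * (e * S₁ + e + δ * Real.exp (y - σ)) ≤
        K₁ * Φ * (W * (e * (S₁ + S₂)) + W * e + δ * (W * Real.exp (-σ / 2))) := by
          have t1 : e * S₁ ≤ W * (e * (S₁ + S₂)) := by
            have : e * S₁ ≤ e * (S₁ + S₂) := by gcongr; linarith
            exact this.trans (hWm _ (mul_nonneg he0.le (add_nonneg hS₁0 hS₂0)))
          have t2 : e ≤ W * e := hWm _ he0.le
          gcongr
      _ = _ := by rw [hq]; ring
  have j2 : |∑ a ∈ Finset.Icc 1 ⌊Real.exp (σ - y)⌋₊, logF j a * (logDivErr i (σ + δ - Real.log a) -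
      logDivErr i (σ - Real.log a))| ≤ K₂ * W * Φ * (e * (S₁ + S₂) + e + q) := by
    refine i2.trans ?_
    calc K₂ * Φ * (e * S₂ + e + δ * Real.exp (σ - y - σ)) ≤
        K₂ * Φ * (W * (e * (S₁ + S₂)) + W * e + δ * (W * Real.exp (-σ / 2))) := by
          have t1 : e * S₂ ≤ W * (e * (S₁ + S₂)) := by
            have : e * S₂ ≤ e * (S₁ + S₂) := by gcongr; linarith
            exact this.trans (hWm _ (mul_nonneg he0.le (add_nonneg hS₁0 hS₂0)))
          have t2 : e ≤ W * e := hWm _ he0.le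
          gcongr
      _ = _ := by rw [hq]; ring
  have hpos : 0 ≤ e * (S₁ + S₂) := by positivity
  have j3 : |∑ b ∈ Finset.Ioc ⌊Real.exp (σ - y)⌋₊ ⌊Real.exp (σ - y + δ)⌋₊,
      logF j b * logDivErr i (σ + δ - Real.log b)| ≤ K₃ * W * Φ * (e * (S₁ + S₂) + e + q) := by
    refine i3.trans ?_
    calc _ = K₃ * Φ * (δ * Real.exp (σ - y - σ) +
          Real.exp (-(σ - y)) * Real.exp (σ - y - σ)) := by ring
      _ ≤ K₃ * Φ * (δ * (W * Real.exp (-σ / 2)) + W * e) := by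
          have t1 : Real.exp (-(σ - y)) * Real.exp (σ - y - σ) ≤ W * e := by
            rw [← Real.exp_add]
            have : -(σ - y) + (σ - y - σ) = -σ := by ring
            rw [this]
            exact hWm _ he0.le
          gcongr
      _ ≤ K₃ * Φ * (W * (e * (S₁ + S₂)) + W * e + W * q) := by
          have : 0 ≤ W * (e * (S₁ + S₂)) := by positivity
          refine mul_le_mul_of_nonneg_left ?_ (by positivity)
          rw [hq]; linarith
      _ = _ := by ring
  have prod : ∀ d : ℝ, 0 ≤ d → |logDivErr i y * logDivErr j (σ - y + d)| ≤ Ki * Kj * Φ *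
      (e * (S₁ + S₂) + e + q) := by
    intro d hd
    rw [abs_mul]
    calc _ ≤ (Ki * Real.exp (-(1 - η / 4) * y)) * (Kj * Real.exp (-(1 - η / 4) * (σ - y + d))) := by
          gcongr
          · exact hi _ hy
          · exact hj _ (by linarith)
      _ = Ki * Kj * (Real.exp (-(1 - η / 4) * y) * Real.exp (-(1 - η / 4) * (σ - y + d))) := by ring
      _ ≤ Ki * Kj * (Φ * e) := by
          refine mul_le_mul_of_nonneg_left ?_ (by positivity)
          rw [← Real.exp_add, hΦ, he, ← Real.exp_add]
          apply Real.exp_le_exp.mpr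
          nlinarith
      _ ≤ Ki * Kj * (Φ * (e * (S₁ + S₂) + e + q)) := by
          gcongr; linarith
      _ = _ := by ring
  have j4 := prod δ hδ
  have j4' := prod 0 le_rfl
  rw [add_zero] at j4'
  have tail : ∀ M z : ℝ, 0 < M → 0 ≤ z → -2 ≤ z - σ / 2 →
      M * δ * Real.exp (η / 4 * σ) * Real.exp (-(1 - η / 4 - η / 4) * z) ≤
      M * W * Φ * (e * (S₁ + S₂) + e + q) := by
    intro M z hM hz hz2
    have : Real.exp (η / 4 * σ) * Real.exp (-(1 - η / 4 - η / 4) * z) ≤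
        W * (Φ * Real.exp (-σ / 2)) := by
      rw [hW, hΦ, ← Real.exp_add, ← Real.exp_add, ← Real.exp_add]
      apply Real.exp_le_exp.mpr
      nlinarith
    calc _ = M * δ * (Real.exp (η / 4 * σ) * Real.exp (-(1 - η / 4 - η / 4) * z)) := by ring
      _ ≤ M * δ * (W * (Φ * Real.exp (-σ / 2))) := by gcongr
      _ = M * W * Φ * q := by rw [hq]; ring
      _ ≤ _ := by
        have : q ≤ e * (S₁ + S₂) + e + q := by linarith
        gcongr
  have j5 := i5.trans (tail M₁ y hM₁ hy (by linarith))
  have j6 := i6.trans (tail M₂ (σ - y) hM₂ (by linarith) (by linarith))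
  have hsplit : ∑ b ∈ Finset.Icc 1 ⌊Real.exp (σ - y + δ)⌋₊,
        logF j b * logDivErr i (σ + δ - Real.log b) =
      ∑ b ∈ Finset.Icc 1 ⌊Real.exp (σ - y)⌋₊, logF j b * logDivErr i (σ + δ - Real.log b) +
      ∑ b ∈ Finset.Ioc ⌊Real.exp (σ - y)⌋₊ ⌊Real.exp (σ - y + δ)⌋₊,
        logF j b * logDivErr i (σ + δ - Real.log b) := by
    have hfl : ⌊Real.exp (σ - y)⌋₊ ≤ ⌊Real.exp (σ - y + δ)⌋₊ :=
      Nat.floor_le_floor (Real.exp_le_exp.mpr (by linarith))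
    have hI : ∀ n : ℕ, Finset.Icc 1 n = Finset.Ioc 0 n := fun n => rfl
    rw [hI, hI, Finset.sum_Ioc_consecutive (fun b : ℕ => logF j b * logDivErr i (σ + δ - Real.log b))
      (Nat.zero_le _) hfl]
  rw [hsplit]
  simp only [mul_sub, Finset.sum_sub_distrib] at j1 j2
  set X := Φ * (e * (S₁ + S₂) + e + q) with hX
  rw [mul_assoc _ Φ, ← hX] at j1 j2 j3 j4 j4' j5 j6
  rw [mul_assoc _ Φ, ← hX]
  rw [abs_le] at j1 j2 j3 j4 j4' j5 j6 ⊢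
  constructor <;> linarith [j1.1, j1.2, j2.1, j2.2, j3.1, j3.2, j4.1, j4.2, j4'.1, j4'.2, j5.1,
    j5.2, j6.1, j6.2]

lemma sum_sq_discSum_le (l h : ℕ) {k M : ℕ} (hM : M ≤ 2 ^ (k + 3)) :
    ∑ m ∈ Finset.range (4 ^ (k + 2) + 1), discSum l M h (m : ℕ) ^ 2 ≤
      3 * 4 ^ (k + 4) * h * ((k : ℝ) + 4) ^ (2 * l + 3) := by
  have hlogM : ∀ a : ℕ, 1 ≤ a → a ≤ M → Real.log a ≤ k + 3 := by
    intro a h1 h2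
    have : (a : ℝ) ≤ 2 ^ (k + 3) := by exact_mod_cast h2.trans hM
    have h3 := Real.log_le_log (by exact_mod_cast h1) this
    rw [Real.log_pow] at h3
    have h4 : Real.log 2 ≤ 1 := by linarith [Real.log_two_lt_d9]
    push_cast at h3
    nlinarith [(Nat.cast_nonneg k : (0 : ℝ) ≤ k)]
  have hk : (0 : ℝ) ≤ k := Nat.cast_nonneg k
  have hlog : Real.log M ≤ k + 3 := by
    rcases Nat.eq_zero_or_pos M with rfl | h0
    · simp; linarith
    · exact hlogM M h0 le_rfl
  have hA : M * M ≤ 4 ^ (k + 4) := by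
    calc M * M ≤ 2 ^ (k + 3) * 2 ^ (k + 3) := Nat.mul_le_mul hM hM
      _ = 4 ^ (k + 3) := by rw [← mul_pow]; norm_num
      _ ≤ _ := Nat.pow_le_pow_right (by norm_num) (by omega)
  have hR : 2 * 4 ^ (k + 2) ≤ 4 ^ (k + 4) := by
    rw [show 4 ^ (k + 4) = 16 * 4 ^ (k + 2) by ring]
    omega
  have := sum_sq_mulDisc_le (R := 4 ^ (k + 4)) (by positivity) hA hR (h := h)
    (fun a => Real.log a ^ l) (L := ((k : ℝ) + 4) ^ l) (by
      intro a ha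
      obtain ⟨h1, h2⟩ := Finset.mem_Icc.mp ha
      have h0 := Real.log_natCast_nonneg a
      rw [abs_of_nonneg (by positivity)]
      exact pow_le_pow_left₀ h0 (by linarith [hlogM a h1 h2]) _)
  refine this.trans ?_
  push_cast
  have h0 := Real.log_natCast_nonneg M
  have h5 : 1 + Real.log M ≤ k + 4 := by linarith
  calc _ ≤ 3 * (4 : ℝ) ^ (k + 4) * h * ((k : ℝ) + 4) ^ 3 * (((k : ℝ) + 4) ^ l) ^ 2 := by
        gcongr
    _ = _ := by ring

/-- The total energy of the discrepancy sums over all cutoffs relevant at the scale `4 ^ k`. -/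
noncomputable def discEnergy (J k h m : ℕ) : ℝ :=
  ∑ l ∈ Finset.range (J + 1), ∑ M ∈ Finset.range (2 ^ (k + 3) + 1), discSum l M h (m : ℕ) ^ 2

lemma discEnergy_nonneg (J k h m : ℕ) : 0 ≤ discEnergy J k h m :=
  Finset.sum_nonneg fun _ _ => Finset.sum_nonneg fun _ _ => sq_nonneg _

lemma sum_discEnergy_le (J k h : ℕ) :
    ∑ m ∈ Finset.range (4 ^ (k + 2) + 1), discEnergy J k h m ≤
      12288 * (J + 1) * (2 ^ k * 4 ^ k * ((k : ℝ) + 4) ^ (2 * J + 3)) * h := by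
  unfold discEnergy
  rw [Finset.sum_comm]
  have hk : (0 : ℝ) ≤ k := Nat.cast_nonneg k
  have hle : ∀ l ∈ Finset.range (J + 1), ∑ m ∈ Finset.range (4 ^ (k + 2) + 1),
      ∑ M ∈ Finset.range (2 ^ (k + 3) + 1), discSum l M h (m : ℕ) ^ 2 ≤
      (16 * 2 ^ k) * (3 * 4 ^ (k + 4) * h * ((k : ℝ) + 4) ^ (2 * J + 3)) := by
    intro l hl
    rw [Finset.sum_comm]
    have : ∀ M ∈ Finset.range (2 ^ (k + 3) + 1), ∑ m ∈ Finset.range (4 ^ (k + 2) + 1),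
        discSum l M h (m : ℕ) ^ 2 ≤ 3 * 4 ^ (k + 4) * h * ((k : ℝ) + 4) ^ (2 * J + 3) := by
      intro M hM
      refine (sum_sq_discSum_le l h (Finset.mem_range_succ_iff.mp hM)).trans ?_
      have hl' := Finset.mem_range_succ_iff.mp hl
      gcongr
      · linarith
    refine (Finset.sum_le_sum this).trans ?_
    rw [Finset.sum_const, Finset.card_range, nsmul_eq_mul]
    have h2 : ((2 ^ (k + 3) + 1 : ℕ) : ℝ) ≤ 16 * 2 ^ k := by
      push_cast
      have : (1 : ℝ) ≤ 2 ^ k := one_le_pow₀ (by norm_num)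
      rw [pow_add]; linarith
    gcongr
  refine (Finset.sum_le_sum hle).trans (le_of_eq ?_)
  rw [Finset.sum_const, Finset.card_range, nsmul_eq_mul]
  push_cast
  ring

lemma discSum_add (l M h j m : ℕ) :
    discSum l M (h + j) (m : ℕ) = discSum l M h (m : ℕ) + discSum l M j ((m + h : ℕ) : ℤ) := by
  unfold discSum
  rw [← Finset.sum_add_distrib]
  refine Finset.sum_congr rfl fun a _ => ?_
  rw [mulDisc_eq, mulDisc_eq, mulDisc_eq, ← add_assoc]
  push_cast
  ring

lemma discEnergy_le_add (J k h j m : ℕ) :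
    discEnergy J k h m ≤ 2 * discEnergy J k (h + j) m + 2 * discEnergy J k j (m + h) := by
  unfold discEnergy
  simp only [Finset.mul_sum]
  rw [← Finset.sum_add_distrib]
  refine Finset.sum_le_sum fun l _ => ?_
  rw [← Finset.sum_add_distrib]
  refine Finset.sum_le_sum fun M _ => ?_
  rw [discSum_add]
  nlinarith [sq_nonneg (discSum l M h m + 2 * discSum l M j ((m + h : ℕ) : ℤ))]

lemma mul_discEnergy_le (J k m : ℕ) {h H H' : ℕ} (hH : h + H ≤ H') :
    H * discEnergy J k h m ≤ 2 * ∑ j ∈ Finset.range (H' + 1), discEnergy J k j m +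
      2 * ∑ j ∈ Finset.range (H' + 1), discEnergy J k j (m + h) := by
  have h1 : H * discEnergy J k h m = ∑ j ∈ Finset.range H, discEnergy J k h m := by simp
  rw [h1]
  refine (Finset.sum_le_sum fun j _ => discEnergy_le_add J k h j m).trans ?_
  rw [Finset.sum_add_distrib, ← Finset.mul_sum, ← Finset.mul_sum]
  have a1 : ∑ j ∈ Finset.range H, discEnergy J k (h + j) m ≤
      ∑ j ∈ Finset.range (H' + 1), discEnergy J k j m := by
    rw [← Finset.sum_image (f := fun j => discEnergy J k j m) (g := fun j => h + j)
      (fun x _ y _ hxy => by simpa using hxy)]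
    refine Finset.sum_le_sum_of_subset_of_nonneg ?_ (fun _ _ _ => discEnergy_nonneg _ _ _ _)
    intro x hx
    obtain ⟨y, hy, rfl⟩ := Finset.mem_image.mp hx
    rw [Finset.mem_range] at hy ⊢
    omega
  have a2 : ∑ j ∈ Finset.range H, discEnergy J k j (m + h) ≤
      ∑ j ∈ Finset.range (H' + 1), discEnergy J k j (m + h) :=
    Finset.sum_le_sum_of_subset_of_nonneg (Finset.range_mono (by omega))
      (fun _ _ _ => discEnergy_nonneg _ _ _ _)
  linarith

lemma setIntegral_floor_exp_le {V : ℕ → ℝ} (hV : ∀ m, 0 ≤ V m) {S : Set ℝ} (hS : MeasurableSet S)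
    (hfin : MeasureTheory.volume S ≠ ⊤) {M : ℕ} (hM : ∀ σ ∈ S, ⌊Real.exp σ⌋₊ ≤ M) {c : ℝ}
    (hc : 0 ≤ c) (hpq : ∀ m : ℕ, ∃ p q : ℝ, q - p ≤ c ∧
      ∀ σ ∈ S, ⌊Real.exp σ⌋₊ = m → p ≤ σ ∧ σ ≤ q) :
    MeasureTheory.IntegrableOn (fun σ => V ⌊Real.exp σ⌋₊) S ∧
    ∫ σ in S, V ⌊Real.exp σ⌋₊ ≤ c * ∑ m ∈ Finset.range (M + 1), V m := by
  set E : ℕ → Set ℝ := fun m => {σ | ⌊Real.exp σ⌋₊ = m} with hE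
  have hEm : ∀ m, MeasurableSet (E m) := fun m =>
    (Nat.measurable_floor.comp Real.measurable_exp) (measurableSet_singleton m)
  have heq : Set.EqOn (fun σ => V ⌊Real.exp σ⌋₊)
      (fun σ => ∑ m ∈ Finset.range (M + 1), (E m).indicator (fun _ => V m) σ) S := by
    intro σ hσ
    simp only [hE, Set.indicator, Set.mem_ofPred_eq]
    rw [Finset.sum_ite_eq, if_pos (Finset.mem_range_succ_iff.mpr (hM σ hσ))]
  have hInt : ∀ m ∈ Finset.range (M + 1), MeasureTheory.Integrable
      (fun σ => (E m).indicator (fun _ => V m) σ) (MeasureTheory.volume.restrict S) := by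
    intro m _
    have : MeasureTheory.IntegrableOn (fun _ : ℝ => V m) S :=
      MeasureTheory.integrableOn_const hfin
    exact MeasureTheory.Integrable.indicator this (hEm m)
  constructor
  · exact (MeasureTheory.integrable_finsetSum _ hInt).congr
      ((MeasureTheory.ae_restrict_iff' hS).mpr (Filter.Eventually.of_forall fun σ hσ => (heq hσ).symm))
  · rw [MeasureTheory.setIntegral_congr_fun hS heq, MeasureTheory.integral_finsetSum _ hInt,
      Finset.mul_sum]
    refine Finset.sum_le_sum fun m _ => ?_
    rw [MeasureTheory.integral_indicator_const _ (hEm m), smul_eq_mul]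
    refine mul_le_mul_of_nonneg_right ?_ (hV m)
    obtain ⟨p, q, hpqc, hsub⟩ := hpq m
    rw [MeasureTheory.measureReal_restrict_apply (hEm m)]
    have hsub' : E m ∩ S ⊆ Set.Icc p q := fun σ hσ => hsub σ hσ.2 hσ.1
    refine (MeasureTheory.measureReal_mono hsub' (by simp)).trans ?_
    rw [Real.volume_real_Icc]
    exact max_le hpqc hc

lemma sub_max_log_le (a : ℝ) (m : ℕ) :
    Real.log (m + 1) - max a (Real.log m) ≤ Real.exp (-a) := by
  set c := max a (Real.log m) with hc
  have h1 : Real.exp a ≤ Real.exp c := Real.exp_le_exp.mpr (le_max_left _ _)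
  have h2 : (m : ℝ) ≤ Real.exp c := by
    rcases Nat.eq_zero_or_pos m with rfl | h0
    · simpa using (Real.exp_pos c).le
    · rw [← Real.exp_log (by exact_mod_cast h0 : (0 : ℝ) < m)]
      exact Real.exp_le_exp.mpr (le_max_right _ _)
  have h3 : Real.log (m + 1) - c = Real.log ((m + 1) / Real.exp c) := by
    rw [Real.log_div (by positivity) (Real.exp_pos c).ne', Real.log_exp]
  rw [h3]
  refine (Real.log_le_sub_one_of_pos (by positivity)).trans ?_
  have h4 : ((m : ℝ) + 1) / Real.exp c ≤ 1 + Real.exp (-c) := by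
    rw [Real.exp_neg, div_le_iff₀ (Real.exp_pos c), add_mul,
      inv_mul_cancel₀ (Real.exp_pos c).ne']
    linarith
  have h5 : Real.exp (-c) ≤ Real.exp (-a) := Real.exp_le_exp.mpr (by linarith [le_max_left a (Real.log m)])
  linarith

lemma le_floor_exp_bounds {σ : ℝ} {m : ℕ} (hσ : 0 ≤ σ) (h : ⌊Real.exp σ⌋₊ = m) :
    Real.log m ≤ σ ∧ σ ≤ Real.log (m + 1) := by
  have h1 : 1 ≤ m := h ▸ Nat.le_floor (by simpa using Real.one_le_exp hσ)
  have h2 := Nat.lt_floor_add_one (Real.exp σ)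
  rw [h] at h2
  refine ⟨(log_le_iff_le_floor_exp h1 σ).mpr h.ge, ?_⟩
  rw [Real.le_log_iff_exp_le (by positivity)]
  exact h2.le

lemma nat_div_injOn {n k : ℕ} (hn : 4 ^ k ≤ n) :
    Set.InjOn (fun Y => n / Y) (Finset.Ioc (2 ^ k / 2) (2 ^ k) : Finset ℕ) := by
  have key : ∀ Y Y' : ℕ, 0 < Y → Y < Y' → Y' ≤ 2 ^ k → n / Y ≠ n / Y' := by
    intro Y Y' hY hYY hY' heq
    have h1 : 2 ^ k ≤ n / Y' := by
      rw [Nat.le_div_iff_mul_le (by omega)]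
      calc 2 ^ k * Y' ≤ 2 ^ k * 2 ^ k := Nat.mul_le_mul le_rfl hY'
        _ = 4 ^ k := by rw [← mul_pow]; norm_num
        _ ≤ n := hn
    have h2 : n / Y' * Y' ≤ n := Nat.div_mul_le_self n Y'
    have h3 : n < (n / Y + 1) * Y := by
      have := Nat.lt_div_mul_add (a := n) hY
      linarith [this]
    rw [heq] at h3
    set q := n / Y'
    have h4 : q * (Y + 1) ≤ q * Y' := Nat.mul_le_mul le_rfl hYY
    nlinarith
  intro Y hY Y' hY' heq
  simp only [Finset.coe_Ioc, Set.mem_Ioc] at hY hY'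
  rcases lt_trichotomy Y Y' with h | h | h
  · exact absurd heq (key Y Y' (by omega) h hY'.2)
  · exact h
  · exact absurd heq.symm (key Y' Y (by omega) h hY.2)

set_option maxHeartbeats 2000000 in
lemma sq_pairErr_add_sub_le (i j : ℕ) {η : ℝ} (hη : 0 < η) (hη8 : η ≤ 1 / 8) :
    ∃ K : ℝ, 0 < K ∧ ∀ (k : ℕ) (σ δ : ℝ), 0 ≤ δ → δ ≤ 1 → (4 : ℝ) ^ k ≤ Real.exp σ →
      Real.exp σ ≤ 4 ^ (k + 1) →
    (pairErr i j (σ + δ) - pairErr i j σ) ^ 2 ≤ K * Real.exp (2 * η * σ) *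
      (discEnergy (i + j) k (⌊Real.exp (σ + δ)⌋₊ - ⌊Real.exp σ⌋₊) ⌊Real.exp σ⌋₊ / (2 ^ k * (4 ^ k) ^ 2)
        + 1 / (4 ^ k) ^ 2 + δ ^ 2 / 4 ^ k) := by
  obtain ⟨K, hK, h⟩ := abs_pairErr_add_sub_le i j hη hη8
  set J := i + j with hJ
  refine ⟨24 * K ^ 2 * (J + 1), by positivity, fun k σ δ hδ hδ1 hk1 hk2 => ?_⟩
  set m := ⌊Real.exp σ⌋₊ with hm
  set d := ⌊Real.exp (σ + δ)⌋₊ - m with hd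
  set D := pairErr i j (σ + δ) - pairErr i j σ with hD
  set U := discEnergy J k d m with hU
  have hU0 : 0 ≤ U := discEnergy_nonneg _ _ _ _
  have hσ : 0 ≤ σ := by
    rw [← Real.exp_le_exp, Real.exp_zero]
    exact (one_le_pow₀ (by norm_num)).trans hk1
  have hm4 : 4 ^ k ≤ m := Nat.le_floor (by push_cast; exact hk1)
  have hlog2 := Real.log_two_lt_d9
  have hlog2' := Real.log_two_gt_d9
  have hlog4 : Real.log 4 = 2 * Real.log 2 := by
    rw [show (4 : ℝ) = 2 ^ 2 by norm_num, Real.log_pow]; norm_num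
  have hσ1 : k * (2 * Real.log 2) ≤ σ := by
    have := Real.log_le_log (by positivity) hk1
    rwa [Real.log_exp, Real.log_pow, hlog4] at this
  have hσ2 : σ ≤ (k + 1) * (2 * Real.log 2) := by
    have := Real.log_le_log (Real.exp_pos _) hk2
    rw [Real.log_exp, Real.log_pow, hlog4] at this
    push_cast at this
    exact this
  set I := Finset.Ioc (2 ^ k / 2) (2 ^ k) with hI
  have hYI : ∀ Y ∈ I, 1 ≤ Y ∧ Y ≤ 2 ^ k ∧ 2 ^ k ≤ 2 * Y := by
    intro Y hY
    obtain ⟨h1, h2⟩ := Finset.mem_Ioc.mp hY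
    omega
  set F : ℕ → ℝ := fun M => ∑ l ∈ Finset.range (J + 1), discSum l M d m ^ 2 with hF
  have hF0 : ∀ M, 0 ≤ F M := fun M => Finset.sum_nonneg fun _ _ => sq_nonneg _
  have hUF : U = ∑ M ∈ Finset.range (2 ^ (k + 3) + 1), F M := by
    rw [hU, discEnergy, Finset.sum_comm]
  have hpt : ∀ Y ∈ I, D ^ 2 ≤ 3 * K ^ 2 * Real.exp (2 * η * σ) *
      (1 / (4 ^ k) ^ 2 * (2 * (J + 1) * (F Y + F (m / Y))) + 1 / (4 ^ k) ^ 2 + δ ^ 2 / 4 ^ k) := by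
    intro Y hY
    obtain ⟨hY1, hY2, hY3⟩ := hYI Y hY
    have hY0 : (0 : ℝ) < Y := by exact_mod_cast hY1
    have hl1 : Real.log Y ≤ k * Real.log 2 := by
      rw [← Real.log_pow]
      exact Real.log_le_log hY0 (by exact_mod_cast hY2)
    have hl2 : k * Real.log 2 ≤ Real.log 2 + Real.log Y := by
      rw [← Real.log_pow, ← Real.log_mul (by norm_num) hY0.ne']
      exact Real.log_le_log (by positivity) (by exact_mod_cast hY3)
    have hl0 := Real.log_natCast_nonneg Y
    have := h σ δ (Real.log Y) hσ hδ hδ1 hl0 (by nlinarith [(Nat.cast_nonneg k : (0 : ℝ) ≤ k)])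
      (by rw [abs_le]; constructor <;> linarith)
    rw [Real.exp_log hY0, Nat.floor_natCast, floor_exp_sub_log hY1] at this
    set S := ∑ l ∈ Finset.range (J + 1), (|discSum l Y d m| + |discSum l (m / Y) d m|) with hS
    have hS2 : S ^ 2 ≤ 2 * (J + 1) * (F Y + F (m / Y)) := by
      have h1 := sq_sum_le_card_mul_sum_sq (s := Finset.range (J + 1))
        (f := fun l => |discSum l Y d m| + |discSum l (m / Y) d m|)
      rw [Finset.card_range] at h1
      push_cast at h1
      refine h1.trans ?_
      rw [mul_comm (2 : ℝ), mul_assoc]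
      refine mul_le_mul_of_nonneg_left ?_ (by positivity)
      simp only [hF]
      rw [← Finset.sum_add_distrib, Finset.mul_sum]
      refine Finset.sum_le_sum fun l _ => ?_
      rw [← sq_abs (discSum l Y d m), ← sq_abs (discSum l (m / Y) d m)]
      nlinarith [sq_nonneg (|discSum l Y d m| - |discSum l (m / Y) d m|)]
    have hS0 : 0 ≤ S := Finset.sum_nonneg fun _ _ => by positivity
    set e := Real.exp (-σ) with he
    set f := Real.exp (-σ / 2) with hf
    have hf2 : f ^ 2 = e := by rw [hf, he, ← Real.exp_nat_mul]; congr 1; push_cast; ring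
    have hek : e ≤ 1 / 4 ^ k := by
      rw [he, Real.exp_neg, ← one_div]
      exact one_div_le_one_div_of_le (by positivity) hk1
    have he2 : e ^ 2 ≤ 1 / (4 ^ k) ^ 2 := by
      have := pow_le_pow_left₀ (Real.exp_pos _).le hek 2
      rwa [div_pow, one_pow] at this
    have hΦ : Real.exp (η * σ) ^ 2 = Real.exp (2 * η * σ) := by
      rw [← Real.exp_nat_mul]; congr 1; push_cast; ring
    have hb : D ^ 2 ≤ (K * Real.exp (η * σ) * (e * S + e + δ * f)) ^ 2 := by
      rw [← sq_abs D]
      exact pow_le_pow_left₀ (abs_nonneg _) this 2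
    refine hb.trans ?_
    rw [mul_pow, mul_pow, hΦ]
    have h3 : (e * S + e + δ * f) ^ 2 ≤ 3 * (e ^ 2 * S ^ 2 + e ^ 2 + δ ^ 2 * e) := by
      rw [← hf2]
      nlinarith [sq_nonneg (f ^ 2 * S - f ^ 2), sq_nonneg (f ^ 2 * S - δ * f),
        sq_nonneg (f ^ 2 - δ * f)]
    have h4 : e ^ 2 * S ^ 2 + e ^ 2 + δ ^ 2 * e ≤
        1 / (4 ^ k) ^ 2 * (2 * (J + 1) * (F Y + F (m / Y))) + 1 / (4 ^ k) ^ 2 + δ ^ 2 / 4 ^ k := by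
      rw [div_eq_mul_one_div (δ ^ 2)]
      gcongr
    calc _ ≤ K ^ 2 * Real.exp (2 * η * σ) * (3 * (1 / (4 ^ k) ^ 2 *
          (2 * (J + 1) * (F Y + F (m / Y))) + 1 / (4 ^ k) ^ 2 + δ ^ 2 / 4 ^ k)) := by
          have := h3.trans (mul_le_mul_of_nonneg_left h4 (by norm_num : (0 : ℝ) ≤ 3))
          gcongr
      _ = _ := by ring
  have hm2 : m < 4 ^ (k + 1) + 1 := by
    have : (m : ℝ) ≤ 4 ^ (k + 1) := (Nat.floor_le (Real.exp_pos σ).le).trans hk2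
    have : m ≤ 4 ^ (k + 1) := by exact_mod_cast this
    omega
  have hsum1 : ∑ Y ∈ I, F Y ≤ U := by
    rw [hUF]
    refine Finset.sum_le_sum_of_subset_of_nonneg ?_ fun _ _ _ => hF0 _
    intro Y hY
    have := (hYI Y hY).2.1
    rw [Finset.mem_range, pow_add]
    omega
  have hsum2 : ∑ Y ∈ I, F (m / Y) ≤ U := by
    rw [hUF, ← Finset.sum_image (f := F) (g := fun Y => m / Y) (nat_div_injOn hm4)]
    refine Finset.sum_le_sum_of_subset_of_nonneg ?_ fun _ _ _ => hF0 _
    intro x hx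
    obtain ⟨Y, hY, rfl⟩ := Finset.mem_image.mp hx
    obtain ⟨hY1, hY2, hY3⟩ := hYI Y hY
    rw [Finset.mem_range, Nat.lt_succ_iff]
    refine Nat.div_le_of_le_mul ?_
    calc m ≤ 4 ^ (k + 1) := by omega
      _ = 2 ^ (k + 1) * (2 * 2 ^ k) := by
        rw [show (4 : ℕ) = 2 * 2 by norm_num, mul_pow]; ring
      _ ≤ 2 ^ (k + 1) * (2 * (2 * Y)) := by gcongr
      _ = Y * 2 ^ (k + 3) := by ring
  have hcard : (2 : ℝ) ^ k ≤ 2 * (I.card : ℝ) := by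
    have : 2 ^ k ≤ 2 * I.card := by rw [hI, Nat.card_Ioc]; omega
    exact_mod_cast this
  have hN : (0 : ℝ) < I.card := by
    have : (0 : ℝ) < 2 ^ k := by positivity
    linarith
  have hsum := Finset.sum_le_sum hpt
  rw [Finset.sum_const, nsmul_eq_mul, ← Finset.mul_sum, Finset.sum_add_distrib,
    Finset.sum_add_distrib, Finset.sum_const, Finset.sum_const, nsmul_eq_mul, nsmul_eq_mul,
    ← Finset.mul_sum, ← Finset.mul_sum, Finset.sum_add_distrib] at hsum
  set Φ := Real.exp (2 * η * σ) with hΦ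
  have hfin : (I.card : ℝ) * D ^ 2 ≤ I.card * (24 * K ^ 2 * (J + 1) * Φ *
      (U / (2 ^ k * (4 ^ k) ^ 2) + 1 / (4 ^ k) ^ 2 + δ ^ 2 / 4 ^ k)) := by
    refine hsum.trans ?_
    have b1 : ∑ Y ∈ I, F Y + ∑ Y ∈ I, F (m / Y) ≤ 2 * U := by linarith
    have b2 : U ≤ 2 * I.card * (U / 2 ^ k) := by
      rw [← mul_div_assoc, le_div_iff₀ (by positivity), mul_comm]
      gcongr
    have b3 : 1 / (4 ^ k) ^ 2 * (2 * ((J : ℝ) + 1) * (∑ Y ∈ I, F Y + ∑ Y ∈ I, F (m / Y))) ≤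
        8 * (J + 1) * (I.card * (U / (2 ^ k * (4 ^ k) ^ 2))) := by
      calc _ ≤ 1 / (4 ^ k) ^ 2 * (2 * ((J : ℝ) + 1) * (2 * (2 * I.card * (U / 2 ^ k)))) := by
            gcongr
            linarith
        _ = _ := by field_simp; ring
    have hJ1 : (1 : ℝ) ≤ J + 1 := by linarith [(Nat.cast_nonneg J : (0 : ℝ) ≤ J)]
    have b4 : I.card * (1 / ((4 : ℝ) ^ k) ^ 2) ≤ 8 * ((J : ℝ) + 1) * (I.card * (1 / (4 ^ k) ^ 2)) := by
      have : 0 ≤ I.card * (1 / ((4 : ℝ) ^ k) ^ 2) := by positivity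
      nlinarith
    have b5 : I.card * (δ ^ 2 / (4 : ℝ) ^ k) ≤ 8 * ((J : ℝ) + 1) * (I.card * (δ ^ 2 / 4 ^ k)) := by
      have : 0 ≤ I.card * (δ ^ 2 / (4 : ℝ) ^ k) := by positivity
      nlinarith
    calc _ ≤ 3 * K ^ 2 * Φ * (8 * (J + 1) * (I.card * (U / (2 ^ k * (4 ^ k) ^ 2))) +
          8 * ((J : ℝ) + 1) * (I.card * (1 / (4 ^ k) ^ 2)) +
          8 * ((J : ℝ) + 1) * (I.card * (δ ^ 2 / 4 ^ k))) := by gcongr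
      _ = _ := by ring
  exact le_of_mul_le_mul_left hfin hN

lemma exp_natCast_mul_log_four (k : ℕ) : Real.exp (k * Real.log 4) = 4 ^ k := by
  rw [← Real.log_pow, Real.exp_log (by positivity)]

lemma exp_bounds_of_mem_Ioc {k : ℕ} {σ : ℝ}
    (hσ : σ ∈ Set.Ioc (k * Real.log 4) ((k + 1 : ℕ) * Real.log 4)) :
    (4 : ℝ) ^ k ≤ Real.exp σ ∧ Real.exp σ ≤ 4 ^ (k + 1) := by
  rw [← exp_natCast_mul_log_four, ← exp_natCast_mul_log_four]
  exact ⟨Real.exp_le_exp.mpr hσ.1.le, Real.exp_le_exp.mpr hσ.2⟩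

lemma exp_le_one_add_two_mul {δ : ℝ} (hδ : 0 ≤ δ) (hδ1 : δ ≤ 1) : Real.exp δ ≤ 1 + 2 * δ := by
  have := Real.abs_exp_sub_one_le (x := δ) (by rwa [abs_of_nonneg hδ])
  rw [abs_of_nonneg hδ] at this
  linarith [le_abs_self (Real.exp δ - 1)]

lemma floor_exp_add_sub_le {k : ℕ} {σ δ : ℝ} (hδ : 0 ≤ δ) (hδ1 : δ ≤ 1)
    (hk : Real.exp σ ≤ 4 ^ (k + 1)) :
    ((⌊Real.exp (σ + δ)⌋₊ - ⌊Real.exp σ⌋₊ : ℕ) : ℝ) ≤ 8 * (δ * 4 ^ k) + 1 := by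
  rw [Nat.cast_sub (Nat.floor_le_floor (Real.exp_le_exp.mpr (by linarith)))]
  have h2 := Nat.floor_le (Real.exp_pos (σ + δ)).le
  have h3 := Nat.lt_floor_add_one (Real.exp σ)
  have h4 := exp_le_one_add_two_mul hδ hδ1
  have h5 : Real.exp (σ + δ) ≤ Real.exp σ + 2 * δ * Real.exp σ := by
    rw [Real.exp_add]; nlinarith [Real.exp_pos σ]
  have h6 : 2 * δ * Real.exp σ ≤ 2 * δ * 4 ^ (k + 1) := by gcongr
  rw [pow_succ] at h6
  linarith

lemma floor_exp_le_of_le {k : ℕ} {σ δ : ℝ} (hδ1 : δ ≤ 1)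
    (hσ : σ ≤ (k + 1 : ℕ) * Real.log 4 + δ) : ⌊Real.exp σ⌋₊ ≤ 4 ^ (k + 2) := by
  have h1 : Real.exp σ ≤ 4 ^ (k + 1) * Real.exp 1 := by
    rw [← exp_natCast_mul_log_four, ← Real.exp_add]
    exact Real.exp_le_exp.mpr (by linarith)
  have h2 : Real.exp σ ≤ (4 ^ (k + 2) : ℕ) := by
    push_cast
    have := Real.exp_one_lt_d9
    have h4 : (0 : ℝ) < 4 ^ (k + 1) := by positivity
    rw [pow_succ (4 : ℝ) (k + 1)]
    nlinarith
  exact_mod_cast (Nat.floor_le (Real.exp_pos σ).le).trans h2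

lemma sum_sum_discEnergy_le (J k H : ℕ) :
    ∑ m ∈ Finset.range (4 ^ (k + 2) + 1), ∑ j ∈ Finset.range (H + 1), discEnergy J k j m ≤
      12288 * (J + 1) * (2 ^ k * 4 ^ k * ((k : ℝ) + 4) ^ (2 * J + 3)) * (H * (H + 1)) := by
  rw [Finset.sum_comm]
  have : ∀ j ∈ Finset.range (H + 1), ∑ m ∈ Finset.range (4 ^ (k + 2) + 1), discEnergy J k j m ≤
      12288 * (J + 1) * (2 ^ k * 4 ^ k * ((k : ℝ) + 4) ^ (2 * J + 3)) * H := by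
    intro j hj
    refine (sum_discEnergy_le J k j).trans ?_
    have : (j : ℝ) ≤ H := by exact_mod_cast Finset.mem_range_succ_iff.mp hj
    gcongr
  refine (Finset.sum_le_sum this).trans (le_of_eq ?_)
  rw [Finset.sum_const, Finset.card_range, nsmul_eq_mul]
  push_cast
  ring

lemma setIntegral_window_le {V : ℕ → ℝ} (hV : ∀ m, 0 ≤ V m) (k : ℕ) {d : ℝ} (hd : 0 ≤ d)
    (hd1 : d ≤ 1) :
    MeasureTheory.IntegrableOn (fun σ => V ⌊Real.exp (σ + d)⌋₊)
      (Set.Ioc (k * Real.log 4) ((k + 1 : ℕ) * Real.log 4)) ∧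
    ∫ σ in Set.Ioc (k * Real.log 4) ((k + 1 : ℕ) * Real.log 4), V ⌊Real.exp (σ + d)⌋₊ ≤
      1 / 4 ^ k * ∑ m ∈ Finset.range (4 ^ (k + 2) + 1), V m := by
  have hab : (k : ℝ) * Real.log 4 ≤ (k + 1 : ℕ) * Real.log 4 := by
    have := Real.log_nonneg (by norm_num : (1 : ℝ) ≤ 4)
    gcongr
    omega
  have ha : 0 ≤ (k : ℝ) * Real.log 4 := by
    have := Real.log_nonneg (by norm_num : (1 : ℝ) ≤ 4)
    positivity
  obtain ⟨h1, h2⟩ := setIntegral_floor_exp_le hV (S := Set.Ioc (k * Real.log 4 + d)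
    ((k + 1 : ℕ) * Real.log 4 + d)) measurableSet_Ioc (by simp)
    (M := 4 ^ (k + 2)) (fun σ hσ => floor_exp_le_of_le hd1 hσ.2) (c := 1 / 4 ^ k) (by positivity)
    (fun m => ⟨max (k * Real.log 4) (Real.log m), Real.log (m + 1), by
        refine (sub_max_log_le _ m).trans ?_
        rw [Real.exp_neg, exp_natCast_mul_log_four, one_div], fun σ hσ hm => by
        have := le_floor_exp_bounds (by linarith [hσ.1]) hm
        exact ⟨max_le (by linarith [hσ.1]) this.1, this.2⟩⟩)
  have h1' : IntervalIntegrable (fun σ => V ⌊Real.exp σ⌋₊) MeasureTheory.volume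
      (k * Real.log 4 + d) ((k + 1 : ℕ) * Real.log 4 + d) := by
    rwa [intervalIntegrable_iff_integrableOn_Ioc_of_le (by linarith)]
  constructor
  · rw [← intervalIntegrable_iff_integrableOn_Ioc_of_le hab]
    have := h1'.comp_add_right d
    simpa using this
  · rw [← intervalIntegral.integral_of_le hab,
      intervalIntegral.integral_comp_add_right (fun σ => V ⌊Real.exp σ⌋₊),
      intervalIntegral.integral_of_le (by linarith)]
    exact h2

lemma exists_majorant_discEnergy (J k : ℕ) {δ : ℝ} (hδ : 0 ≤ δ) (hδ1 : δ ≤ 1)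
    (hk : 1 ≤ δ * 4 ^ k) : ∃ g : ℝ → ℝ,
    MeasureTheory.IntegrableOn g (Set.Ioc (k * Real.log 4) ((k + 1 : ℕ) * Real.log 4)) ∧
    (∀ σ ∈ Set.Ioc (k * Real.log 4) ((k + 1 : ℕ) * Real.log 4),
      discEnergy J k (⌊Real.exp (σ + δ)⌋₊ - ⌊Real.exp σ⌋₊) ⌊Real.exp σ⌋₊ ≤ g σ) ∧
    ∫ σ in Set.Ioc (k * Real.log 4) ((k + 1 : ℕ) * Real.log 4), g σ ≤
      528 * (12288 * (J + 1) * (2 ^ k * 4 ^ k * ((k : ℝ) + 4) ^ (2 * J + 3))) * δ := by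
  set X := δ * 4 ^ k with hX
  have hX0 : 0 < X := by linarith
  set H' := ⌊11 * X⌋₊ with hH'
  set V : ℕ → ℝ := fun m => ∑ j ∈ Finset.range (H' + 1), discEnergy J k j m with hV
  have hV0 : ∀ m, 0 ≤ V m := fun m => Finset.sum_nonneg fun _ _ => discEnergy_nonneg _ _ _ _
  obtain ⟨i1, j1⟩ := setIntegral_window_le hV0 k le_rfl zero_le_one
  obtain ⟨i2, j2⟩ := setIntegral_window_le hV0 k hδ hδ1
  simp only [add_zero] at i1 j1
  refine ⟨fun σ => 2 / X * (V ⌊Real.exp σ⌋₊ + V ⌊Real.exp (σ + δ)⌋₊), (i1.add i2).const_mul _,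
    fun σ hσ => ?_, ?_⟩
  · obtain ⟨hk1, hk2⟩ := exp_bounds_of_mem_Ioc hσ
    set m := ⌊Real.exp σ⌋₊ with hm
    set n := ⌊Real.exp (σ + δ)⌋₊ with hn
    have hmn : m ≤ n := Nat.floor_le_floor (Real.exp_le_exp.mpr (by linarith))
    have hh := floor_exp_add_sub_le hδ hδ1 hk2
    rw [← hn, ← hm] at hh
    have hH : n - m + ⌈X⌉₊ ≤ H' := by
      refine Nat.le_floor ?_
      push_cast
      have := Nat.ceil_lt_add_one hX0.le
      linarith
    have := mul_discEnergy_le J k m hH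
    rw [Nat.add_sub_cancel' hmn] at this
    have h0 := discEnergy_nonneg J k (n - m) m
    have hc : X ≤ ⌈X⌉₊ := Nat.le_ceil X
    change _ ≤ 2 / X * (V m + V n)
    rw [div_mul_eq_mul_div, le_div_iff₀ hX0]
    have : X * discEnergy J k (n - m) m ≤ ⌈X⌉₊ * discEnergy J k (n - m) m := by gcongr
    simp only [hV]
    linarith
  · rw [MeasureTheory.integral_const_mul, MeasureTheory.integral_add i1 i2]
    have hS := sum_sum_discEnergy_le J k H'
    set C := 12288 * ((J : ℝ) + 1) * (2 ^ k * 4 ^ k * ((k : ℝ) + 4) ^ (2 * J + 3)) with hC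
    have hC0 : 0 ≤ C := by positivity
    have hf : (H' : ℝ) ≤ 11 * X := Nat.floor_le (by positivity)
    have hHH : (H' : ℝ) * (H' + 1) ≤ 132 * X ^ 2 := by
      have : (H' : ℝ) * (H' + 1) ≤ (11 * X) * (12 * X) := by
        gcongr; linarith
      linarith
    have hS' := hS.trans (mul_le_mul_of_nonneg_left hHH hC0)
    have h4 : (0 : ℝ) < 4 ^ k := by positivity
    calc _ ≤ 2 / X * (1 / 4 ^ k * (C * (132 * X ^ 2)) + 1 / 4 ^ k * (C * (132 * X ^ 2))) := by
          have q1 := j1.trans (mul_le_mul_of_nonneg_left hS' (by positivity))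
          have q2 := j2.trans (mul_le_mul_of_nonneg_left hS' (by positivity))
          gcongr
      _ = 528 * C * (X / 4 ^ k) := by field_simp; ring
      _ = _ := by rw [hX, mul_div_assoc, div_self h4.ne', mul_one]

lemma pairErr_add_sub_eq_of_floor_eq (i j : ℕ) {σ δ : ℝ} (hσ : 0 ≤ σ) (hδ : 0 ≤ δ)
    (h : ⌊Real.exp (σ + δ)⌋₊ = ⌊Real.exp σ⌋₊) : pairErr i j (σ + δ) - pairErr i j σ =
      -((pairMain i j).eval (σ + δ) - (pairMain i j).eval σ) := by
  rw [pairErr, pairErr, if_pos hσ, if_pos (by linarith)]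
  unfold expSum
  rw [h]
  ring

lemma setIntegral_sq_pairErr_window_large (i j : ℕ) {η : ℝ} (hη : 0 < η) (hη8 : η ≤ 1 / 8) :
    ∃ K : ℝ, 0 < K ∧ ∀ (k : ℕ) (δ : ℝ), 0 < δ → δ ≤ 1 → 1 ≤ δ * 4 ^ k →
      ∫ σ in Set.Ioc (k * Real.log 4) ((k + 1 : ℕ) * Real.log 4),
        (pairErr i j (σ + δ) - pairErr i j σ) ^ 2 ≤
      K * Real.exp (2 * η * (k * Real.log 4)) * ((k : ℝ) + 4) ^ (2 * (i + j) + 3) * δ / 4 ^ k := by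
  obtain ⟨K, hK, h⟩ := sq_pairErr_add_sub_le i j hη hη8
  set J := i + j with hJ
  set Λ := Real.exp (2 * η * Real.log 4) with hΛ
  refine ⟨K * Λ * (528 * (12288 * (J + 1)) + 2 * Real.log 4), by positivity, fun k δ hδ hδ1 hk => ?_⟩
  obtain ⟨g, hg, hgU, hgI⟩ := exists_majorant_discEnergy J k hδ.le hδ1 hk
  set S := Set.Ioc (k * Real.log 4) ((k + 1 : ℕ) * Real.log 4) with hS
  have hl4 : 0 < Real.log 4 := Real.log_pos (by norm_num)
  have h4 : (0 : ℝ) < 4 ^ k := by positivity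
  set Φ := Real.exp (2 * η * (k * Real.log 4)) with hΦ
  set c := 1 / ((4 : ℝ) ^ k) ^ 2 + δ ^ 2 / 4 ^ k with hc
  have hc0 : 0 ≤ c := by positivity
  set P := ((k : ℝ) + 4) ^ (2 * J + 3) with hP
  have hP1 : 1 ≤ P := one_le_pow₀ (by linarith [(Nat.cast_nonneg k : (0 : ℝ) ≤ k)])
  have hfin : MeasureTheory.volume S ≠ ⊤ := by simp [hS]
  have hci : MeasureTheory.IntegrableOn (fun _ : ℝ => c) S :=
    MeasureTheory.integrableOn_const hfin
  have hle : ∀ σ ∈ S, (pairErr i j (σ + δ) - pairErr i j σ) ^ 2 ≤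
      K * (Λ * Φ) * ((2 ^ k * (4 ^ k) ^ 2)⁻¹ * g σ + c) := by
    intro σ hσ
    obtain ⟨hk1, hk2⟩ := exp_bounds_of_mem_Ioc hσ
    refine (h k σ δ hδ.le hδ1 hk1 hk2).trans ?_
    have e1 : Real.exp (2 * η * σ) ≤ Λ * Φ := by
      rw [hΛ, hΦ, ← Real.exp_add]
      apply Real.exp_le_exp.mpr
      have := hσ.2
      push_cast at this
      nlinarith
    have hU0 := discEnergy_nonneg J k (⌊Real.exp (σ + δ)⌋₊ - ⌊Real.exp σ⌋₊) ⌊Real.exp σ⌋₊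
    have hU := hgU σ hσ
    rw [div_eq_inv_mul (discEnergy _ _ _ _), add_assoc, ← hc]
    gcongr
  have hInt : MeasureTheory.IntegrableOn
      (fun σ => K * (Λ * Φ) * ((2 ^ k * (4 ^ k) ^ 2)⁻¹ * g σ + c)) S :=
    ((hg.const_mul _).add hci).const_mul _
  refine (MeasureTheory.integral_mono_of_nonneg (Filter.Eventually.of_forall fun σ => sq_nonneg _)
    hInt ((MeasureTheory.ae_restrict_iff' measurableSet_Ioc).mpr
      (Filter.Eventually.of_forall hle))).trans ?_
  rw [MeasureTheory.integral_const_mul, MeasureTheory.integral_add (hg.const_mul _) hci,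
    MeasureTheory.integral_const_mul, MeasureTheory.setIntegral_const, smul_eq_mul, hS,
    Real.volume_real_Ioc_of_le (by push_cast; nlinarith), ← hS]
  have hlen : ((k + 1 : ℕ) : ℝ) * Real.log 4 - k * Real.log 4 = Real.log 4 := by push_cast; ring
  rw [hlen]
  have hcδ : c ≤ 2 * (δ / 4 ^ k) * P := by
    have a1 : 1 / ((4 : ℝ) ^ k) ^ 2 ≤ δ / 4 ^ k := by
      rw [div_le_div_iff₀ (by positivity) h4]
      nlinarith
    have a2 : δ ^ 2 / 4 ^ k ≤ δ / 4 ^ k := by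
      gcongr; nlinarith
    have a3 : 0 ≤ 2 * (δ / 4 ^ k) := by positivity
    nlinarith
  calc _ ≤ K * (Λ * Φ) * ((2 ^ k * (4 ^ k) ^ 2)⁻¹ *
        (528 * (12288 * (J + 1) * (2 ^ k * 4 ^ k * P)) * δ) +
        Real.log 4 * (2 * (δ / 4 ^ k) * P)) := by gcongr
    _ = _ := by field_simp

set_option maxHeartbeats 2000000 in
lemma setIntegral_sq_pairErr_window_small (i j : ℕ) {η : ℝ} (hη : 0 < η) (hη8 : η ≤ 1 / 8) :
    ∃ K : ℝ, 0 < K ∧ ∀ (k : ℕ) (δ : ℝ), 0 < δ → δ ≤ 1 → δ * 4 ^ k ≤ 1 →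
      ∫ σ in Set.Ioc (k * Real.log 4) ((k + 1 : ℕ) * Real.log 4),
        (pairErr i j (σ + δ) - pairErr i j σ) ^ 2 ≤
      K * Real.exp (2 * η * (k * Real.log 4)) * ((k : ℝ) + 4) ^ (2 * (i + j) + 3) * δ / 4 ^ k := by
  obtain ⟨K, hK, h⟩ := sq_pairErr_add_sub_le i j hη hη8
  obtain ⟨K', hK', h'⟩ := (pairMain i j).abs_eval_add_sub_eval_le hη
  set J := i + j with hJ
  set Λ := Real.exp (2 * η * Real.log 4) with hΛ
  refine ⟨Λ * (K * (12288 * (J + 1) * 90 + 34) + K' ^ 2 * Real.log 4), by positivity,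
    fun k δ hδ hδ1 hk => ?_⟩
  set S := Set.Ioc (k * Real.log 4) ((k + 1 : ℕ) * Real.log 4) with hS
  have hl4 : 0 < Real.log 4 := Real.log_pos (by norm_num)
  have h4 : (0 : ℝ) < 4 ^ k := by positivity
  have h41 : (1 : ℝ) ≤ 4 ^ k := one_le_pow₀ (by norm_num)
  set Φ := Real.exp (2 * η * (k * Real.log 4)) with hΦ
  set P := ((k : ℝ) + 4) ^ (2 * J + 3) with hP
  have hP1 : 1 ≤ P := one_le_pow₀ (by linarith [(Nat.cast_nonneg k : (0 : ℝ) ≤ k)])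
  have hfin : MeasureTheory.volume S ≠ ⊤ := by simp [hS]
  set c := K' ^ 2 * (Λ * Φ) * (δ / 4 ^ k) with hc
  have hc0 : 0 ≤ c := by positivity
  have hci : MeasureTheory.IntegrableOn (fun _ : ℝ => c) S :=
    MeasureTheory.integrableOn_const hfin
  set V : ℕ → ℝ := fun m => (2 ^ k * (4 ^ k) ^ 2)⁻¹ *
    (∑ n ∈ Finset.range (9 + 1), discEnergy J k n m) + 2 * (1 / (4 ^ k) ^ 2) with hV
  have hV0 : ∀ m, 0 ≤ V m := fun m => by
    have : 0 ≤ ∑ n ∈ Finset.range (9 + 1), discEnergy J k n m :=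
      Finset.sum_nonneg fun _ _ => discEnergy_nonneg _ _ _ _
    positivity
  have hS0 : ∀ σ ∈ S, 0 ≤ σ := fun σ hσ => le_trans (by positivity) hσ.1.le
  set E : Set ℝ := {σ | ⌊Real.exp σ⌋₊ < ⌊Real.exp (σ + δ)⌋₊} with hE
  have hEm : MeasurableSet E := measurableSet_lt
    (Nat.measurable_floor.comp Real.measurable_exp)
    (Nat.measurable_floor.comp (Real.measurable_exp.comp (measurable_id.add_const δ)))
  obtain ⟨hVi, hVI⟩ := setIntegral_floor_exp_le hV0 (S := E ∩ S) (hEm.inter measurableSet_Ioc)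
    (ne_top_of_le_ne_top hfin (MeasureTheory.measure_mono Set.inter_subset_right))
    (M := 4 ^ (k + 2)) (fun σ hσ => floor_exp_le_of_le zero_le_one (by simpa using hσ.2.2))
    (c := δ) hδ.le (fun m => ⟨Real.log (m + 1) - δ, Real.log (m + 1), by linarith, fun σ hσ hm => by
      refine ⟨?_, (le_floor_exp_bounds (hS0 σ hσ.2) hm).2⟩
      have h1 : m + 1 ≤ ⌊Real.exp (σ + δ)⌋₊ := by rw [← hm]; exact hσ.1
      have := (log_le_iff_le_floor_exp (Nat.succ_pos m) (σ + δ)).mpr h1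
      push_cast at this
      linarith⟩)
  have hle : ∀ σ ∈ S, (pairErr i j (σ + δ) - pairErr i j σ) ^ 2 ≤
      E.indicator (fun σ => K * (Λ * Φ) * V ⌊Real.exp σ⌋₊) σ + c := by
    intro σ hσ
    obtain ⟨hk1, hk2⟩ := exp_bounds_of_mem_Ioc hσ
    have e1 : Real.exp (2 * η * σ) ≤ Λ * Φ := by
      rw [hΛ, hΦ, ← Real.exp_add]
      apply Real.exp_le_exp.mpr
      have := hσ.2
      push_cast at this
      nlinarith
    by_cases hσE : σ ∈ E
    · rw [Set.indicator_of_mem hσE]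
      refine le_add_of_le_of_nonneg ?_ hc0
      refine (h k σ δ hδ.le hδ1 hk1 hk2).trans ?_
      have hh := floor_exp_add_sub_le hδ.le hδ1 hk2
      have hh9 : ⌊Real.exp (σ + δ)⌋₊ - ⌊Real.exp σ⌋₊ ≤ 9 := by
        have : ((⌊Real.exp (σ + δ)⌋₊ - ⌊Real.exp σ⌋₊ : ℕ) : ℝ) ≤ (9 : ℕ) := by
          push_cast at hh ⊢; linarith
        exact_mod_cast this
      have hU : discEnergy J k (⌊Real.exp (σ + δ)⌋₊ - ⌊Real.exp σ⌋₊) ⌊Real.exp σ⌋₊ ≤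
          ∑ n ∈ Finset.range (9 + 1), discEnergy J k n ⌊Real.exp σ⌋₊ :=
        Finset.single_le_sum (f := fun n => discEnergy J k n ⌊Real.exp σ⌋₊)
          (fun _ _ => discEnergy_nonneg _ _ _ _) (Finset.mem_range_succ_iff.mpr hh9)
      have hU0 := discEnergy_nonneg J k (⌊Real.exp (σ + δ)⌋₊ - ⌊Real.exp σ⌋₊) ⌊Real.exp σ⌋₊
      have hδ2 : δ ^ 2 / 4 ^ k ≤ 1 / ((4 : ℝ) ^ k) ^ 2 := by
        rw [div_le_div_iff₀ h4 (by positivity)]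
        calc δ ^ 2 * (4 ^ k) ^ 2 = (δ * 4 ^ k) ^ 2 := by ring
          _ ≤ 1 := pow_le_one₀ (by positivity) hk
          _ ≤ 1 * 4 ^ k := by linarith
      have : discEnergy J k (⌊Real.exp (σ + δ)⌋₊ - ⌊Real.exp σ⌋₊) ⌊Real.exp σ⌋₊ /
          (2 ^ k * (4 ^ k) ^ 2) + 1 / (4 ^ k) ^ 2 + δ ^ 2 / 4 ^ k ≤ V ⌊Real.exp σ⌋₊ := by
        rw [div_eq_inv_mul (discEnergy _ _ _ _)]
        have : (2 ^ k * (4 ^ k) ^ 2 : ℝ)⁻¹ *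
            discEnergy J k (⌊Real.exp (σ + δ)⌋₊ - ⌊Real.exp σ⌋₊) ⌊Real.exp σ⌋₊ ≤
            (2 ^ k * (4 ^ k) ^ 2 : ℝ)⁻¹ *
            ∑ n ∈ Finset.range (9 + 1), discEnergy J k n ⌊Real.exp σ⌋₊ := by gcongr
        simp only [hV]
        linarith
      rw [mul_assoc K, mul_assoc K]
      gcongr
    · rw [Set.indicator_of_notMem hσE, zero_add]
      have hfl : ⌊Real.exp (σ + δ)⌋₊ = ⌊Real.exp σ⌋₊ :=
        le_antisymm (not_lt.mp hσE) (Nat.floor_le_floor (Real.exp_le_exp.mpr (by linarith)))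
      rw [pairErr_add_sub_eq_of_floor_eq i j (hS0 σ hσ) hδ.le hfl, neg_sq, ← sq_abs]
      have := h' σ δ hδ.le hδ1
      rw [abs_of_nonneg (hS0 σ hσ)] at this
      calc _ ≤ (K' * δ * Real.exp (η * σ)) ^ 2 := pow_le_pow_left₀ (abs_nonneg _) this 2
        _ = K' ^ 2 * Real.exp (2 * η * σ) * (δ * δ) := by
          have : Real.exp (2 * η * σ) = Real.exp (η * σ) ^ 2 := by
            rw [← Real.exp_nat_mul]; congr 1; push_cast; ring
          rw [this]; ring
        _ ≤ K' ^ 2 * (Λ * Φ) * (δ / 4 ^ k) := by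
          have : δ * δ ≤ δ / 4 ^ k := by
            rw [le_div_iff₀ h4]; nlinarith
          gcongr
  have hi1 : MeasureTheory.IntegrableOn
      (E.indicator (fun σ => K * (Λ * Φ) * V ⌊Real.exp σ⌋₊)) S := by
    rw [MeasureTheory.IntegrableOn, MeasureTheory.integrable_indicator_iff hEm,
      MeasureTheory.IntegrableOn, MeasureTheory.Measure.restrict_restrict hEm]
    exact hVi.const_mul _
  refine (MeasureTheory.integral_mono_of_nonneg (Filter.Eventually.of_forall fun σ => sq_nonneg _)
    (hi1.add hci) ((MeasureTheory.ae_restrict_iff' measurableSet_Ioc).mpr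
      (Filter.Eventually.of_forall hle))).trans ?_
  simp only [Pi.add_apply]
  rw [MeasureTheory.integral_add hi1 hci,
    MeasureTheory.setIntegral_const, smul_eq_mul, hS,
    Real.volume_real_Ioc_of_le (by push_cast; nlinarith), ← hS,
    MeasureTheory.integral_indicator hEm, MeasureTheory.Measure.restrict_restrict hEm,
    MeasureTheory.integral_const_mul]
  have hlen : ((k + 1 : ℕ) : ℝ) * Real.log 4 - k * Real.log 4 = Real.log 4 := by push_cast; ring
  rw [hlen]
  have hVsum : ∑ m ∈ Finset.range (4 ^ (k + 2) + 1), V m ≤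
      (12288 * (J + 1) * 90 + 34) * P / 4 ^ k := by
    simp only [hV]
    rw [Finset.sum_add_distrib, ← Finset.mul_sum, Finset.sum_const, Finset.card_range, nsmul_eq_mul]
    have a1 := sum_sum_discEnergy_le J k 9
    rw [← hP] at a1
    have a2 : ((4 ^ (k + 2) + 1 : ℕ) : ℝ) ≤ 17 * 4 ^ k := by
      push_cast; rw [pow_add]; linarith
    calc _ ≤ (2 ^ k * (4 ^ k) ^ 2 : ℝ)⁻¹ * (12288 * (J + 1) * (2 ^ k * 4 ^ k * P) *
          ((9 : ℕ) * ((9 : ℕ) + 1))) + (17 * 4 ^ k) * (2 * (1 / (4 ^ k) ^ 2)) := by gcongr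
      _ = (12288 * (J + 1) * 90 * P + 34) / 4 ^ k := by field_simp; push_cast; ring
      _ ≤ _ := by gcongr; linarith
  calc _ ≤ K * (Λ * Φ) * (δ * ((12288 * (J + 1) * 90 + 34) * P / 4 ^ k)) +
        Real.log 4 * (K' ^ 2 * (Λ * Φ) * (δ * P / 4 ^ k)) := by
        have q1 := hVI.trans (mul_le_mul_of_nonneg_left hVsum hδ.le)
        have q2 : c ≤ K' ^ 2 * (Λ * Φ) * (δ * P / 4 ^ k) := by
          rw [hc]; gcongr; nlinarith
        gcongr
    _ = _ := by field_simp

lemma setIntegral_sq_pairErr_window (i j : ℕ) {η : ℝ} (hη : 0 < η) (hη8 : η ≤ 1 / 8) :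
    ∃ K : ℝ, 0 < K ∧ ∀ (k : ℕ) (δ : ℝ), 0 < δ → δ ≤ 1 →
      ∫ σ in Set.Ioc (k * Real.log 4) ((k + 1 : ℕ) * Real.log 4),
        (pairErr i j (σ + δ) - pairErr i j σ) ^ 2 ≤
      K * Real.exp (2 * η * (k * Real.log 4)) * ((k : ℝ) + 4) ^ (2 * (i + j) + 3) * δ / 4 ^ k := by
  obtain ⟨K₁, hK₁, h₁⟩ := setIntegral_sq_pairErr_window_large i j hη hη8
  obtain ⟨K₂, hK₂, h₂⟩ := setIntegral_sq_pairErr_window_small i j hη hη8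
  refine ⟨K₁ + K₂, by positivity, fun k δ hδ hδ1 => ?_⟩
  rcases le_total 1 (δ * 4 ^ k) with hk | hk
  · refine (h₁ k δ hδ hδ1 hk).trans ?_
    gcongr; linarith
  · refine (h₂ k δ hδ hδ1 hk).trans ?_
    gcongr; linarith

lemma pairErr_of_neg (i j : ℕ) {τ : ℝ} (h : τ < 0) : pairErr i j τ = 0 := by
  simp [pairErr, not_le.mpr h]

lemma abs_pairErr_le_const (i j : ℕ) : ∃ K : ℝ, 0 < K ∧ ∀ τ, |pairErr i j τ| ≤ K := by
  obtain ⟨K, hK, h⟩ := abs_pairErr_le i j (ε := 1 / 4) (by norm_num)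
  refine ⟨K, hK, fun τ => ?_⟩
  rcases lt_or_ge τ 0 with hτ | hτ
  · rw [pairErr_of_neg i j hτ, abs_zero]; exact hK.le
  · refine (h τ hτ).trans (mul_le_of_le_one_right hK.le (Real.exp_le_one_iff.mpr (by nlinarith)))

lemma integrableOn_weighted_sq_pairErr (i j : ℕ) {ε : ℝ} (hε : 0 < ε) (hε1 : ε ≤ 1) {δ : ℝ}
    (hδ : 0 ≤ δ) :
    MeasureTheory.IntegrableOn
      (fun σ => Real.exp ((1 - ε) * σ) * (pairErr i j (σ + δ) - pairErr i j σ) ^ 2)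
      (Set.Ioi 0) := by
  obtain ⟨K, hK, h⟩ := abs_pairErr_le i j (ε := ε / 4) (by positivity)
  have hm := measurable_pairErr i j
  have hi : MeasureTheory.IntegrableOn (fun σ => (2 * K) ^ 2 * Real.exp (-(ε / 2) * σ))
      (Set.Ioi 0) := (integrableOn_exp_mul_Ioi (by linarith) 0).const_mul _
  refine hi.mono' (by fun_prop) ((MeasureTheory.ae_restrict_iff' measurableSet_Ioi).mpr
    (Filter.Eventually.of_forall fun σ hσ => ?_))
  have hσ0 : (0 : ℝ) ≤ σ := le_of_lt hσ
  have hb : |pairErr i j (σ + δ) - pairErr i j σ| ≤ 2 * K * Real.exp (-(1 / 2 - ε / 4) * σ) := by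
    have h1 := h (σ + δ) (by linarith)
    have h2 := h σ hσ0
    have h3 : Real.exp (-(1 / 2 - ε / 4) * (σ + δ)) ≤ Real.exp (-(1 / 2 - ε / 4) * σ) :=
      Real.exp_le_exp.mpr (by nlinarith)
    have h4 := mul_le_mul_of_nonneg_left h3 hK.le
    have := abs_sub (pairErr i j (σ + δ)) (pairErr i j σ)
    linarith
  rw [Real.norm_of_nonneg (by positivity), ← sq_abs]
  calc _ ≤ Real.exp ((1 - ε) * σ) * (2 * K * Real.exp (-(1 / 2 - ε / 4) * σ)) ^ 2 := by gcongr
    _ = (2 * K) ^ 2 * (Real.exp ((1 - ε) * σ) * Real.exp (2 * (-(1 / 2 - ε / 4) * σ))) := by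
      rw [two_mul (-(1 / 2 - ε / 4) * σ), Real.exp_add]; ring
    _ = _ := by rw [← Real.exp_add]; ring_nf

lemma setIntegral_weighted_sq_pairErr_le (i j : ℕ) {ε : ℝ} (hε : 0 < ε) (hε1 : ε ≤ 1) :
    ∃ K : ℝ, 0 < K ∧ ∀ δ : ℝ, 0 < δ → δ ≤ 1 →
      ∫ σ in Set.Ioi 0, Real.exp ((1 - ε) * σ) * (pairErr i j (σ + δ) - pairErr i j σ) ^ 2 ≤
        K * δ := by
  obtain ⟨K, hK, h⟩ := setIntegral_sq_pairErr_window i j (η := ε / 8) (by positivity) (by linarith)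
  set p := 2 * (i + j) + 3 with hp
  obtain ⟨C, hC, hC'⟩ := one_add_pow_le_const_mul_exp p (η := ε / 4) (by positivity)
  set l := Real.log 4 with hl
  have hl1 : 1 ≤ l := by
    rw [hl, Real.le_log_iff_exp_le (by norm_num)]
    linarith [Real.exp_one_lt_d9]
  set q := Real.exp (-(ε / 2) * l) with hq
  have hq1 : q < 1 := Real.exp_lt_one_iff.mpr (by nlinarith)
  have hq0 : 0 < q := Real.exp_pos _
  have hsum : Summable fun k : ℕ => q ^ k := summable_geometric_of_lt_one hq0.le hq1
  set A := 4 * K * C * Real.exp (3 * (ε / 4)) with hA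
  have hA0 : 0 < A := by positivity
  refine ⟨A * ∑' k : ℕ, q ^ k,
    mul_pos hA0 (hsum.tsum_pos (fun k => by positivity) 0 (by simp)),
    fun δ hδ hδ1 => ?_⟩
  set f := fun σ => Real.exp ((1 - ε) * σ) * (pairErr i j (σ + δ) - pairErr i j σ) ^ 2 with hf
  have hInt : MeasureTheory.IntegrableOn f (Set.Ioi 0) :=
    integrableOn_weighted_sq_pairErr i j hε hε1 hδ.le
  have hsub : ∀ k : ℕ, Set.Ioc (k * l) ((k + 1 : ℕ) * l) ⊆ Set.Ioi 0 := fun k σ hσ =>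
    lt_of_le_of_lt (by positivity) hσ.1
  have hle : ∀ k : ℕ, (k : ℝ) * l ≤ ((k + 1 : ℕ) : ℝ) * l := fun k => by push_cast; nlinarith
  obtain ⟨B, hB, hB'⟩ := abs_pairErr_le_const i j
  have hm := measurable_pairErr i j
  have hwin : ∀ k : ℕ, ∫ σ in (k * l)..((k + 1 : ℕ) * l), f σ ≤ A * δ * q ^ k := by
    intro k
    rw [intervalIntegral.integral_of_le (hle k)]
    have hk := h k δ hδ hδ1
    set S := Set.Ioc (k * l) ((k + 1 : ℕ) * l) with hS
    have hi2 : MeasureTheory.IntegrableOn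
        (fun σ => 4 * 4 ^ k * Real.exp (-ε * (k * l)) *
          (pairErr i j (σ + δ) - pairErr i j σ) ^ 2) S := by
      refine MeasureTheory.Measure.integrableOn_of_bounded
        (M := 4 * 4 ^ k * Real.exp (-ε * (k * l)) * (2 * B) ^ 2) (by simp [hS])
        (by fun_prop) (Filter.Eventually.of_forall fun σ => ?_)
      rw [Real.norm_of_nonneg (by positivity), ← sq_abs (_ - _)]
      have := abs_sub (pairErr i j (σ + δ)) (pairErr i j σ)
      have h1 := hB' (σ + δ)
      have h2 := hB' σ
      gcongr; linarith
    calc ∫ σ in S, f σ ≤ ∫ σ in S, 4 * 4 ^ k * Real.exp (-ε * (k * l)) *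
          (pairErr i j (σ + δ) - pairErr i j σ) ^ 2 := by
          refine MeasureTheory.setIntegral_mono_on (hInt.mono_set (hsub k)) hi2 measurableSet_Ioc
            fun σ hσ => ?_
          simp only [hf]
          gcongr
          calc Real.exp ((1 - ε) * σ) ≤ Real.exp (l + k * l + -ε * (k * l)) := by
                apply Real.exp_le_exp.mpr
                have := hσ.2
                push_cast at this
                have := hσ.1
                nlinarith
            _ = _ := by
                rw [Real.exp_add, Real.exp_add, hl, exp_natCast_mul_log_four,
                  Real.exp_log (by norm_num)]
      _ = 4 * 4 ^ k * Real.exp (-ε * (k * l)) * ∫ σ in S,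
          (pairErr i j (σ + δ) - pairErr i j σ) ^ 2 := MeasureTheory.integral_const_mul _ _
      _ ≤ 4 * 4 ^ k * Real.exp (-ε * (k * l)) *
          (K * Real.exp (2 * (ε / 8) * (k * l)) *
            (C * (Real.exp (3 * (ε / 4)) * Real.exp (ε / 4 * (k * l)))) * δ / 4 ^ k) := by
          refine mul_le_mul_of_nonneg_left (hk.trans ?_) (by positivity)
          have h1 := hC' (k + 3) (by positivity)
          rw [show (1 : ℝ) + (k + 3) = k + 4 by ring] at h1
          have h2 : Real.exp (ε / 4 * (k + 3)) ≤
              Real.exp (3 * (ε / 4)) * Real.exp (ε / 4 * (k * l)) := by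
            rw [← Real.exp_add]
            apply Real.exp_le_exp.mpr
            have : (k : ℝ) ≤ k * l := le_mul_of_one_le_right (by positivity) hl1
            nlinarith
          have h3 := h1.trans (mul_le_mul_of_nonneg_left h2 hC.le)
          gcongr
      _ = A * δ * (Real.exp (-ε * (k * l)) * Real.exp (2 * (ε / 8) * (k * l)) *
            Real.exp (ε / 4 * (k * l))) := by rw [hA]; field_simp
      _ = A * δ * q ^ k := by
          rw [← Real.exp_add, ← Real.exp_add, hq, ← Real.exp_nat_mul]
          congr 2; ring
  have hpart : ∀ n : ℕ, ∫ σ in (0 : ℝ)..(n * l), f σ ≤ (A * ∑' k : ℕ, q ^ k) * δ := by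
    intro n
    have hadj := intervalIntegral.sum_integral_adjacent_intervals (f := f)
      (μ := MeasureTheory.volume) (a := fun k : ℕ => (k : ℝ) * l) (n := n) (fun k _ => by
        rw [intervalIntegrable_iff_integrableOn_Ioc_of_le (hle k)]
        exact hInt.mono_set (hsub k))
    simp only [Nat.cast_zero, zero_mul] at hadj
    rw [← hadj]
    calc _ ≤ ∑ k ∈ Finset.range n, A * δ * q ^ k := Finset.sum_le_sum fun k _ => hwin k
      _ = A * δ * ∑ k ∈ Finset.range n, q ^ k := by rw [Finset.mul_sum]
      _ ≤ A * δ * ∑' k : ℕ, q ^ k := by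
        gcongr
        exact hsum.sum_le_tsum _ fun k _ => by positivity
      _ = _ := by ring
  refine le_of_tendsto (MeasureTheory.intervalIntegral_tendsto_integral_Ioi 0 hInt
    (tendsto_natCast_atTop_atTop.atTop_mul_const (by linarith : 0 < l)))
    (Filter.Eventually.of_forall hpart)

/-- The weighted mean square of the increments of `pairErr` is linear in the step. -/
lemma exists_integral_weighted_sq_pairErr_le (i j : ℕ) {ε : ℝ} (hε : 0 < ε) (hε1 : ε ≤ 1) :
    ∃ K : ℝ, 0 < K ∧ ∀ δ : ℝ, 0 < δ → δ ≤ 1 →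
      MeasureTheory.Integrable
        (fun σ => Real.exp ((1 - ε) * σ) * (pairErr i j (σ + δ) - pairErr i j σ) ^ 2) ∧
      ∫ σ, Real.exp ((1 - ε) * σ) * (pairErr i j (σ + δ) - pairErr i j σ) ^ 2 ≤ K * δ := by
  obtain ⟨K, hK, h⟩ := setIntegral_weighted_sq_pairErr_le i j hε hε1
  obtain ⟨B, hB, hB'⟩ := abs_pairErr_le_const i j
  have hm := measurable_pairErr i j
  refine ⟨(2 * B) ^ 2 + K, by positivity, fun δ hδ hδ1 => ?_⟩
  set f := fun σ => Real.exp ((1 - ε) * σ) * (pairErr i j (σ + δ) - pairErr i j σ) ^ 2 with hf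
  have hInt : MeasureTheory.IntegrableOn f (Set.Ioi 0) :=
    integrableOn_weighted_sq_pairErr i j hε hε1 hδ.le
  set g := (Set.Icc (-δ) 0).indicator fun _ : ℝ => (2 * B) ^ 2 with hg
  have hgi : MeasureTheory.Integrable g := by
    rw [hg, MeasureTheory.integrable_indicator_iff measurableSet_Icc]
    exact MeasureTheory.integrableOn_const (by simp)
  have hfg : ∀ σ ∈ Set.Iic (0 : ℝ), f σ ≤ g σ := by
    intro σ hσ
    have hσ0 : σ ≤ 0 := hσ
    by_cases hσδ : -δ ≤ σ
    · rw [hg, Set.indicator_of_mem (Set.mem_Icc.mpr ⟨hσδ, hσ0⟩)]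
      simp only [hf]
      rw [← sq_abs (_ - _)]
      have := abs_sub (pairErr i j (σ + δ)) (pairErr i j σ)
      have h1 := hB' (σ + δ)
      have h2 := hB' σ
      have h3 : Real.exp ((1 - ε) * σ) ≤ 1 := Real.exp_le_one_iff.mpr (by nlinarith)
      calc _ ≤ 1 * (2 * B) ^ 2 := by gcongr; linarith
        _ = _ := one_mul _
    · rw [not_le] at hσδ
      rw [hg, Set.indicator_of_notMem fun hc => absurd hc.1 (not_le.mpr hσδ)]
      simp only [hf]
      rw [pairErr_of_neg i j (by linarith), pairErr_of_neg i j (by linarith)]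
      simp
  have hf0 : ∀ σ, 0 ≤ f σ := fun σ => by positivity
  have hInt' : MeasureTheory.IntegrableOn f (Set.Iic 0) := by
    refine hgi.integrableOn.mono' (by fun_prop)
      ((MeasureTheory.ae_restrict_iff' measurableSet_Iic).mpr
        (Filter.Eventually.of_forall fun σ hσ => ?_))
    rw [Real.norm_of_nonneg (hf0 σ)]
    exact hfg σ hσ
  refine ⟨?_, ?_⟩
  · rw [← MeasureTheory.integrableOn_univ, ← Set.Iic_union_Ioi (a := (0 : ℝ))]
    exact hInt'.union hInt
  · rw [← intervalIntegral.integral_Iic_add_Ioi hInt' hInt, add_mul]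
    refine add_le_add ?_ (h δ hδ hδ1)
    calc ∫ σ in Set.Iic 0, f σ ≤ ∫ σ in Set.Iic 0, g σ :=
          MeasureTheory.setIntegral_mono_on hInt' hgi.integrableOn measurableSet_Iic hfg
      _ ≤ ∫ σ, g σ := MeasureTheory.setIntegral_le_integral hgi
          (Filter.Eventually.of_forall fun σ => Set.indicator_nonneg (fun _ _ => by positivity) _)
      _ = (2 * B) ^ 2 * δ := by
          rw [hg, MeasureTheory.integral_indicator measurableSet_Icc,
            MeasureTheory.setIntegral_const, Real.volume_real_Icc_of_le (by linarith)]
          simp [mul_comm]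

lemma integrable_pairErr_mul_pairErr (i j k l : ℕ) (x y : ℝ) :
    MeasureTheory.Integrable fun σ => pairErr i j (x - σ) * pairErr k l (σ + y) := by
  obtain ⟨B, hB, hB'⟩ := abs_pairErr_le_const i j
  obtain ⟨C, hC, hC'⟩ := abs_pairErr_le_const k l
  have hm := measurable_pairErr i j
  have hm' := measurable_pairErr k l
  have hgi : MeasureTheory.Integrable ((Set.Icc (-y) x).indicator fun _ : ℝ => B * C) := by
    rw [MeasureTheory.integrable_indicator_iff measurableSet_Icc]
    exact MeasureTheory.integrableOn_const (by simp)
  refine hgi.mono' (by fun_prop) (Filter.Eventually.of_forall fun σ => ?_)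
  rw [Real.norm_eq_abs, abs_mul]
  by_cases hσ : σ ∈ Set.Icc (-y) x
  · rw [Set.indicator_of_mem hσ]
    exact mul_le_mul (hB' _) (hC' _) (abs_nonneg _) hB.le
  · rw [Set.indicator_of_notMem hσ]
    rw [Set.mem_Icc, not_and_or, not_le, not_le] at hσ
    rcases hσ with hσ | hσ
    · rw [pairErr_of_neg k l (by linarith), abs_zero, mul_zero]
    · rw [pairErr_of_neg i j (by linarith), abs_zero, zero_mul]

/-- The additive convolution of two error terms. -/
noncomputable def convErr (i j k l : ℕ) (τ : ℝ) : ℝ := ∫ σ, pairErr i j (τ - σ) * pairErr k l σ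

lemma convErr_eq_shift (i j k l : ℕ) (τ δ : ℝ) :
    convErr i j k l τ = ∫ σ, pairErr i j (τ - δ - σ) * pairErr k l (σ + δ) := by
  rw [convErr, ← MeasureTheory.integral_add_right_eq_self _ δ]
  refine MeasureTheory.integral_congr_ae (Filter.Eventually.of_forall fun σ => ?_)
  simp only
  rw [show τ - (σ + δ) = τ - δ - σ by ring]

lemma convErr_second_difference (i j k l : ℕ) (τ δ : ℝ) :
    convErr i j k l (τ + 2 * δ) - 2 * convErr i j k l (τ + δ) + convErr i j k l τ =
      ∫ σ, (pairErr i j (τ - σ + δ) - pairErr i j (τ - σ)) *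
        (pairErr k l (σ + δ) - pairErr k l σ) := by
  have e1 := convErr_eq_shift i j k l (τ + 2 * δ) δ
  have e2 := convErr_eq_shift i j k l (τ + δ) δ
  have e3 := convErr_eq_shift i j k l (τ + δ) 0
  have e4 := convErr_eq_shift i j k l τ 0
  have i1 := integrable_pairErr_mul_pairErr i j k l (τ + 2 * δ - δ) δ
  have i2 := integrable_pairErr_mul_pairErr i j k l (τ + δ - δ) δ
  have i3 := integrable_pairErr_mul_pairErr i j k l (τ + δ - 0) 0
  have i4 := integrable_pairErr_mul_pairErr i j k l (τ - 0) 0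
  have i5 : MeasureTheory.Integrable fun σ =>
      pairErr i j (τ + 2 * δ - δ - σ) * pairErr k l (σ + δ) -
        pairErr i j (τ + δ - δ - σ) * pairErr k l (σ + δ) := i1.sub i2
  have i6 : MeasureTheory.Integrable fun σ =>
      pairErr i j (τ + 2 * δ - δ - σ) * pairErr k l (σ + δ) -
        pairErr i j (τ + δ - δ - σ) * pairErr k l (σ + δ) -
        pairErr i j (τ + δ - 0 - σ) * pairErr k l (σ + 0) := i5.sub i3
  rw [two_mul (convErr i j k l (τ + δ)), ← sub_sub]
  nth_rewrite 2 [e3]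
  rw [e1, e2, e4, ← MeasureTheory.integral_sub i1 i2, ← MeasureTheory.integral_sub i5 i3,
    ← MeasureTheory.integral_add i6 i4]
  refine MeasureTheory.integral_congr_ae (Filter.Eventually.of_forall fun σ => ?_)
  simp only [add_zero, sub_zero]
  rw [show τ + 2 * δ - δ - σ = τ - σ + δ by ring, show τ + δ - δ - σ = τ - σ by ring,
    show τ + δ - σ = τ - σ + δ by ring]
  ring

lemma abs_convErr_second_difference_le (i j k l : ℕ) {ε : ℝ} (hε : 0 < ε) (hε1 : ε ≤ 1 / 2) :
    ∃ K : ℝ, 0 < K ∧ ∀ τ δ : ℝ, 0 < δ → δ ≤ 1 →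
      |convErr i j k l (τ + 2 * δ) - 2 * convErr i j k l (τ + δ) + convErr i j k l τ| ≤
        K * δ * Real.exp (-(1 / 2 - ε) * τ) := by
  obtain ⟨K₁, hK₁, h₁⟩ := exists_integral_weighted_sq_pairErr_le i j (ε := 2 * ε) (by positivity)
    (by linarith)
  obtain ⟨K₂, hK₂, h₂⟩ := exists_integral_weighted_sq_pairErr_le k l (ε := 2 * ε) (by positivity)
    (by linarith)
  refine ⟨(K₁ + K₂) / 2, by positivity, fun τ δ hδ hδ1 => ?_⟩
  obtain ⟨i1, b1⟩ := h₁ δ hδ hδ1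
  obtain ⟨i2, b2⟩ := h₂ δ hδ hδ1
  set f := fun σ => Real.exp ((1 - 2 * ε) * σ) * (pairErr i j (σ + δ) - pairErr i j σ) ^ 2 with hf
  set g := fun σ => Real.exp ((1 - 2 * ε) * σ) * (pairErr k l (σ + δ) - pairErr k l σ) ^ 2 with hg
  have i1' : MeasureTheory.Integrable fun σ => f (τ - σ) := i1.comp_sub_left τ
  have hI : MeasureTheory.Integrable fun σ =>
      Real.exp (-(1 / 2 - ε) * τ) / 2 * (f (τ - σ) + g σ) := (i1'.add i2).const_mul _
  rw [convErr_second_difference, ← Real.norm_eq_abs]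
  refine (MeasureTheory.norm_integral_le_of_norm_le hI
    (Filter.Eventually.of_forall fun σ => ?_)).trans ?_
  · rw [Real.norm_eq_abs, abs_mul]
    set x := |pairErr i j (τ - σ + δ) - pairErr i j (τ - σ)| with hx
    set y := |pairErr k l (σ + δ) - pairErr k l σ| with hy
    simp only [hf, hg]
    rw [← sq_abs (_ - _), ← hx, ← sq_abs (_ - _), ← hy]
    have hu : Real.exp ((1 - 2 * ε) * (τ - σ)) = Real.exp ((1 / 2 - ε) * (τ - σ)) ^ 2 := by
      rw [← Real.exp_nat_mul]; congr 1; push_cast; ring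
    have hv : Real.exp ((1 - 2 * ε) * σ) = Real.exp ((1 / 2 - ε) * σ) ^ 2 := by
      rw [← Real.exp_nat_mul]; congr 1; push_cast; ring
    have hw : Real.exp (-(1 / 2 - ε) * τ) * Real.exp ((1 / 2 - ε) * (τ - σ)) *
        Real.exp ((1 / 2 - ε) * σ) = 1 := by
      rw [← Real.exp_add, ← Real.exp_add, Real.exp_eq_one_iff]; ring
    rw [hu, hv]
    set u := Real.exp ((1 / 2 - ε) * (τ - σ))
    set v := Real.exp ((1 / 2 - ε) * σ)
    set w := Real.exp (-(1 / 2 - ε) * τ) with hw'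
    have hw0 : 0 < w := Real.exp_pos _
    have : x * y = w * ((u * x) * (v * y)) := by linear_combination (-x * y) * hw
    rw [this]
    have := two_mul_le_add_sq (u * x) (v * y)
    have h3 : (u * x) * (v * y) ≤ (u ^ 2 * x ^ 2 + v ^ 2 * y ^ 2) / 2 := by nlinarith
    calc _ ≤ w * ((u ^ 2 * x ^ 2 + v ^ 2 * y ^ 2) / 2) := mul_le_mul_of_nonneg_left h3 hw0.le
      _ = _ := by ring
  · rw [MeasureTheory.integral_const_mul, MeasureTheory.integral_add i1' i2,
      MeasureTheory.integral_sub_left_eq_self f]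
    calc _ ≤ Real.exp (-(1 / 2 - ε) * τ) / 2 * (K₁ * δ + K₂ * δ) := by gcongr
      _ = _ := by ring

lemma abs_convErr_le (i j k l : ℕ) {ε : ℝ} (hε : 0 < ε) :
    ∃ K : ℝ, 0 < K ∧ ∀ τ : ℝ, 0 ≤ τ →
      |convErr i j k l τ| ≤ K * Real.exp (-(1 / 2 - ε) * τ) := by
  obtain ⟨B, hB, hB'⟩ := abs_pairErr_le i j (ε := ε / 2) (by positivity)
  obtain ⟨C, hC, hC'⟩ := abs_pairErr_le k l (ε := ε / 2) (by positivity)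
  obtain ⟨E, hE, hE'⟩ := one_add_pow_le_const_mul_exp 1 (η := ε / 2) (by positivity)
  refine ⟨B * C * E, by positivity, fun τ hτ => ?_⟩
  have hgi : MeasureTheory.Integrable ((Set.Icc 0 τ).indicator fun _ : ℝ =>
      B * C * Real.exp (-(1 / 2 - ε / 2) * τ)) := by
    rw [MeasureTheory.integrable_indicator_iff measurableSet_Icc]
    exact MeasureTheory.integrableOn_const (by simp)
  rw [convErr, ← Real.norm_eq_abs]
  refine (MeasureTheory.norm_integral_le_of_norm_le hgi
    (Filter.Eventually.of_forall fun σ => ?_)).trans ?_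
  · rw [Real.norm_eq_abs, abs_mul]
    by_cases hσ : σ ∈ Set.Icc 0 τ
    · rw [Set.indicator_of_mem hσ]
      refine (mul_le_mul (hB' _ (by linarith [hσ.2])) (hC' _ hσ.1) (abs_nonneg _)
        (by positivity)).trans (le_of_eq ?_)
      rw [mul_mul_mul_comm, ← Real.exp_add]
      congr 2; ring
    · rw [Set.indicator_of_notMem hσ]
      rw [Set.mem_Icc, not_and_or, not_le, not_le] at hσ
      rcases hσ with hσ | hσ
      · rw [pairErr_of_neg k l (by linarith), abs_zero, mul_zero]
      · rw [pairErr_of_neg i j (by linarith), abs_zero, zero_mul]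
  · rw [MeasureTheory.integral_indicator measurableSet_Icc, MeasureTheory.setIntegral_const,
      Real.volume_real_Icc_of_le hτ, sub_zero, smul_eq_mul]
    calc _ ≤ (E * Real.exp (ε / 2 * τ)) * (B * C * Real.exp (-(1 / 2 - ε / 2) * τ)) := by
          gcongr; linarith [hE' τ hτ]
      _ = B * C * E * (Real.exp (ε / 2 * τ) * Real.exp (-(1 / 2 - ε / 2) * τ)) := by ring
      _ = _ := by rw [← Real.exp_add]; congr 2; ring

/-- Telescoping over dyadic steps turns the bound for second differences into one for first
differences, with a logarithmic loss. -/
lemma abs_convErr_sub_le (i j k l : ℕ) {ε : ℝ} (hε : 0 < ε) (hε1 : ε ≤ 1 / 2) :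
    ∃ K : ℝ, 0 < K ∧ ∀ (n : ℕ) (τ : ℝ), 0 ≤ τ →
      |convErr i j k l (τ + (1 / 2) ^ n) - convErr i j k l τ| ≤
        K * (1 + n) * (1 / 2) ^ n * Real.exp (-(1 / 2 - ε) * τ) := by
  obtain ⟨K₁, hK₁, h₁⟩ := abs_convErr_second_difference_le i j k l hε hε1
  obtain ⟨K₂, hK₂, h₂⟩ := abs_convErr_le i j k l hε
  refine ⟨K₁ + 2 * K₂, by positivity, fun n τ hτ => ?_⟩
  set G := convErr i j k l
  set w := Real.exp (-(1 / 2 - ε) * τ)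
  have hw : 0 < w := Real.exp_pos _
  induction n with
  | zero =>
    have h3 := h₂ τ hτ
    have h4 := h₂ (τ + 1) (by linarith)
    have h5 : Real.exp (-(1 / 2 - ε) * (τ + 1)) ≤ w := Real.exp_le_exp.mpr (by nlinarith)
    have h6 := mul_le_mul_of_nonneg_left h5 hK₂.le
    have := abs_sub (G (τ + 1)) (G τ)
    simp only [pow_zero, Nat.cast_zero]
    have : 0 < K₁ * w := by positivity
    linarith
  | succ n ih =>
    set δ : ℝ := (1 / 2) ^ (n + 1) with hδ
    have hδ0 : 0 < δ := by positivity
    have hδ1 : δ ≤ 1 := pow_le_one₀ (by norm_num) (by norm_num)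
    have h2 : (1 / 2 : ℝ) ^ n = 2 * δ := by rw [hδ, pow_succ]; ring
    rw [h2] at ih
    have h3 := h₁ τ δ hδ0 hδ1
    have h4 : 2 * (G (τ + δ) - G τ) =
        (G (τ + 2 * δ) - G τ) - (G (τ + 2 * δ) - 2 * G (τ + δ) + G τ) := by ring
    have h5 : 2 * |G (τ + δ) - G τ| ≤ (K₁ + 2 * K₂) * (1 + n) * (2 * δ) * w + K₁ * δ * w := by
      rw [← abs_two (α := ℝ), ← abs_mul, h4, abs_two]
      exact (abs_sub _ _).trans (add_le_add ih h3)
    push_cast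
    have : 0 < K₁ * δ * w := by positivity
    have : 0 < K₂ * δ * w := by positivity
    nlinarith

lemma integral_expSum_dirConv (F : ℕ → ℝ) {G : ℕ → ℝ} (hG : ∀ n, 0 ≤ G n) {τ : ℝ} (hτ : 0 ≤ τ) :
    ∫ σ in (0 : ℝ)..τ, expSum (dirConv F G) σ = ∫ σ in (0 : ℝ)..τ, expSum F σ * expSum G (τ - σ) := by
  have hmono := expSum_mono hG
  have hanti : Antitone fun σ => expSum G (τ - σ) := fun a b hab => hmono (by linarith)
  rw [integral_expSum_mul F hanti.intervalIntegrable hτ]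
  have h1 := integral_expSum_mul (dirConv F G) (φ := fun _ => 1) (y := τ)
    intervalIntegrable_const hτ
  simp only [mul_one, intervalIntegral.integral_const, smul_eq_mul] at h1
  rw [h1]
  unfold dirConv
  have h2 : ∀ n ∈ Finset.Icc 1 ⌊Real.exp τ⌋₊,
      (∑ x ∈ n.divisorsAntidiagonal, F x.1 * G x.2) * (τ - Real.log n) =
        ∑ x ∈ n.divisorsAntidiagonal, F x.1 * G x.2 * (τ - Real.log x.1 - Real.log x.2) := by
    intro n hn
    rw [Finset.sum_mul]
    refine Finset.sum_congr rfl fun x hx => ?_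
    rw [Nat.mem_divisorsAntidiagonal] at hx
    have h1 : (x.1 : ℝ) ≠ 0 := by
      rintro h; rw [Nat.cast_eq_zero] at h; rw [h, zero_mul] at hx; exact hx.2 hx.1.symm
    have h2 : (x.2 : ℝ) ≠ 0 := by
      rintro h; rw [Nat.cast_eq_zero] at h; rw [h, mul_zero] at hx; exact hx.2 hx.1.symm
    rw [← hx.1, Nat.cast_mul, Real.log_mul h1 h2]
    ring
  rw [Finset.sum_congr rfl h2, sum_Icc_divisorsAntidiagonal
    (fun x => F x.1 * G x.2 * (τ - Real.log x.1 - Real.log x.2))]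
  refine Finset.sum_congr rfl fun a ha => ?_
  have ha' := Finset.mem_Icc.mp ha
  have hla : Real.log a ≤ τ := (log_le_iff_le_floor_exp ha'.1 τ).mpr ha'.2
  rw [intervalIntegral.integral_comp_sub_left (fun σ => expSum G σ) τ, sub_self]
  have h3 := integral_expSum_mul G (φ := fun _ => 1) (y := τ - Real.log a)
    intervalIntegrable_const (by linarith)
  simp only [mul_one, intervalIntegral.integral_const, smul_eq_mul] at h3
  rw [h3, floor_exp_sub_log ha'.1, Finset.mul_sum]
  refine Finset.sum_congr rfl fun b _ => ?_
  ring

lemma exists_poly_integral_mul (p q : Polynomial ℝ) {m n : ℕ} (hp : p.natDegree ≤ m)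
    (hq : q.natDegree ≤ n) : ∃ P : Polynomial ℝ, P.natDegree ≤ m + n + 1 ∧
      P.coeff (m + n + 1) =
        p.coeff m * q.coeff n * (Nat.factorial m * Nat.factorial n / Nat.factorial (m + n + 1)) ∧
      ∀ T : ℝ, ∫ σ in (0 : ℝ)..T, p.eval σ * q.eval (T - σ) = P.eval T := by
  refine ⟨∑ a ∈ Finset.range (m + 1), ∑ b ∈ Finset.range (n + 1),
    Polynomial.C (p.coeff a * q.coeff b *
      (Nat.factorial a * Nat.factorial b / Nat.factorial (a + b + 1) : ℝ)) *
      Polynomial.X ^ (a + b + 1), ?_, ?_, fun T => ?_⟩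
  · refine Polynomial.natDegree_sum_le_of_forall_le _ _ fun a ha =>
      Polynomial.natDegree_sum_le_of_forall_le _ _ fun b hb => ?_
    rw [Finset.mem_range] at ha hb
    exact (Polynomial.natDegree_C_mul_X_pow_le _ _).trans (by omega)
  · simp only [Polynomial.finsetSum_coeff, Polynomial.coeff_C_mul_X_pow]
    rw [Finset.sum_eq_single m, Finset.sum_eq_single n]
    · simp
    · intro b hb hbn
      rw [Finset.mem_range] at hb
      rw [if_neg (by omega)]
    · intro h; exact absurd (Finset.self_mem_range_succ n) h
    · intro a ha ham
      refine Finset.sum_eq_zero fun b hb => ?_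
      rw [Finset.mem_range] at ha hb
      rw [if_neg (by omega)]
    · intro h; exact absurd (Finset.self_mem_range_succ m) h
  · have hexp : ∀ σ, p.eval σ * q.eval (T - σ) = ∑ a ∈ Finset.range (m + 1),
        ∑ b ∈ Finset.range (n + 1), p.coeff a * q.coeff b * (σ ^ a * (T - σ) ^ b) := by
      intro σ
      rw [Polynomial.eval_eq_sum_range' (Nat.lt_succ_of_le hp),
        Polynomial.eval_eq_sum_range' (Nat.lt_succ_of_le hq), Finset.sum_mul_sum]
      exact Finset.sum_congr rfl fun a _ => Finset.sum_congr rfl fun b _ => by ring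
    simp only [hexp]
    rw [intervalIntegral.integral_finsetSum fun a _ =>
      Continuous.intervalIntegrable (by fun_prop) _ _, Polynomial.eval_finsetSum]
    refine Finset.sum_congr rfl fun a _ => ?_
    rw [intervalIntegral.integral_finsetSum fun b _ =>
      Continuous.intervalIntegrable (by fun_prop) _ _, Polynomial.eval_finsetSum]
    refine Finset.sum_congr rfl fun b _ => ?_
    rw [intervalIntegral.integral_const_mul, integral_pow_mul_sub_pow]
    simp only [Polynomial.eval_mul, Polynomial.eval_C, Polynomial.eval_pow, Polynomial.eval_X]
    ring

lemma Polynomial.exists_taylor_bound (p : Polynomial ℝ) {η : ℝ} (hη : 0 < η) :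
    ∃ K : ℝ, 0 < K ∧ ∀ x δ : ℝ, 0 ≤ x → 0 < δ → δ ≤ 1 →
      |p.eval (x + δ) - p.eval x - δ * p.derivative.eval x| ≤
        K * δ ^ 2 * Real.exp (η * (x + δ)) ∧
      |p.eval (x + δ) - p.eval x - δ * p.derivative.eval (x + δ)| ≤
        K * δ ^ 2 * Real.exp (η * (x + δ)) := by
  obtain ⟨K, hK, h⟩ := p.derivative.abs_eval_add_sub_eval_le hη
  refine ⟨K, hK, fun x δ hx hδ hδ1 => ?_⟩
  obtain ⟨ξ, hξ, hξ'⟩ := exists_deriv_eq_slope (fun y => p.eval y) (a := x) (b := x + δ)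
    (by linarith) (by fun_prop) (by fun_prop)
  rw [Polynomial.deriv, add_sub_cancel_left, eq_div_iff hδ.ne'] at hξ'
  have hξ1 := hξ.1
  have hξ2 := hξ.2
  have e : ∀ y, p.eval (x + δ) - p.eval x - δ * p.derivative.eval y =
      δ * (p.derivative.eval ξ - p.derivative.eval y) := fun y => by rw [← hξ']; ring
  rw [e, e, abs_mul, abs_mul, abs_of_pos hδ]
  constructor
  · have h1 := h x (ξ - x) (by linarith) (by linarith)
    rw [add_sub_cancel, abs_of_nonneg hx] at h1
    calc _ ≤ δ * (K * δ * Real.exp (η * (x + δ))) := by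
          gcongr
          refine h1.trans ?_
          gcongr
          · linarith
          · linarith
      _ = _ := by ring
  · have h1 := h ξ (x + δ - ξ) (by linarith) (by linarith)
    rw [add_sub_cancel, abs_of_nonneg (by linarith : 0 ≤ ξ), abs_sub_comm] at h1
    calc _ ≤ δ * (K * δ * Real.exp (η * (x + δ))) := by
          gcongr
          refine h1.trans ?_
          gcongr
          linarith
      _ = _ := by ring

lemma half_pow_ceil_le (τ : ℝ) : (1 / 2 : ℝ) ^ ⌈τ⌉₊ ≤ Real.exp (-(1 / 2) * τ) := by
  have h := Nat.le_ceil τ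
  have h2 : (1 / 2 : ℝ) ≤ Real.exp (-(1 / 2)) := by
    have := Real.add_one_le_exp (-(1 / 2) : ℝ)
    linarith
  calc (1 / 2 : ℝ) ^ ⌈τ⌉₊ ≤ Real.exp (-(1 / 2)) ^ ⌈τ⌉₊ := by gcongr
    _ = Real.exp (⌈τ⌉₊ * (-(1 / 2))) := by rw [← Real.exp_nat_mul]
    _ ≤ _ := Real.exp_le_exp.mpr (by linarith)

/-- A Tauberian step: a monotone function whose primitive is close to a polynomial on dyadic scales
is close to the derivative of that polynomial. -/
lemma abs_sub_eval_derivative_le {D : ℝ → ℝ} (hD : Monotone D) (hD0 : ∀ τ, 0 ≤ D τ)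
    (P : Polynomial ℝ) {ε K : ℝ} (hε : 0 < ε) (hε1 : ε ≤ 1 / 4)
    (h : ∀ (n : ℕ) (τ : ℝ), 0 ≤ τ →
      |(∫ σ in τ..(τ + (1 / 2) ^ n), D σ) - (P.eval (τ + (1 / 2) ^ n) - P.eval τ)| ≤
        K * (1 + n) * (1 / 2) ^ n * Real.exp (-(1 / 2 - ε) * τ)) :
    ∃ K' : ℝ, 0 < K' ∧ ∀ τ : ℝ, 0 ≤ τ →
      |D τ - P.derivative.eval τ| ≤ K' * Real.exp (-(1 / 2 - 2 * ε) * τ) := by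
  obtain ⟨A, hA, hA'⟩ := P.exists_taylor_bound hε
  obtain ⟨C, hC, hC'⟩ := P.derivative.abs_eval_le_const_mul_exp hε
  obtain ⟨E, hE, hE'⟩ := one_add_pow_le_const_mul_exp 1 hε
  have hK : 0 ≤ K := by
    have := (abs_nonneg _).trans (h 0 0 le_rfl)
    simpa using this
  refine ⟨A * Real.exp ε + K * (2 * E) * Real.exp (1 / 2) + C * Real.exp 1, by positivity,
    fun τ hτ => ?_⟩
  set w := Real.exp (-(1 / 2 - 2 * ε) * τ) with hw
  have hw0 : 0 < w := Real.exp_pos _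
  set n := ⌈τ⌉₊ with hn
  set δ : ℝ := (1 / 2) ^ n with hδ
  have hδ0 : 0 < δ := by positivity
  have hδ1 : δ ≤ 1 := pow_le_one₀ (by norm_num) (by norm_num)
  have hδw : δ ≤ Real.exp (-(1 / 2) * τ) := half_pow_ceil_le τ
  have hn1 : 1 + (n : ℝ) ≤ 2 * E * Real.exp (ε * τ) := by
    have := Nat.ceil_lt_add_one hτ
    have := hE' τ hτ
    rw [← hn] at *
    linarith
  have hInt : ∀ a b, IntervalIntegrable D MeasureTheory.volume a b := fun a b =>
    hD.intervalIntegrable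
  have hmain : ∀ s : ℝ, s ≤ δ → A * δ * Real.exp (ε * (τ + s)) ≤ A * Real.exp ε * w := by
    intro s hs
    calc A * δ * Real.exp (ε * (τ + s)) ≤
          A * Real.exp (-(1 / 2) * τ) * (Real.exp ε * Real.exp (ε * τ)) := by
          gcongr
          rw [← Real.exp_add]
          exact Real.exp_le_exp.mpr (by nlinarith)
      _ = A * Real.exp ε * (Real.exp (-(1 / 2) * τ) * Real.exp (ε * τ)) := by ring
      _ ≤ _ := by
          gcongr
          rw [← Real.exp_add]
          exact Real.exp_le_exp.mpr (by nlinarith)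
  have herr : ∀ s : ℝ, -1 ≤ s → K * (1 + n) * Real.exp (-(1 / 2 - ε) * (τ + s)) ≤
      K * (2 * E) * Real.exp (1 / 2) * w := by
    intro s hs
    calc K * (1 + n) * Real.exp (-(1 / 2 - ε) * (τ + s)) ≤
          K * (2 * E * Real.exp (ε * τ)) *
            (Real.exp (1 / 2) * Real.exp (-(1 / 2 - ε) * τ)) := by
          gcongr
          rw [← Real.exp_add]
          exact Real.exp_le_exp.mpr (by nlinarith)
      _ = K * (2 * E) * Real.exp (1 / 2) *
            (Real.exp (ε * τ) * Real.exp (-(1 / 2 - ε) * τ)) := by ring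
      _ = _ := by rw [← Real.exp_add, hw]; congr 2; ring
  have hCw : 0 < C * Real.exp 1 * w := by positivity
  have hAw : 0 < A * Real.exp ε * w := by positivity
  have hKw : 0 ≤ K * (2 * E) * Real.exp (1 / 2) * w := by positivity
  rw [abs_le]
  constructor
  · rcases lt_or_ge τ 1 with hτ1 | hτ1
    · have h1 := hC' τ
      rw [abs_of_nonneg hτ] at h1
      have h2 : C * Real.exp (ε * τ) ≤ C * Real.exp 1 * w := by
        rw [mul_assoc, hw, ← Real.exp_add]
        gcongr
        nlinarith
      have := (le_abs_self _).trans h1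
      have := hD0 τ
      linarith
    · have h1 := (abs_le.mp (h n (τ - δ) (by linarith))).1
      have h2 := (abs_le.mp (hA' (τ - δ) δ (by linarith) hδ0 hδ1).2).1
      rw [← hδ, sub_add_cancel] at h1
      rw [sub_add_cancel] at h2
      have h3 : ∫ σ in (τ - δ)..τ, D σ ≤ δ * D τ := by
        calc _ ≤ ∫ σ in (τ - δ)..τ, D τ := intervalIntegral.integral_mono_on (by linarith)
              (hInt _ _) intervalIntegrable_const fun σ hσ => hD hσ.2
          _ = _ := by simp
      have h4 := hmain 0 hδ0.le
      have h5 := herr (-δ) (by linarith)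
      rw [add_zero] at h4
      rw [← sub_eq_add_neg] at h5
      have h6 : δ * (D τ - P.derivative.eval τ) ≥
          -(δ * (A * δ * Real.exp (ε * τ) +
            K * (1 + n) * Real.exp (-(1 / 2 - ε) * (τ - δ)))) := by linarith
      have h7 := le_of_mul_le_mul_left (by linarith : δ *
        (-(A * δ * Real.exp (ε * τ) + K * (1 + n) * Real.exp (-(1 / 2 - ε) * (τ - δ)))) ≤
        δ * (D τ - P.derivative.eval τ)) hδ0
      linarith
  · have h1 := (abs_le.mp (h n τ hτ)).2
    have h2 := (abs_le.mp (hA' τ δ hτ hδ0 hδ1).1).2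
    rw [← hδ] at h1
    have h3 : δ * D τ ≤ ∫ σ in τ..(τ + δ), D σ := by
      calc δ * D τ = ∫ σ in τ..(τ + δ), D τ := by simp
        _ ≤ _ := intervalIntegral.integral_mono_on (by linarith)
            intervalIntegrable_const (hInt _ _) fun σ hσ => hD hσ.1
    have h4 := hmain δ le_rfl
    have h5 := herr 0 (by norm_num)
    rw [add_zero] at h5
    have h7 := le_of_mul_le_mul_left (by linarith : δ * (D τ - P.derivative.eval τ) ≤ δ *
      (A * δ * Real.exp (ε * (τ + δ)) + K * (1 + n) * Real.exp (-(1 / 2 - ε) * τ))) hδ0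
    linarith

lemma logF_conv_nonneg (i j n : ℕ) : 0 ≤ dirConv (logF i) (logF j) n :=
  Finset.sum_nonneg fun x _ => mul_nonneg (logF_nonneg i x.1) (logF_nonneg j x.2)

lemma intervalIntegrable_pairErr_sub (i j : ℕ) (τ a b : ℝ) :
    IntervalIntegrable (fun σ => pairErr i j (τ - σ)) MeasureTheory.volume a b := by
  obtain ⟨B, hB, hB'⟩ := abs_pairErr_le_const i j
  have hm := measurable_pairErr i j
  exact intervalIntegrable_const (c := B) |>.mono_fun
    (hm.comp (measurable_const.sub measurable_id)).aestronglyMeasurable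
    (Filter.Eventually.of_forall fun σ => by
      simp only [Real.norm_eq_abs]; exact (hB' _).trans (le_abs_self B))

lemma intervalIntegrable_pairErr (i j : ℕ) (a b : ℝ) :
    IntervalIntegrable (pairErr i j) MeasureTheory.volume a b := by
  obtain ⟨B, hB, hB'⟩ := abs_pairErr_le_const i j
  have hm := measurable_pairErr i j
  exact intervalIntegrable_const (c := B) |>.mono_fun (by fun_prop)
    (Filter.Eventually.of_forall fun σ => by
      simp only [Real.norm_eq_abs]; exact (hB' _).trans (le_abs_self B))

lemma convErr_eq_intervalIntegral (i j k l : ℕ) {τ : ℝ} (hτ : 0 ≤ τ) :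
    convErr i j k l τ = ∫ σ in (0 : ℝ)..τ, pairErr i j (τ - σ) * pairErr k l σ := by
  rw [intervalIntegral.integral_of_le hτ, ← MeasureTheory.integral_Icc_eq_integral_Ioc, convErr]
  refine (MeasureTheory.setIntegral_eq_integral_of_forall_compl_eq_zero fun σ hσ => ?_).symm
  rw [Set.mem_Icc, not_and_or, not_le, not_le] at hσ
  rcases hσ with hσ | hσ
  · rw [pairErr_of_neg k l (by linarith), mul_zero]
  · rw [pairErr_of_neg i j (by linarith), zero_mul]

lemma integral_expSum_mul_expSum_eq (i j k l : ℕ) {τ : ℝ} (hτ : 0 ≤ τ) :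
    ∫ σ in (0 : ℝ)..τ, expSum (dirConv (logF i) (logF j)) σ *
        expSum (dirConv (logF k) (logF l)) (τ - σ) =
      (∫ σ in (0 : ℝ)..τ, (pairMain i j).eval σ * (pairMain k l).eval (τ - σ)) +
      (∫ σ in (0 : ℝ)..τ, pairErr i j σ * (pairMain k l).eval (τ - σ)) +
      (∫ σ in (0 : ℝ)..τ, pairErr k l σ * (pairMain i j).eval (τ - σ)) +
      convErr k l i j τ := by
  rw [convErr_eq_intervalIntegral k l i j hτ]
  have e1 : ∫ σ in (0 : ℝ)..τ, pairErr k l σ * (pairMain i j).eval (τ - σ) =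
      ∫ σ in (0 : ℝ)..τ, (pairMain i j).eval σ * pairErr k l (τ - σ) := by
    have := intervalIntegral.integral_comp_sub_left
      (fun σ => pairErr k l σ * (pairMain i j).eval (τ - σ)) τ (a := 0) (b := τ)
    rw [sub_self, sub_zero] at this
    rw [← this]
    refine intervalIntegral.integral_congr fun σ _ => ?_
    simp only [sub_sub_cancel]
    ring
  rw [e1]
  have hb := intervalIntegrable_pairErr i j 0 τ
  have hd := intervalIntegrable_pairErr_sub k l τ 0 τ
  have i1 : IntervalIntegrable (fun σ => (pairMain i j).eval σ * (pairMain k l).eval (τ - σ))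
      MeasureTheory.volume 0 τ := Continuous.intervalIntegrable (by fun_prop) _ _
  have i2 : IntervalIntegrable (fun σ => pairErr i j σ * (pairMain k l).eval (τ - σ))
      MeasureTheory.volume 0 τ := hb.mul_continuousOn (by fun_prop)
  have i3 : IntervalIntegrable (fun σ => (pairMain i j).eval σ * pairErr k l (τ - σ))
      MeasureTheory.volume 0 τ := hd.continuousOn_mul (by fun_prop)
  have i4 : IntervalIntegrable (fun σ => pairErr k l (τ - σ) * pairErr i j σ)
      MeasureTheory.volume 0 τ := by
    have := integrable_pairErr_mul_pairErr k l i j τ 0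
    simp only [add_zero] at this
    exact this.intervalIntegrable
  rw [← intervalIntegral.integral_add i1 i2, ← intervalIntegral.integral_add (i1.add i2) i3,
    ← intervalIntegral.integral_add ((i1.add i2).add i3) i4]
  refine intervalIntegral.integral_congr fun σ hσ => ?_
  rw [Set.uIcc_of_le hτ] at hσ
  have f1 : expSum (dirConv (logF i) (logF j)) σ = (pairMain i j).eval σ + pairErr i j σ := by
    rw [pairErr, if_pos hσ.1]; ring
  have f2 : expSum (dirConv (logF k) (logF l)) (τ - σ) =
      (pairMain k l).eval (τ - σ) + pairErr k l (τ - σ) := by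
    rw [pairErr, if_pos (by linarith [hσ.2])]; ring
  rw [f1, f2]
  ring

lemma exists_poly_integral_pairErr (i j : ℕ) (p : Polynomial ℝ) {D : ℕ} (hp : p.natDegree ≤ D) :
    ∃ P : Polynomial ℝ, P.natDegree ≤ D ∧ ∀ τ : ℝ, 0 ≤ τ →
      ∫ σ in (0 : ℝ)..τ, pairErr i j σ * p.eval (τ - σ) =
        P.eval τ - ∫ σ in Set.Ioi τ, pairErr i j σ * p.eval (τ - σ) := by
  obtain ⟨K, hK, hB⟩ := abs_pairErr_le i j (ε := 1 / 4) (by norm_num)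
  have hm := measurable_pairErr i j
  obtain ⟨P, hP, hP'⟩ := exists_poly_integral_Ioi hm (c := 1 / 2 - 1 / 4) (by norm_num) hB p hp
  refine ⟨P, hP, fun τ hτ => ?_⟩
  have hi : ∀ {z : ℝ}, 0 ≤ z → _ := fun {z} =>
    integrableOn_decay_mul_poly hm (c := 1 / 2 - 1 / 4) (by norm_num) hB p τ (z := z)
  rw [← hP' τ, intervalIntegral.integral_of_le hτ, ← Set.Ioc_union_Ioi_eq_Ioi hτ,
    MeasureTheory.setIntegral_union Set.Ioc_disjoint_Ioi_same measurableSet_Ioi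
      ((hi le_rfl).mono_set Set.Ioc_subset_Ioi_self) (hi hτ)]
  ring

lemma abs_tail_pairErr_sub_le (i j : ℕ) (p : Polynomial ℝ) {ε : ℝ} (hε : 0 < ε) (hε1 : ε ≤ 1 / 4) :
    ∃ K : ℝ, 0 < K ∧ ∀ τ δ : ℝ, 0 ≤ τ → 0 ≤ δ → δ ≤ 1 →
      |(∫ σ in Set.Ioi (τ + δ), pairErr i j σ * p.eval (τ + δ - σ)) -
        ∫ σ in Set.Ioi τ, pairErr i j σ * p.eval (τ - σ)| ≤
        K * δ * Real.exp (-(1 / 2 - ε) * τ) := by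
  obtain ⟨K, hK, hB⟩ := abs_pairErr_le i j (ε := ε / 2) (by positivity)
  obtain ⟨K', hK', h⟩ := abs_tail_integral_sub_le (measurable_pairErr i j)
    (c := 1 / 2 - ε / 2) (by linarith) hB p (η := ε / 4) (by positivity) (by linarith)
  refine ⟨K', hK', fun τ δ hτ hδ hδ1 => ?_⟩
  refine (h τ τ (τ + δ) δ hτ hτ hδ hδ1 (by linarith) le_rfl).trans (le_of_eq ?_)
  rw [mul_assoc, ← Real.exp_add]
  congr 2; ring

lemma exists_primitive_formula (i j k l : ℕ) :
    ∃ P : Polynomial ℝ, P.natDegree ≤ i + j + k + l + 5 ∧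
      P.coeff (i + j + k + l + 5) = (Nat.factorial i * Nat.factorial j * Nat.factorial k *
        Nat.factorial l : ℝ) / Nat.factorial (i + j + k + l + 5) ∧
      ∀ τ : ℝ, 0 ≤ τ →
        ∫ σ in (0 : ℝ)..τ,
          expSum (dirConv (dirConv (logF i) (logF j)) (dirConv (logF k) (logF l))) σ =
        P.eval τ - (∫ σ in Set.Ioi τ, pairErr i j σ * (pairMain k l).eval (τ - σ)) -
          (∫ σ in Set.Ioi τ, pairErr k l σ * (pairMain i j).eval (τ - σ)) +
          convErr k l i j τ := by
  obtain ⟨P₀, hd₀, hc₀, h₀⟩ := exists_poly_integral_mul (pairMain i j) (pairMain k l)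
    (natDegree_pairMain_le i j) (natDegree_pairMain_le k l)
  obtain ⟨P₁, hd₁, h₁⟩ := exists_poly_integral_pairErr i j (pairMain k l)
    (natDegree_pairMain_le k l)
  obtain ⟨P₂, hd₂, h₂⟩ := exists_poly_integral_pairErr k l (pairMain i j)
    (natDegree_pairMain_le i j)
  have hN : i + j + 2 + (k + l + 2) + 1 = i + j + k + l + 5 := by ring
  rw [hN] at hd₀ hc₀
  refine ⟨P₀ + P₁ + P₂, ?_, ?_, fun τ hτ => ?_⟩
  · exact Polynomial.natDegree_add_le_of_degree_le
      (Polynomial.natDegree_add_le_of_degree_le hd₀ (by omega)) (by omega)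
  · rw [Polynomial.coeff_add, Polynomial.coeff_add, hc₀, coeff_pairMain, coeff_pairMain,
      Polynomial.coeff_eq_zero_of_natDegree_lt (by omega : P₁.natDegree < _),
      Polynomial.coeff_eq_zero_of_natDegree_lt (by omega : P₂.natDegree < _)]
    field_simp
    ring
  · rw [integral_expSum_dirConv _ (logF_conv_nonneg k l) hτ, integral_expSum_mul_expSum_eq i j k l hτ,
      h₀, h₁ τ hτ, h₂ τ hτ, Polynomial.eval_add, Polynomial.eval_add]
    ring

/-- The summatory function of a fourfold convolution of `logF`'s is a polynomial up to an error
of size `exp (-(1 / 2 - ε) τ)`. -/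
lemma exists_quad_formula (i j k l : ℕ) :
    ∃ P : Polynomial ℝ, P.natDegree ≤ i + j + k + l + 4 ∧
      P.coeff (i + j + k + l + 4) = (Nat.factorial i * Nat.factorial j * Nat.factorial k *
        Nat.factorial l : ℝ) / Nat.factorial (i + j + k + l + 4) ∧
      ∀ ε : ℝ, 0 < ε → ∃ K : ℝ, 0 < K ∧ ∀ τ : ℝ, 0 ≤ τ →
        |expSum (dirConv (dirConv (logF i) (logF j)) (dirConv (logF k) (logF l))) τ - P.eval τ| ≤
          K * Real.exp (-(1 / 2 - ε) * τ) := by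
  obtain ⟨P, hd, hc, h⟩ := exists_primitive_formula i j k l
  refine ⟨P.derivative, (Polynomial.natDegree_derivative_le P).trans (by omega), ?_,
    fun ε hε => ?_⟩
  · rw [Polynomial.coeff_derivative, hc, show i + j + k + l + 5 = (i + j + k + l + 4) + 1 by ring,
      Nat.factorial_succ]
    push_cast
    field_simp
  set D := expSum (dirConv (dirConv (logF i) (logF j)) (dirConv (logF k) (logF l))) with hD
  have hF : ∀ n, 0 ≤ dirConv (dirConv (logF i) (logF j)) (dirConv (logF k) (logF l)) n := fun n =>
    Finset.sum_nonneg fun x _ => mul_nonneg (logF_conv_nonneg i j _) (logF_conv_nonneg k l _)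
  have hDm : Monotone D := expSum_mono hF
  set ε' := min (ε / 2) (1 / 4) with hε'
  have hε'0 : 0 < ε' := by positivity
  have hε'1 : ε' ≤ 1 / 4 := min_le_right _ _
  have hε'2 : ε' ≤ ε / 2 := min_le_left _ _
  obtain ⟨K₁, hK₁, h₁⟩ := abs_tail_pairErr_sub_le i j (pairMain k l) hε'0 hε'1
  obtain ⟨K₂, hK₂, h₂⟩ := abs_tail_pairErr_sub_le k l (pairMain i j) hε'0 hε'1
  obtain ⟨K₃, hK₃, h₃⟩ := abs_convErr_sub_le k l i j hε'0 (by linarith)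
  obtain ⟨K, hK, hmain⟩ := abs_sub_eval_derivative_le hDm
    (fun τ => Finset.sum_nonneg fun n _ => hF n) P (K := K₁ + K₂ + K₃) hε'0 hε'1
    (fun n τ hτ => by
      set δ : ℝ := (1 / 2) ^ n with hδ
      have hδ0 : 0 < δ := by positivity
      have hδ1 : δ ≤ 1 := pow_le_one₀ (by norm_num) (by norm_num)
      set w := Real.exp (-(1 / 2 - ε') * τ)
      have hw : 0 < w := Real.exp_pos _
      have hInt : ∀ a b, IntervalIntegrable D MeasureTheory.volume a b := fun a b =>
        hDm.intervalIntegrable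
      have e := intervalIntegral.integral_interval_sub_left (hInt 0 (τ + δ)) (hInt 0 τ)
      rw [← e, h (τ + δ) (by linarith), h τ hτ]
      have q1 := abs_le.mp (h₁ τ δ hτ hδ0.le hδ1)
      have q2 := abs_le.mp (h₂ τ δ hτ hδ0.le hδ1)
      have q3 := abs_le.mp (h₃ n τ hτ)
      rw [← hδ] at q3
      have r1 : K₁ * δ * w ≤ K₁ * (1 + n) * δ * w := by
        gcongr; nlinarith [(Nat.cast_nonneg n : (0 : ℝ) ≤ n)]
      have r2 : K₂ * δ * w ≤ K₂ * (1 + n) * δ * w := by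
        gcongr; nlinarith [(Nat.cast_nonneg n : (0 : ℝ) ≤ n)]
      rw [abs_le]
      constructor <;> linarith [q1.1, q1.2, q2.1, q2.2, q3.1, q3.2])
  refine ⟨K, hK, fun τ hτ => (hmain τ hτ).trans ?_⟩
  gcongr
  linarith

lemma exists_coprime_param {a b c d : ℕ} (ha : 0 < a) (h : c * d = a * b) :
    ∃ p q r s : ℕ, 0 < p ∧ 0 < q ∧ Nat.Coprime q r ∧ a = p * q ∧ b = r * s ∧ c = p * r ∧
      d = q * s ∧ Nat.gcd a c = p := by
  obtain ⟨g, q, r, hg, hco, hqa, hrc⟩ := Nat.exists_coprime' (m := a) (n := c)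
    (Nat.gcd_pos_of_pos_left _ ha)
  have hq : 0 < q := Nat.pos_of_ne_zero (by rintro rfl; omega)
  have hrd : r * d = q * b := by
    refine Nat.eq_of_mul_eq_mul_left hg ?_
    calc g * (r * d) = c * d := by rw [hrc]; ring
      _ = a * b := h
      _ = g * (q * b) := by rw [hqa]; ring
  obtain ⟨s, rfl⟩ : q ∣ d := hco.dvd_of_dvd_mul_left ⟨b, hrd⟩
  refine ⟨g, q, r, s, hg, hq, hco, by rw [hqa, mul_comm], ?_, by rw [hrc, mul_comm], rfl, ?_⟩
  · exact Nat.eq_of_mul_eq_mul_left hq (by rw [← hrd]; ring)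
  · rw [hqa, hrc, Nat.gcd_mul_right, hco.gcd_eq_one, one_mul]

/-- The divisors `c` of `a * b` are parametrised as `c = p * r` with `a = p * q`, `b = r * s` and
`q`, `r` coprime. -/
lemma sum_divisorsAntidiagonal_mul (ψ : ℕ → ℕ → ℝ) {a b : ℕ} (ha : 0 < a) (hb : 0 < b) :
    ∑ y ∈ (a * b).divisorsAntidiagonal, ψ y.1 y.2 =
      ∑ x ∈ a.divisorsAntidiagonal, ∑ y ∈ b.divisorsAntidiagonal,
        if Nat.Coprime x.2 y.1 then ψ (x.1 * y.1) (x.2 * y.2) else 0 := by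
  rw [← Finset.sum_product', ← Finset.sum_filter]
  refine Finset.sum_bij' (fun y _ => ((Nat.gcd a y.1, a / Nat.gcd a y.1),
    (y.1 / Nat.gcd a y.1, y.2 / (a / Nat.gcd a y.1))))
    (fun z _ => (z.1.1 * z.2.1, z.1.2 * z.2.2)) ?_ ?_ ?_ ?_ ?_
  · rintro ⟨c, d⟩ h
    obtain ⟨p, q, r, s, hp, hq, hco, e1, e2, e3, e4, hg⟩ :=
      exists_coprime_param (c := c) (d := d) ha (Nat.mem_divisorsAntidiagonal.mp h).1
    simp only [Finset.mem_filter, Finset.mem_product, Nat.mem_divisorsAntidiagonal]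
    rw [hg, e1, e3, e4, Nat.mul_div_cancel_left _ hp, Nat.mul_div_cancel_left _ hp,
      Nat.mul_div_cancel_left _ hq]
    exact ⟨⟨⟨rfl, by positivity⟩, e2.symm, hb.ne'⟩, hco⟩
  · rintro ⟨⟨p, q⟩, ⟨r, s⟩⟩ h
    simp only [Finset.mem_filter, Finset.mem_product, Nat.mem_divisorsAntidiagonal] at h ⊢
    obtain ⟨⟨⟨h1, -⟩, h2, -⟩, -⟩ := h
    exact ⟨by rw [← h1, ← h2]; ring, by positivity⟩
  · rintro ⟨c, d⟩ h
    obtain ⟨p, q, r, s, hp, hq, hco, e1, e2, e3, e4, hg⟩ :=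
      exists_coprime_param (c := c) (d := d) ha (Nat.mem_divisorsAntidiagonal.mp h).1
    simp only [hg]
    rw [e1, e3, e4, Nat.mul_div_cancel_left _ hp, Nat.mul_div_cancel_left _ hp,
      Nat.mul_div_cancel_left _ hq]
  · rintro ⟨⟨p, q⟩, ⟨r, s⟩⟩ h
    simp only [Finset.mem_filter, Finset.mem_product, Nat.mem_divisorsAntidiagonal] at h
    obtain ⟨⟨⟨rfl, -⟩, rfl, -⟩, hco⟩ := h
    have hp : 0 < p := Nat.pos_of_mul_pos_right ha
    have hq : 0 < q := Nat.pos_of_mul_pos_left ha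
    have hgcd : Nat.gcd (p * q) (p * r) = p := by
      rw [Nat.gcd_mul_left, hco.gcd_eq_one, mul_one]
    simp only [hgcd, Nat.mul_div_cancel_left _ hp, Nat.mul_div_cancel_left _ hq]
  · rintro ⟨c, d⟩ h
    obtain ⟨p, q, r, s, hp, hq, hco, e1, e2, e3, e4, hg⟩ :=
      exists_coprime_param (c := c) (d := d) ha (Nat.mem_divisorsAntidiagonal.mp h).1
    simp only [hg]
    rw [e1, e3, e4, Nat.mul_div_cancel_left _ hp, Nat.mul_div_cancel_left _ hp,
      Nat.mul_div_cancel_left _ hq]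

/-- Fourfold divisor sums as sums over a box. -/
lemma sum_quad_eq_sum_box (φ : ℕ → ℕ → ℕ → ℕ → ℝ) {N M : ℕ} (hNM : N ≤ M) :
    ∑ n ∈ Finset.Icc 1 N, ∑ u ∈ n.divisorsAntidiagonal, ∑ x ∈ u.1.divisorsAntidiagonal,
      ∑ y ∈ u.2.divisorsAntidiagonal, φ x.1 x.2 y.1 y.2 =
    ∑ p ∈ Finset.Icc 1 M, ∑ q ∈ Finset.Icc 1 M, ∑ r ∈ Finset.Icc 1 M, ∑ s ∈ Finset.Icc 1 M,
      if p * q * r * s ≤ N then φ p q r s else 0 := by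
  have hsub : ∀ (K a : ℕ) (g : ℕ → ℝ), K ≤ M → 0 < a →
      ∑ b ∈ Finset.Icc 1 (K / a), g b = ∑ b ∈ Finset.Icc 1 M, if a * b ≤ K then g b else 0 := by
    intro K a g hK ha
    rw [← Finset.sum_filter]
    refine Finset.sum_congr ?_ fun _ _ => rfl
    ext b
    simp only [Finset.mem_Icc, Finset.mem_filter, Nat.le_div_iff_mul_le ha]
    constructor
    · rintro ⟨h1, h2⟩
      rw [mul_comm] at h2
      exact ⟨⟨h1, (Nat.le_mul_of_pos_left b ha).trans (h2.trans hK)⟩, h2⟩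
    · rintro ⟨⟨h1, -⟩, h2⟩
      exact ⟨h1, by rwa [mul_comm]⟩
  have hext : ∀ (K : ℕ) (g : ℕ → ℝ), K ≤ M → (∀ b, K < b → g b = 0) →
      ∑ b ∈ Finset.Icc 1 K, g b = ∑ b ∈ Finset.Icc 1 M, g b := by
    intro K g hK hg
    refine Finset.sum_subset (Finset.Icc_subset_Icc_right hK) fun b hb hb' => hg b ?_
    rw [Finset.mem_Icc] at hb hb'
    omega
  rw [sum_Icc_divisorsAntidiagonal (fun u => ∑ x ∈ u.1.divisorsAntidiagonal,
      ∑ y ∈ u.2.divisorsAntidiagonal, φ x.1 x.2 y.1 y.2)]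
  simp only
  have h1 : ∀ a ∈ Finset.Icc 1 N, ∑ b ∈ Finset.Icc 1 (N / a), ∑ x ∈ a.divisorsAntidiagonal,
      ∑ y ∈ b.divisorsAntidiagonal, φ x.1 x.2 y.1 y.2 = ∑ x ∈ a.divisorsAntidiagonal,
      ∑ r ∈ Finset.Icc 1 (N / (x.1 * x.2)), ∑ s ∈ Finset.Icc 1 (N / (x.1 * x.2) / r),
        φ x.1 x.2 r s := by
    intro a _
    rw [Finset.sum_comm]
    refine Finset.sum_congr rfl fun x hx => ?_
    rw [sum_Icc_divisorsAntidiagonal (fun y => φ x.1 x.2 y.1 y.2),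
      (Nat.mem_divisorsAntidiagonal.mp hx).1]
  rw [Finset.sum_congr rfl h1, sum_Icc_divisorsAntidiagonal (fun x =>
      ∑ r ∈ Finset.Icc 1 (N / (x.1 * x.2)), ∑ s ∈ Finset.Icc 1 (N / (x.1 * x.2) / r),
        φ x.1 x.2 r s), hext N _ hNM fun p hp => by rw [Nat.div_eq_of_lt hp]; simp]
  refine Finset.sum_congr rfl fun p hp => ?_
  have hp0 : 0 < p := (Finset.mem_Icc.mp hp).1
  rw [hext (N / p) _ ((Nat.div_le_self _ _).trans hNM) fun q hq => by
    rw [← Nat.div_div_eq_div_mul, Nat.div_eq_of_lt hq]; simp]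
  refine Finset.sum_congr rfl fun q hq => ?_
  have hq0 : 0 < q := (Finset.mem_Icc.mp hq).1
  rw [hext (N / (p * q)) _ ((Nat.div_le_self _ _).trans hNM) fun r hr => by
    rw [Nat.div_eq_of_lt hr]; simp]
  refine Finset.sum_congr rfl fun r hr => ?_
  have hr0 : 0 < r := (Finset.mem_Icc.mp hr).1
  rw [Nat.div_div_eq_div_mul, hsub N (p * q * r) _ hNM (by positivity)]

lemma sum_Icc_ite_dvd {m N : ℕ} (hm : 0 < m) {g : ℕ → ℝ} (hg : ∀ n, N < n → g n = 0) :
    ∑ q ∈ Finset.Icc 1 N, (if m ∣ q then g q else 0) = ∑ q ∈ Finset.Icc 1 N, g (m * q) := by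
  rw [← Finset.sum_filter]
  have h1 : ∑ q ∈ Finset.Icc 1 N, g (m * q) =
      ∑ q ∈ (Finset.Icc 1 N).filter (fun q => m * q ≤ N), g (m * q) := by
    rw [Finset.sum_filter]
    refine Finset.sum_congr rfl fun q _ => ?_
    split_ifs with h
    · rfl
    · exact hg _ (not_le.mp h)
  rw [h1]
  refine (Finset.sum_bij (fun q _ => m * q) ?_ ?_ ?_ ?_).symm
  · intro q hq
    simp only [Finset.mem_filter, Finset.mem_Icc] at hq ⊢
    exact ⟨⟨Nat.mul_pos hm hq.1.1, hq.2⟩, dvd_mul_right _ _⟩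
  · intro a _ b _ hab
    exact Nat.eq_of_mul_eq_mul_left hm hab
  · intro q hq
    simp only [Finset.mem_filter, Finset.mem_Icc] at hq
    obtain ⟨⟨h1, h2⟩, k, rfl⟩ := hq
    have hk : 0 < k := Nat.pos_of_ne_zero (by rintro rfl; omega)
    refine ⟨k, ?_, rfl⟩
    simp only [Finset.mem_filter, Finset.mem_Icc]
    exact ⟨⟨hk, (Nat.le_mul_of_pos_left k hm).trans h2⟩, h2⟩
  · intro q _
    rfl

lemma ite_coprime_eq_sum_moebius {q r N : ℕ} (hq : 0 < q) (hqN : q ≤ N) :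
    (if Nat.Coprime q r then (1 : ℝ) else 0) =
      ∑ m ∈ Finset.Icc 1 N, if m ∣ q ∧ m ∣ r then (ArithmeticFunction.moebius m : ℝ) else 0 := by
  have h := congrArg (fun f : ArithmeticFunction ℤ => f (Nat.gcd q r))
    ArithmeticFunction.coe_zeta_mul_moebius
  simp only [ArithmeticFunction.coe_zeta_mul_apply, ArithmeticFunction.one_apply] at h
  have h2 : (Nat.gcd q r).divisors = (Finset.Icc 1 N).filter fun m => m ∣ q ∧ m ∣ r := by
    ext m
    simp only [Nat.mem_divisors, Finset.mem_filter, Finset.mem_Icc, Nat.dvd_gcd_iff]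
    constructor
    · rintro ⟨h, -⟩
      exact ⟨⟨Nat.pos_of_dvd_of_pos h.1 hq, (Nat.le_of_dvd hq h.1).trans hqN⟩, h⟩
    · rintro ⟨-, h⟩
      exact ⟨h, (Nat.gcd_pos_of_pos_left _ hq).ne'⟩
  rw [← Finset.sum_filter, ← h2]
  have h3 := congrArg (fun z : ℤ => (z : ℝ)) h
  push_cast at h3
  rw [h3]

lemma sum_quad_coprime (ψ : ℕ → ℕ → ℕ → ℕ → ℝ) (N : ℕ) :
    ∑ n ∈ Finset.Icc 1 N, ∑ u ∈ n.divisorsAntidiagonal, ∑ x ∈ u.1.divisorsAntidiagonal,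
      ∑ y ∈ u.2.divisorsAntidiagonal,
        (if Nat.Coprime x.2 y.1 then ψ x.1 x.2 y.1 y.2 else 0) =
    ∑ m ∈ Finset.Icc 1 N, (ArithmeticFunction.moebius m : ℝ) *
      ∑ n ∈ Finset.Icc 1 (N / m ^ 2), ∑ u ∈ n.divisorsAntidiagonal,
        ∑ x ∈ u.1.divisorsAntidiagonal, ∑ y ∈ u.2.divisorsAntidiagonal,
          ψ x.1 (m * x.2) (m * y.1) y.2 := by
  rw [sum_quad_eq_sum_box (fun p q r s => if Nat.Coprime q r then ψ p q r s else 0) le_rfl]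
  have hR : ∀ m ∈ Finset.Icc 1 N, (ArithmeticFunction.moebius m : ℝ) *
      ∑ n ∈ Finset.Icc 1 (N / m ^ 2), ∑ u ∈ n.divisorsAntidiagonal,
        ∑ x ∈ u.1.divisorsAntidiagonal, ∑ y ∈ u.2.divisorsAntidiagonal,
          ψ x.1 (m * x.2) (m * y.1) y.2 =
      ∑ p ∈ Finset.Icc 1 N, ∑ q ∈ Finset.Icc 1 N, ∑ r ∈ Finset.Icc 1 N, ∑ s ∈ Finset.Icc 1 N,
        if m ∣ q ∧ m ∣ r then (ArithmeticFunction.moebius m : ℝ) *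
          (if p * q * r * s ≤ N then ψ p q r s else 0) else 0 := by
    intro m hm
    have hm0 : 0 < m := (Finset.mem_Icc.mp hm).1
    rw [sum_quad_eq_sum_box (fun p q r s => ψ p (m * q) (m * r) s) (Nat.div_le_self N (m ^ 2)),
      Finset.mul_sum]
    refine Finset.sum_congr rfl fun p hp => ?_
    have hp0 : 0 < p := (Finset.mem_Icc.mp hp).1
    have e1 : ∀ q : ℕ, ∑ r ∈ Finset.Icc 1 N, ∑ s ∈ Finset.Icc 1 N,
        (if m ∣ q ∧ m ∣ r then (ArithmeticFunction.moebius m : ℝ) *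
          (if p * q * r * s ≤ N then ψ p q r s else 0) else 0) =
        if m ∣ q then ∑ r ∈ Finset.Icc 1 N, (if m ∣ r then ∑ s ∈ Finset.Icc 1 N,
          (ArithmeticFunction.moebius m : ℝ) * (if p * q * r * s ≤ N then ψ p q r s else 0)
            else 0) else 0 := by
      intro q
      by_cases hq : m ∣ q
      · simp only [hq, true_and, if_true]
        refine Finset.sum_congr rfl fun r _ => ?_
        split_ifs <;> simp
      · simp [hq]
    rw [Finset.sum_congr rfl fun q _ => e1 q, sum_Icc_ite_dvd hm0 fun q hq => ?_, Finset.mul_sum]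
    · refine Finset.sum_congr rfl fun q hq => ?_
      have hq0 : 0 < q := (Finset.mem_Icc.mp hq).1
      rw [sum_Icc_ite_dvd hm0 fun r hr => ?_, Finset.mul_sum]
      · refine Finset.sum_congr rfl fun r hr => ?_
        rw [Finset.mul_sum]
        refine Finset.sum_congr rfl fun s _ => ?_
        have : p * q * r * s ≤ N / m ^ 2 ↔ p * (m * q) * (m * r) * s ≤ N := by
          rw [Nat.le_div_iff_mul_le (by positivity)]
          rw [show p * (m * q) * (m * r) * s = p * q * r * s * m ^ 2 by ring]
        simp only [this]
      · refine Finset.sum_eq_zero fun s hs => ?_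
        have hs0 : 0 < s := (Finset.mem_Icc.mp hs).1
        rw [if_neg, mul_zero]
        have : r ≤ p * (m * q) * r * s := by
          calc r ≤ r * (p * (m * q) * s) := Nat.le_mul_of_pos_right r (by positivity)
            _ = _ := by ring
        omega
    · refine Finset.sum_eq_zero fun r hr => ?_
      have hr0 : 0 < r := (Finset.mem_Icc.mp hr).1
      split_ifs with h
      · refine Finset.sum_eq_zero fun s hs => ?_
        have hs0 : 0 < s := (Finset.mem_Icc.mp hs).1
        rw [if_neg, mul_zero]
        have : q ≤ p * q * r * s := by
          calc q ≤ q * (p * r * s) := Nat.le_mul_of_pos_right q (by positivity)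
            _ = _ := by ring
        omega
      · rfl
  rw [Finset.sum_congr rfl hR]
  conv_rhs => rw [Finset.sum_comm]
  refine Finset.sum_congr rfl fun p _ => ?_
  conv_rhs => rw [Finset.sum_comm]
  refine Finset.sum_congr rfl fun q hq => ?_
  conv_rhs => rw [Finset.sum_comm]
  refine Finset.sum_congr rfl fun r _ => ?_
  conv_rhs => rw [Finset.sum_comm]
  refine Finset.sum_congr rfl fun s _ => ?_
  have hq' := Finset.mem_Icc.mp hq
  have := ite_coprime_eq_sum_moebius (r := r) hq'.1 hq'.2
  have e2 : (if Nat.Coprime q r then ψ p q r s else 0) =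
      (if Nat.Coprime q r then (1 : ℝ) else 0) * ψ p q r s := by split_ifs <;> simp
  rw [e2, this]
  split_ifs with h
  · rw [Finset.sum_mul]
    refine Finset.sum_congr rfl fun m _ => ?_
    split_ifs <;> simp
  · simp

/-- Reduction of the correlation of two divisor functions to fourfold convolutions. -/
lemma sum_dGen_mul_dGen (n₁ n₂ n₃ n₄ N : ℕ) :
    ∑ n ∈ Finset.Icc 1 N, dGen n₁ n₂ n * dGen n₃ n₄ n / n =
    ∑ m ∈ Finset.Icc 1 N, (ArithmeticFunction.moebius m : ℝ) / m ^ 2 *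
      ∑ n ∈ Finset.Icc 1 (N / m ^ 2), ∑ u ∈ n.divisorsAntidiagonal,
        ∑ x ∈ u.1.divisorsAntidiagonal, ∑ y ∈ u.2.divisorsAntidiagonal,
          (Real.log m + (Real.log x.1 + Real.log x.2)) ^ n₁ *
          (Real.log m + (Real.log y.1 + Real.log y.2)) ^ n₂ *
          (Real.log m + (Real.log x.1 + Real.log y.1)) ^ n₃ *
          (Real.log m + (Real.log x.2 + Real.log y.2)) ^ n₄ / (x.1 * x.2 * y.1 * y.2) := by
  have hL : ∀ n ∈ Finset.Icc 1 N, dGen n₁ n₂ n * dGen n₃ n₄ n / n =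
      ∑ u ∈ n.divisorsAntidiagonal, ∑ x ∈ u.1.divisorsAntidiagonal,
        ∑ y ∈ u.2.divisorsAntidiagonal, if Nat.Coprime x.2 y.1 then
          Real.log (x.1 * x.2 : ℕ) ^ n₁ * Real.log (y.1 * y.2 : ℕ) ^ n₂ *
          Real.log (x.1 * y.1 : ℕ) ^ n₃ * Real.log (x.2 * y.2 : ℕ) ^ n₄ /
          (x.1 * x.2 * y.1 * y.2 : ℕ) else 0 := by
    intro n hn
    conv_lhs => rw [dGen]
    rw [Finset.sum_mul, Finset.sum_div]
    refine Finset.sum_congr rfl fun u hu => ?_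
    obtain ⟨hu1, hu2⟩ := Nat.mem_divisorsAntidiagonal.mp hu
    have h1 : 0 < u.1 := Nat.pos_of_ne_zero (by rintro h; rw [h, zero_mul] at hu1; omega)
    have h2 : 0 < u.2 := Nat.pos_of_ne_zero (by rintro h; rw [h, mul_zero] at hu1; omega)
    have h3 : dGen n₃ n₄ n = ∑ x ∈ u.1.divisorsAntidiagonal, ∑ y ∈ u.2.divisorsAntidiagonal,
        if Nat.Coprime x.2 y.1 then
          Real.log (x.1 * y.1 : ℕ) ^ n₃ * Real.log (x.2 * y.2 : ℕ) ^ n₄ else 0 := by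
      rw [dGen, ← hu1]
      exact sum_divisorsAntidiagonal_mul
        (fun c d => Real.log (c : ℕ) ^ n₃ * Real.log (d : ℕ) ^ n₄) h1 h2
    rw [h3, Finset.mul_sum, Finset.sum_div]
    refine Finset.sum_congr rfl fun x hx => ?_
    rw [Finset.mul_sum, Finset.sum_div]
    refine Finset.sum_congr rfl fun y hy => ?_
    obtain ⟨hx1, -⟩ := Nat.mem_divisorsAntidiagonal.mp hx
    obtain ⟨hy1, -⟩ := Nat.mem_divisorsAntidiagonal.mp hy
    have e : x.1 * x.2 * y.1 * y.2 = n := by rw [mul_assoc, hy1, hx1, hu1]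
    rw [e, hx1, hy1]
    split_ifs
    · ring
    · simp
  rw [Finset.sum_congr rfl hL, sum_quad_coprime (fun p q r s =>
    Real.log (p * q : ℕ) ^ n₁ * Real.log (r * s : ℕ) ^ n₂ * Real.log (p * r : ℕ) ^ n₃ *
      Real.log (q * s : ℕ) ^ n₄ / (p * q * r * s : ℕ))]
  refine Finset.sum_congr rfl fun m hm => ?_
  have hm0 : (m : ℝ) ≠ 0 := by
    have := (Finset.mem_Icc.mp hm).1
    positivity
  rw [div_mul_eq_mul_div, mul_div_assoc]
  congr 1
  simp only [Finset.sum_div]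
  refine Finset.sum_congr rfl fun n hn => Finset.sum_congr rfl fun u hu =>
    Finset.sum_congr rfl fun x hx => Finset.sum_congr rfl fun y hy => ?_
  obtain ⟨hx1, hx2⟩ := Nat.mem_divisorsAntidiagonal.mp hx
  obtain ⟨hy1, hy2⟩ := Nat.mem_divisorsAntidiagonal.mp hy
  rw [← hx1] at hx2
  rw [← hy1] at hy2
  have a1 : (x.1 : ℝ) ≠ 0 := by exact_mod_cast left_ne_zero_of_mul hx2
  have a2 : (x.2 : ℝ) ≠ 0 := by exact_mod_cast right_ne_zero_of_mul hx2
  have a3 : (y.1 : ℝ) ≠ 0 := by exact_mod_cast left_ne_zero_of_mul hy2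
  have a4 : (y.2 : ℝ) ≠ 0 := by exact_mod_cast right_ne_zero_of_mul hy2
  push_cast
  have b1 : Real.log (x.1 * (m * x.2)) = Real.log m + (Real.log x.1 + Real.log x.2) := by
    rw [Real.log_mul a1 (by positivity), Real.log_mul hm0 a2]; ring
  have b2 : Real.log (m * y.1 * y.2) = Real.log m + (Real.log y.1 + Real.log y.2) := by
    rw [Real.log_mul (by positivity) a4, Real.log_mul hm0 a3]; ring
  have b3 : Real.log (x.1 * (m * y.1)) = Real.log m + (Real.log x.1 + Real.log y.1) := by
    rw [Real.log_mul a1 (by positivity), Real.log_mul hm0 a3]; ring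
  have b4 : Real.log (m * x.2 * y.2) = Real.log m + (Real.log x.2 + Real.log y.2) := by
    rw [Real.log_mul (by positivity) a4, Real.log_mul hm0 a2]; ring
  rw [b1, b2, b3, b4]
  field_simp

/-- `F τ` is a polynomial in `τ` of degree at most `D`, whose coefficient of degree `D` is `c`, up
to an error `O(exp (-(1/2 - ε) τ))`. -/
def HasPolyAsymp (F : ℝ → ℝ) (D : ℕ) (c : ℝ) : Prop :=
  ∃ P : Polynomial ℝ, P.natDegree ≤ D ∧ P.coeff D = c ∧
    ∀ ε, 0 < ε → ∃ K, 0 < K ∧ ∀ τ, 0 ≤ τ → |F τ - P.eval τ| ≤ K * Real.exp (-(1 / 2 - ε) * τ)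

namespace HasPolyAsymp

variable {F G : ℝ → ℝ} {D : ℕ} {c c' : ℝ}

lemma congr (h : HasPolyAsymp F D c) (hFG : ∀ τ, 0 ≤ τ → F τ = G τ) : HasPolyAsymp G D c := by
  obtain ⟨P, h1, h2, h3⟩ := h
  refine ⟨P, h1, h2, fun ε hε => ?_⟩
  obtain ⟨K, hK, h4⟩ := h3 ε hε
  exact ⟨K, hK, fun τ hτ => by rw [← hFG τ hτ]; exact h4 τ hτ⟩

lemma of_lt (h : HasPolyAsymp F D c) {D' : ℕ} (hD : D < D') : HasPolyAsymp F D' 0 := by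
  obtain ⟨P, h1, -, h3⟩ := h
  exact ⟨P, h1.trans hD.le, Polynomial.coeff_eq_zero_of_natDegree_lt (h1.trans_lt hD), h3⟩

lemma zero : HasPolyAsymp (fun _ => 0) D 0 :=
  ⟨0, by simp, by simp, fun ε _ => ⟨1, one_pos, fun τ _ => by simp; positivity⟩⟩

lemma add (hF : HasPolyAsymp F D c) (hG : HasPolyAsymp G D c') :
    HasPolyAsymp (fun τ => F τ + G τ) D (c + c') := by
  obtain ⟨P, h1, h2, h3⟩ := hF
  obtain ⟨Q, g1, g2, g3⟩ := hG
  refine ⟨P + Q, Polynomial.natDegree_add_le_of_degree_le h1 g1, by simp [h2, g2],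
    fun ε hε => ?_⟩
  obtain ⟨K, hK, h4⟩ := h3 ε hε
  obtain ⟨L, hL, g4⟩ := g3 ε hε
  refine ⟨K + L, by positivity, fun τ hτ => ?_⟩
  rw [Polynomial.eval_add, add_sub_add_comm, add_mul]
  exact (abs_add_le _ _).trans (add_le_add (h4 τ hτ) (g4 τ hτ))

lemma const_mul (a : ℝ) (hF : HasPolyAsymp F D c) :
    HasPolyAsymp (fun τ => a * F τ) D (a * c) := by
  obtain ⟨P, h1, h2, h3⟩ := hF
  refine ⟨Polynomial.C a * P, (Polynomial.natDegree_C_mul_le _ _).trans h1, by simp [h2],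
    fun ε hε => ?_⟩
  obtain ⟨K, hK, h4⟩ := h3 ε hε
  refine ⟨(|a| + 1) * K, by positivity, fun τ hτ => ?_⟩
  rw [Polynomial.eval_C_mul, ← mul_sub, abs_mul, mul_assoc]
  exact mul_le_mul (by linarith) (h4 τ hτ) (abs_nonneg _) (by positivity)

lemma sum {ι : Type*} (s : Finset ι) {f : ι → ℝ → ℝ} {C : ι → ℝ}
    (h : ∀ i ∈ s, HasPolyAsymp (f i) D (C i)) :
    HasPolyAsymp (fun τ => ∑ i ∈ s, f i τ) D (∑ i ∈ s, C i) := by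
  classical
  induction s using Finset.induction_on with
  | empty => simpa using zero
  | insert i s hi ih =>
    simp only [Finset.sum_insert hi]
    exact (h i (Finset.mem_insert_self i s)).add
      (ih fun j hj => h j (Finset.mem_insert_of_mem hj))

end HasPolyAsymp

/-- The weight `μ(m) (log m)^u / m^2`. -/
noncomputable def moebiusLogF (u m : ℕ) : ℝ :=
  (ArithmeticFunction.moebius m : ℝ) / m ^ 2 * Real.log m ^ u

lemma abs_moebiusLogF_le (u : ℕ) {ε : ℝ} (hε : 0 < ε) :
    ∃ C, 0 < C ∧ ∀ m : ℕ, |moebiusLogF u m| * Real.exp ((1 - 2 * ε) * Real.log m) ≤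
      C * (m : ℝ) ^ (-(1 + ε)) := by
  refine ⟨u.factorial / ε ^ u, by positivity, fun m => ?_⟩
  rcases Nat.eq_zero_or_pos m with rfl | hm
  · simp only [moebiusLogF, ArithmeticFunction.map_zero, Int.cast_zero, zero_div, zero_mul,
      abs_zero]
    positivity
  have hm' : (0 : ℝ) < m := by exact_mod_cast hm
  have hL : 0 ≤ Real.log m := Real.log_natCast_nonneg m
  have h1 : |(ArithmeticFunction.moebius m : ℝ)| ≤ 1 := by
    exact_mod_cast ArithmeticFunction.abs_moebius_le_one
  have h2 := pow_le_const_mul_exp u hε hL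
  have h3 : |moebiusLogF u m| ≤ Real.exp (-2 * Real.log m) *
      (u.factorial / ε ^ u * Real.exp (ε * Real.log m)) := by
    rw [moebiusLogF, abs_mul, abs_div, abs_of_nonneg (pow_nonneg hL u),
      abs_of_nonneg (by positivity : (0 : ℝ) ≤ (m : ℝ) ^ 2)]
    refine mul_le_mul ?_ h2 (by positivity) (by positivity)
    have : Real.exp (-2 * Real.log m) = 1 / (m : ℝ) ^ 2 := by
      rw [show -2 * Real.log m = -(Real.log m + Real.log m) by ring, Real.exp_neg, Real.exp_add,
        Real.exp_log hm', one_div, sq]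
    rw [this]
    gcongr
  calc |moebiusLogF u m| * Real.exp ((1 - 2 * ε) * Real.log m)
      ≤ Real.exp (-2 * Real.log m) * (u.factorial / ε ^ u * Real.exp (ε * Real.log m)) *
          Real.exp ((1 - 2 * ε) * Real.log m) := by gcongr
    _ = u.factorial / ε ^ u * (Real.exp (-2 * Real.log m) * Real.exp (ε * Real.log m) *
          Real.exp ((1 - 2 * ε) * Real.log m)) := by ring
    _ = _ := by
      rw [← Real.exp_add, ← Real.exp_add, Real.rpow_def_of_pos hm']
      congr 2
      ring

lemma summable_abs_moebiusLogF_mul_exp (u : ℕ) {ε : ℝ} (hε : 0 < ε) :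
    Summable fun m : ℕ => |moebiusLogF u m| * Real.exp ((1 - 2 * ε) * Real.log m) := by
  obtain ⟨C, hC, h⟩ := abs_moebiusLogF_le u hε
  refine Summable.of_nonneg_of_le (fun m => by positivity) h ?_
  exact (Real.summable_nat_rpow.mpr (by linarith)).mul_left C

lemma summable_moebiusLogF_mul_eval (u : ℕ) (p : Polynomial ℝ) :
    Summable fun m : ℕ => moebiusLogF u m * p.eval (-(2 * Real.log m)) := by
  obtain ⟨K, hK, hp⟩ := p.abs_eval_le_const_mul_exp (η := 1 / 4) (by norm_num)
  refine Summable.of_norm_bounded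
    ((summable_abs_moebiusLogF_mul_exp u (ε := 1 / 4) (by norm_num)).mul_left K) fun m => ?_
  rw [Real.norm_eq_abs, abs_mul, mul_left_comm]
  refine mul_le_mul_of_nonneg_left ((hp _).trans (le_of_eq ?_)) (abs_nonneg _)
  rw [abs_neg, abs_of_nonneg (mul_nonneg zero_le_two (Real.log_natCast_nonneg m))]
  congr 2
  ring

lemma HasPolyAsymp.bound_all {F : ℝ → ℝ} (P : Polynomial ℝ) (hF : ∀ τ < 0, F τ = 0) {ε : ℝ}
    (hε : ε < 1 / 2)
    (h : ∃ K, 0 < K ∧ ∀ τ, 0 ≤ τ → |F τ - P.eval τ| ≤ K * Real.exp (-(1 / 2 - ε) * τ)) :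
    ∃ K, 0 < K ∧ ∀ τ, |F τ - P.eval τ| ≤ K * Real.exp (-(1 / 2 - ε) * τ) := by
  obtain ⟨K, hK, h1⟩ := h
  obtain ⟨L, hL, h2⟩ := P.abs_eval_le_const_mul_exp (η := 1 / 2 - ε) (by linarith)
  refine ⟨K + L, by positivity, fun τ => ?_⟩
  have he := Real.exp_pos (-(1 / 2 - ε) * τ)
  rcases lt_or_ge τ 0 with hτ | hτ
  · rw [hF τ hτ, zero_sub, abs_neg]
    refine (h2 τ).trans ?_
    rw [abs_of_neg hτ, show (1 / 2 - ε) * -τ = -(1 / 2 - ε) * τ by ring]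
    gcongr
    linarith
  · refine (h1 τ hτ).trans ?_
    gcongr
    linarith

/-- Twisting by the weights `moebiusLogF u` preserves polynomial asymptotics. -/
lemma HasPolyAsymp.moebius {F : ℝ → ℝ} {D : ℕ} {c : ℝ} (h : HasPolyAsymp F D c)
    (hF : ∀ τ < 0, F τ = 0) (u : ℕ) :
    HasPolyAsymp (fun T => ∑ m ∈ Finset.Icc 1 ⌊Real.exp T⌋₊,
      moebiusLogF u m * F (T - 2 * Real.log m)) D (c * ∑' m, moebiusLogF u m) := by
  obtain ⟨P, h1, h2, h3⟩ := h
  set Q : Polynomial ℝ := ∑ k ∈ Finset.range (D + 1),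
    Polynomial.C (∑' m, moebiusLogF u m * (Polynomial.hasseDeriv k P).eval (-(2 * Real.log m))) *
      Polynomial.X ^ k with hQ
  have hsum := fun k => summable_moebiusLogF_mul_eval u (Polynomial.hasseDeriv k P)
  have hdeg : Q.natDegree ≤ D := by
    refine Polynomial.natDegree_sum_le_of_forall_le _ _ fun k hk => ?_
    exact (Polynomial.natDegree_C_mul_X_pow_le _ _).trans (by simpa [Nat.lt_succ_iff] using hk)
  have hcoeff : Q.coeff D = c * ∑' m, moebiusLogF u m := by
    rw [hQ, Polynomial.finsetSum_coeff]
    simp only [Polynomial.coeff_C_mul_X_pow]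
    rw [Finset.sum_ite_eq, if_pos (by simp), ← tsum_mul_left]
    refine tsum_congr fun m => ?_
    have : Polynomial.hasseDeriv D P = Polynomial.C c := by
      rw [Polynomial.eq_C_of_natDegree_le_zero
        ((Polynomial.natDegree_hasseDeriv_le P D).trans (by omega)), Polynomial.hasseDeriv_coeff]
      simp [h2]
    rw [this, Polynomial.eval_C, mul_comm]
  have heval : ∀ T, Q.eval T = ∑' m, moebiusLogF u m * P.eval (T - 2 * Real.log m) := by
    intro T
    have e : ∀ m : ℕ, moebiusLogF u m * P.eval (T - 2 * Real.log m) =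
        ∑ k ∈ Finset.range (D + 1), moebiusLogF u m *
          (Polynomial.hasseDeriv k P).eval (-(2 * Real.log m)) * T ^ k := by
      intro m
      have := Polynomial.taylor_eval (-(2 * Real.log m)) P T
      rw [← sub_eq_add_neg] at this
      rw [← this, Polynomial.eval_eq_sum_range' (n := D + 1)
        (by rw [Polynomial.natDegree_taylor]; omega), Finset.mul_sum]
      refine Finset.sum_congr rfl fun k _ => ?_
      rw [Polynomial.taylor_coeff, mul_assoc]
    rw [tsum_congr e, Summable.tsum_finsetSum fun k _ => (hsum k).mul_right _, hQ,
      Polynomial.eval_finsetSum]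
    refine Finset.sum_congr rfl fun k _ => ?_
    rw [tsum_mul_right]
    simp
  have hsumP : ∀ T, Summable fun m : ℕ => moebiusLogF u m * P.eval (T - 2 * Real.log m) := by
    intro T
    have := summable_moebiusLogF_mul_eval u (Polynomial.taylor T P)
    refine this.congr fun m => ?_
    rw [Polynomial.taylor_eval, neg_add_eq_sub]
  have hfin : ∀ T : ℝ, ∀ m ∉ Finset.Icc 1 ⌊Real.exp T⌋₊,
      moebiusLogF u m * F (T - 2 * Real.log m) = 0 := by
    intro T m hm
    rcases Nat.eq_zero_or_pos m with rfl | hm0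
    · simp [moebiusLogF]
    have h4 : ⌊Real.exp T⌋₊ < m := by
      by_contra h
      exact hm (Finset.mem_Icc.mpr ⟨hm0, not_lt.mp h⟩)
    have h5 : T < Real.log m := by
      rw [Real.lt_log_iff_exp_lt (by exact_mod_cast hm0)]
      exact (Nat.floor_lt (Real.exp_pos T).le).mp h4
    have := Real.log_natCast_nonneg m
    rw [hF _ (by linarith), mul_zero]
  have key : ∀ ε, 0 < ε → ε < 1 / 2 → ∃ K, 0 < K ∧ ∀ T,
      |∑ m ∈ Finset.Icc 1 ⌊Real.exp T⌋₊, moebiusLogF u m * F (T - 2 * Real.log m) - Q.eval T| ≤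
        K * Real.exp (-(1 / 2 - ε) * T) := by
    intro ε hε hε2
    obtain ⟨K, hK, hb⟩ := HasPolyAsymp.bound_all P hF hε2 (h3 ε hε)
    have hS := summable_abs_moebiusLogF_mul_exp u hε
    have hS0 : 0 ≤ ∑' m : ℕ, |moebiusLogF u m| * Real.exp ((1 - 2 * ε) * Real.log m) :=
      tsum_nonneg fun m => by positivity
    refine ⟨K * (∑' m : ℕ, |moebiusLogF u m| * Real.exp ((1 - 2 * ε) * Real.log m) + 1),
      by positivity, fun T => ?_⟩
    have hsF : Summable fun m : ℕ => moebiusLogF u m * F (T - 2 * Real.log m) :=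
      summable_of_ne_finset_zero (hfin T)
    rw [← tsum_eq_sum (L := SummationFilter.unconditional ℕ) (hfin T), heval, ← hsF.tsum_sub (hsumP T)]
    have hle : ∀ m : ℕ, ‖moebiusLogF u m * F (T - 2 * Real.log m) -
        moebiusLogF u m * P.eval (T - 2 * Real.log m)‖ ≤
        K * Real.exp (-(1 / 2 - ε) * T) *
          (|moebiusLogF u m| * Real.exp ((1 - 2 * ε) * Real.log m)) := by
      intro m
      rw [← mul_sub, Real.norm_eq_abs, abs_mul]
      calc |moebiusLogF u m| * |F (T - 2 * Real.log m) - P.eval (T - 2 * Real.log m)|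
          ≤ |moebiusLogF u m| * (K * Real.exp (-(1 / 2 - ε) * (T - 2 * Real.log m))) := by
            gcongr
            exact hb _
        _ = _ := by
          rw [show -(1 / 2 - ε) * (T - 2 * Real.log m) =
            -(1 / 2 - ε) * T + (1 - 2 * ε) * Real.log m by ring, Real.exp_add]
          ring
    have := tsum_of_norm_bounded (hS.mul_left (K * Real.exp (-(1 / 2 - ε) * T))).hasSum hle
    rw [tsum_mul_left, Real.norm_eq_abs] at this
    refine this.trans ?_
    have hp := mul_pos hK (Real.exp_pos (-(1 / 2 - ε) * T))
    nlinarith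
  refine ⟨Q, hdeg, hcoeff, fun ε hε => ?_⟩
  obtain ⟨K, hK, hb⟩ := key (min ε (1 / 4)) (lt_min hε (by norm_num))
    ((min_le_right _ _).trans_lt (by norm_num))
  refine ⟨K, hK, fun T hT => (hb T).trans ?_⟩
  have := min_le_left ε (1 / 4)
  gcongr

lemma tsum_moebiusLogF_zero : ∑' m, moebiusLogF 0 m = 6 / Real.pi ^ 2 := by
  have h1 : (1 : ℝ) < (2 : ℂ).re := by norm_num
  have h2 := ArithmeticFunction.LSeries_zeta_mul_Lseries_moebius h1
  rw [ArithmeticFunction.LSeries_zeta_eq_riemannZeta h1, riemannZeta_two] at h2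
  have h3 : LSeries (fun n => ((ArithmeticFunction.moebius n : ℤ) : ℂ)) 2 =
      ((∑' m, moebiusLogF 0 m : ℝ) : ℂ) := by
    rw [LSeries, Complex.ofReal_tsum]
    refine tsum_congr fun m => ?_
    rcases Nat.eq_zero_or_pos m with rfl | hm
    · simp [moebiusLogF]
    · rw [LSeries.term_of_ne_zero hm.ne', moebiusLogF]
      push_cast
      simp
  have h4 : (Real.pi ^ 2 / 6 : ℝ) * ∑' m, moebiusLogF 0 m = 1 := by
    have := h2
    erw [h3] at this
    exact_mod_cast this
  have hpi := Real.pi_pos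
  field_simp at h4 ⊢
  linarith

/-- Index set of the trinomial expansion of exponent `n`. -/
def trinomialIndex (n : ℕ) : Finset (Σ _ : ℕ, ℕ) :=
  (Finset.range (n + 1)).sigma fun e => Finset.range (n - e + 1)

/-- The trinomial coefficient `n! / (e! a! (n - e - a)!)`. -/
def trinomialCoeff (n : ℕ) (q : Σ _ : ℕ, ℕ) : ℝ := n.choose q.1 * (n - q.1).choose q.2

lemma add_add_pow_eq_sum (n : ℕ) (L x y : ℝ) :
    (L + (x + y)) ^ n = ∑ q ∈ trinomialIndex n,
      trinomialCoeff n q * (L ^ q.1 * x ^ q.2 * y ^ (n - q.1 - q.2)) := by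
  rw [add_pow, trinomialIndex, Finset.sum_sigma]
  refine Finset.sum_congr rfl fun e _ => ?_
  rw [add_pow, Finset.mul_sum, Finset.sum_mul]
  refine Finset.sum_congr rfl fun a _ => ?_
  simp only [trinomialCoeff]
  ring

lemma sum_trinomialIndex_of_eq_zero {n : ℕ} {g : (Σ _ : ℕ, ℕ) → ℝ}
    (hg : ∀ q, q.1 ≠ 0 → g q = 0) :
    ∑ q ∈ trinomialIndex n, g q = ∑ a ∈ Finset.range (n + 1), g ⟨0, a⟩ := by
  rw [trinomialIndex, Finset.sum_sigma, Finset.sum_eq_single 0]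
  · simp
  · exact fun e _ he => Finset.sum_eq_zero fun a _ => hg ⟨e, a⟩ he
  · simp

lemma sum_choose_mul_choose (a b n : ℕ) :
    ∑ e ∈ Finset.range (n + 1), ((a + e).choose a : ℝ) * ((b + (n - e)).choose b : ℝ) =
      ((a + b + 1 + n).choose n : ℝ) := by
  have h : (PowerSeries.mk 1 : PowerSeries ℝ) ^ (a + 1) * PowerSeries.mk 1 ^ (b + 1) =
      PowerSeries.mk 1 ^ (a + b + 1 + 1) := by
    rw [← pow_add]
    congr 1
    ring
  rw [PowerSeries.mk_one_pow_eq_mk_choose_add, PowerSeries.mk_one_pow_eq_mk_choose_add,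
    PowerSeries.mk_one_pow_eq_mk_choose_add] at h
  have h2 := congrArg (PowerSeries.coeff n) h
  rw [PowerSeries.coeff_mul, Finset.Nat.sum_antidiagonal_eq_sum_range_succ_mk] at h2
  simp only [PowerSeries.coeff_mk] at h2
  rw [h2, Nat.choose_symm_add]

/-- Evaluation of the sum giving the leading coefficient. -/
lemma sum_choose_mul_factorial (n₁ n₂ n₃ n₄ : ℕ) :
    ∑ a ∈ Finset.range (n₁ + 1), ∑ c ∈ Finset.range (n₂ + 1), ∑ e ∈ Finset.range (n₃ + 1),
      ∑ f ∈ Finset.range (n₄ + 1), ((n₁.choose a : ℝ) * n₂.choose c * n₃.choose e * n₄.choose f) *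
        ((a + e).factorial * (n₁ - a + f).factorial * (c + (n₃ - e)).factorial *
          (n₂ - c + (n₄ - f)).factorial : ℝ) =
    (n₁.factorial * n₂.factorial * n₃.factorial * n₄.factorial : ℝ) *
      ∑ a ∈ Finset.range (n₁ + 1), ∑ c ∈ Finset.range (n₂ + 1),
        (((n₃ + 1 + a + c).choose n₃ : ℝ) * ((n₄ + 1 + n₁ + n₂ - a - c).choose n₄ : ℝ)) := by
  rw [Finset.mul_sum]
  refine Finset.sum_congr rfl fun a ha => ?_
  rw [Finset.mul_sum]
  refine Finset.sum_congr rfl fun c hc => ?_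
  have ha' : a ≤ n₁ := Nat.lt_succ_iff.mp (Finset.mem_range.mp ha)
  have hc' : c ≤ n₂ := Nat.lt_succ_iff.mp (Finset.mem_range.mp hc)
  have h1 := sum_choose_mul_choose a c n₃
  have h2 := sum_choose_mul_choose (n₁ - a) (n₂ - c) n₄
  rw [show n₃ + 1 + a + c = a + c + 1 + n₃ by ring,
    show n₄ + 1 + n₁ + n₂ - a - c = n₁ - a + (n₂ - c) + 1 + n₄ by omega, ← h1, ← h2,
    Finset.sum_mul_sum, Finset.mul_sum]
  refine Finset.sum_congr rfl fun e he => ?_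
  rw [Finset.mul_sum]
  refine Finset.sum_congr rfl fun f hf => ?_
  have he' : e ≤ n₃ := Nat.lt_succ_iff.mp (Finset.mem_range.mp he)
  have hf' : f ≤ n₄ := Nat.lt_succ_iff.mp (Finset.mem_range.mp hf)
  rw [Nat.cast_choose ℝ ha', Nat.cast_choose ℝ hc', Nat.cast_choose ℝ he', Nat.cast_choose ℝ hf',
    Nat.cast_add_choose, Nat.cast_add_choose, Nat.cast_add_choose, Nat.cast_add_choose]
  field_simp

/-- Fourfold divisor sums up to `M`. -/
noncomputable def quadSum (M : ℕ) (φ : ℕ × ℕ → ℕ × ℕ → ℝ) : ℝ :=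
  ∑ n ∈ Finset.Icc 1 M, ∑ u ∈ n.divisorsAntidiagonal, ∑ x ∈ u.1.divisorsAntidiagonal,
    ∑ y ∈ u.2.divisorsAntidiagonal, φ x y

lemma quadSum_sum {ι : Type*} (s : Finset ι) (M : ℕ) (φ : ι → ℕ × ℕ → ℕ × ℕ → ℝ) :
    quadSum M (fun x y => ∑ i ∈ s, φ i x y) = ∑ i ∈ s, quadSum M (φ i) := by
  simp only [quadSum]
  rw [Finset.sum_comm (s := s)]
  refine Finset.sum_congr rfl fun n _ => ?_
  rw [Finset.sum_comm (s := s)]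
  refine Finset.sum_congr rfl fun u _ => ?_
  rw [Finset.sum_comm (s := s)]
  refine Finset.sum_congr rfl fun x _ => ?_
  rw [Finset.sum_comm (s := s)]

lemma quadSum_const_mul (M : ℕ) (a : ℝ) (φ : ℕ × ℕ → ℕ × ℕ → ℝ) :
    quadSum M (fun x y => a * φ x y) = a * quadSum M φ := by
  simp only [quadSum, Finset.mul_sum]

lemma expSum_quad_sub (i j k l : ℕ) {m : ℕ} (hm : 0 < m) (T : ℝ) :
    expSum (dirConv (dirConv (logF i) (logF j)) (dirConv (logF k) (logF l)))
      (T - 2 * Real.log m) =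
    quadSum (⌊Real.exp T⌋₊ / m ^ 2) fun x y =>
      Real.log x.1 ^ i * Real.log x.2 ^ j * Real.log y.1 ^ k * Real.log y.2 ^ l /
        (x.1 * x.2 * y.1 * y.2) := by
  have h : T - 2 * Real.log m = T - Real.log ((m ^ 2 : ℕ) : ℝ) := by
    push_cast
    rw [Real.log_pow]
    push_cast
    ring
  rw [expSum, h, floor_exp_sub_log (by positivity)]
  refine Finset.sum_congr rfl fun n _ => Finset.sum_congr rfl fun u _ => ?_
  simp only [dirConv, logF]
  rw [Finset.sum_mul_sum]
  refine Finset.sum_congr rfl fun x _ => Finset.sum_congr rfl fun y _ => ?_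
  rw [div_mul_div_comm, div_mul_div_comm, div_mul_div_comm]
  ring_nf

/-- Expansion of the correlation sum into twisted fourfold convolution sums of powers of
logarithms. -/
lemma sum_dGen_mul_dGen_eq_sum_trinomial (n₁ n₂ n₃ n₄ : ℕ) (T : ℝ) :
    ∑ n ∈ Finset.Icc 1 ⌊Real.exp T⌋₊, dGen n₁ n₂ n * dGen n₃ n₄ n / n =
    ∑ q₁ ∈ trinomialIndex n₁, ∑ q₂ ∈ trinomialIndex n₂, ∑ q₃ ∈ trinomialIndex n₃,
      ∑ q₄ ∈ trinomialIndex n₄, (trinomialCoeff n₁ q₁ * trinomialCoeff n₂ q₂ *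
        trinomialCoeff n₃ q₃ * trinomialCoeff n₄ q₄) *
        ∑ m ∈ Finset.Icc 1 ⌊Real.exp T⌋₊, moebiusLogF (q₁.1 + q₂.1 + q₃.1 + q₄.1) m *
          expSum (dirConv (dirConv (logF (q₁.2 + q₃.2)) (logF (n₁ - q₁.1 - q₁.2 + q₄.2)))
            (dirConv (logF (q₂.2 + (n₃ - q₃.1 - q₃.2)))
              (logF (n₂ - q₂.1 - q₂.2 + (n₄ - q₄.1 - q₄.2))))) (T - 2 * Real.log m) := by
  rw [sum_dGen_mul_dGen]
  simp only [Finset.mul_sum (s := Finset.Icc 1 ⌊Real.exp T⌋₊)]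
  simp only [Finset.sum_comm (t := Finset.Icc 1 ⌊Real.exp T⌋₊)]
  refine Finset.sum_congr rfl fun m hm => ?_
  have hm0 : 0 < m := (Finset.mem_Icc.mp hm).1
  simp only [expSum_quad_sub _ _ _ _ hm0]
  have h : ∀ x y : ℕ × ℕ,
      (Real.log m + (Real.log x.1 + Real.log x.2)) ^ n₁ *
      (Real.log m + (Real.log y.1 + Real.log y.2)) ^ n₂ *
      (Real.log m + (Real.log x.1 + Real.log y.1)) ^ n₃ *
      (Real.log m + (Real.log x.2 + Real.log y.2)) ^ n₄ / (x.1 * x.2 * y.1 * y.2) =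
      ∑ q₁ ∈ trinomialIndex n₁, ∑ q₂ ∈ trinomialIndex n₂, ∑ q₃ ∈ trinomialIndex n₃,
      ∑ q₄ ∈ trinomialIndex n₄, (trinomialCoeff n₁ q₁ * trinomialCoeff n₂ q₂ *
        trinomialCoeff n₃ q₃ * trinomialCoeff n₄ q₄ *
        Real.log m ^ (q₁.1 + q₂.1 + q₃.1 + q₄.1)) *
        (Real.log x.1 ^ (q₁.2 + q₃.2) * Real.log x.2 ^ (n₁ - q₁.1 - q₁.2 + q₄.2) *
          Real.log y.1 ^ (q₂.2 + (n₃ - q₃.1 - q₃.2)) *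
          Real.log y.2 ^ (n₂ - q₂.1 - q₂.2 + (n₄ - q₄.1 - q₄.2)) /
            (x.1 * x.2 * y.1 * y.2)) := by
    intro x y
    rw [add_add_pow_eq_sum n₁, add_add_pow_eq_sum n₂, add_add_pow_eq_sum n₃,
      add_add_pow_eq_sum n₄]
    rw [Finset.sum_mul_sum, Finset.sum_mul, Finset.sum_mul, Finset.sum_div]
    refine Finset.sum_congr rfl fun q₁ _ => ?_
    rw [Finset.sum_mul, Finset.sum_mul, Finset.sum_div]
    refine Finset.sum_congr rfl fun q₂ _ => ?_
    rw [mul_assoc, Finset.sum_mul_sum, Finset.mul_sum, Finset.sum_div]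
    refine Finset.sum_congr rfl fun q₃ _ => ?_
    rw [Finset.mul_sum, Finset.sum_div]
    refine Finset.sum_congr rfl fun q₄ _ => ?_
    ring
  change _ * quadSum (⌊Real.exp T⌋₊ / m ^ 2) (fun x y =>
      (Real.log m + (Real.log x.1 + Real.log x.2)) ^ n₁ *
      (Real.log m + (Real.log y.1 + Real.log y.2)) ^ n₂ *
      (Real.log m + (Real.log x.1 + Real.log y.1)) ^ n₃ *
      (Real.log m + (Real.log x.2 + Real.log y.2)) ^ n₄ / (x.1 * x.2 * y.1 * y.2)) = _
  simp only [h, quadSum_sum, quadSum_const_mul, Finset.mul_sum]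
  refine Finset.sum_congr rfl fun q₁ _ => Finset.sum_congr rfl fun q₂ _ =>
    Finset.sum_congr rfl fun q₃ _ => Finset.sum_congr rfl fun q₄ _ => ?_
  rw [moebiusLogF]
  ring

lemma trinomialIndex_add_le {n : ℕ} {q : Σ _ : ℕ, ℕ} (hq : q ∈ trinomialIndex n) :
    q.1 + q.2 ≤ n := by
  simp only [trinomialIndex, Finset.mem_sigma, Finset.mem_range] at hq
  omega

lemma hasPolyAsymp_quad (i j k l : ℕ) :
    HasPolyAsymp (expSum (dirConv (dirConv (logF i) (logF j)) (dirConv (logF k) (logF l))))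
      (i + j + k + l + 4)
      ((i.factorial * j.factorial * k.factorial * l.factorial : ℝ) /
        (i + j + k + l + 4).factorial) :=
  exists_quad_formula i j k l

/-- Polynomial asymptotics for the correlation sum. -/
lemma hasPolyAsymp_sum_dGen_mul_dGen (n₁ n₂ n₃ n₄ : ℕ) :
    HasPolyAsymp
      (fun T => ∑ n ∈ Finset.Icc 1 ⌊Real.exp T⌋₊, dGen n₁ n₂ n * dGen n₃ n₄ n / n)
      (n₁ + n₂ + n₃ + n₄ + 4)
      (6 / Real.pi ^ 2 *
          ((Nat.factorial n₁ : ℝ) * (Nat.factorial n₂ : ℝ) * (Nat.factorial n₃ : ℝ) *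
              (Nat.factorial n₄ : ℝ) / (Nat.factorial (n₁ + n₂ + n₃ + n₄ + 4) : ℝ)) *
          ∑ a ∈ Finset.range (n₁ + 1), ∑ c ∈ Finset.range (n₂ + 1),
            ((Nat.choose (n₃ + 1 + a + c) n₃ : ℝ) *
              (Nat.choose (n₄ + 1 + n₁ + n₂ - a - c) n₄ : ℝ))) := by
  set g : (Σ _ : ℕ, ℕ) → (Σ _ : ℕ, ℕ) → (Σ _ : ℕ, ℕ) → (Σ _ : ℕ, ℕ) → ℝ :=
    fun q₁ q₂ q₃ q₄ => if q₁.1 + q₂.1 + q₃.1 + q₄.1 = 0 then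
      (trinomialCoeff n₁ q₁ * trinomialCoeff n₂ q₂ * trinomialCoeff n₃ q₃ * trinomialCoeff n₄ q₄) *
        (((q₁.2 + q₃.2).factorial * (n₁ - q₁.2 + q₄.2).factorial *
          (q₂.2 + (n₃ - q₃.2)).factorial * (n₂ - q₂.2 + (n₄ - q₄.2)).factorial : ℝ) /
            (n₁ + n₂ + n₃ + n₄ + 4).factorial * (6 / Real.pi ^ 2)) else 0 with hg
  have hterm : ∀ q₁ ∈ trinomialIndex n₁, ∀ q₂ ∈ trinomialIndex n₂, ∀ q₃ ∈ trinomialIndex n₃,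
      ∀ q₄ ∈ trinomialIndex n₄, HasPolyAsymp (fun T =>
        (trinomialCoeff n₁ q₁ * trinomialCoeff n₂ q₂ * trinomialCoeff n₃ q₃ *
          trinomialCoeff n₄ q₄) *
        ∑ m ∈ Finset.Icc 1 ⌊Real.exp T⌋₊, moebiusLogF (q₁.1 + q₂.1 + q₃.1 + q₄.1) m *
          expSum (dirConv (dirConv (logF (q₁.2 + q₃.2)) (logF (n₁ - q₁.1 - q₁.2 + q₄.2)))
            (dirConv (logF (q₂.2 + (n₃ - q₃.1 - q₃.2)))
              (logF (n₂ - q₂.1 - q₂.2 + (n₄ - q₄.1 - q₄.2))))) (T - 2 * Real.log m))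
      (n₁ + n₂ + n₃ + n₄ + 4) (g q₁ q₂ q₃ q₄) := by
    intro q₁ h₁ q₂ h₂ q₃ h₃ q₄ h₄
    have a₁ := trinomialIndex_add_le h₁
    have a₂ := trinomialIndex_add_le h₂
    have a₃ := trinomialIndex_add_le h₃
    have a₄ := trinomialIndex_add_le h₄
    have hm := ((hasPolyAsymp_quad (q₁.2 + q₃.2) (n₁ - q₁.1 - q₁.2 + q₄.2)
      (q₂.2 + (n₃ - q₃.1 - q₃.2)) (n₂ - q₂.1 - q₂.2 + (n₄ - q₄.1 - q₄.2))).moebius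
        (fun τ hτ => expSum_eq_zero _ hτ) (q₁.1 + q₂.1 + q₃.1 + q₄.1)).const_mul
        (trinomialCoeff n₁ q₁ * trinomialCoeff n₂ q₂ * trinomialCoeff n₃ q₃ *
          trinomialCoeff n₄ q₄)
    by_cases h0 : q₁.1 + q₂.1 + q₃.1 + q₄.1 = 0
    · have e₁ : q₁.1 = 0 := by omega
      have e₂ : q₂.1 = 0 := by omega
      have e₃ : q₃.1 = 0 := by omega
      have e₄ : q₄.1 = 0 := by omega
      simp only [hg, if_pos h0]
      rw [h0, e₁, e₂, e₃, e₄] at hm ⊢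
      simp only [Nat.sub_zero, tsum_moebiusLogF_zero] at hm ⊢
      rwa [show q₁.2 + q₃.2 + (n₁ - q₁.2 + q₄.2) + (q₂.2 + (n₃ - q₃.2)) +
        (n₂ - q₂.2 + (n₄ - q₄.2)) + 4 = n₁ + n₂ + n₃ + n₄ + 4 by omega] at hm
    · simp only [hg, if_neg h0]
      exact hm.of_lt (by omega)
  have hsum := HasPolyAsymp.sum (trinomialIndex n₁) fun q₁ h₁ =>
    HasPolyAsymp.sum (trinomialIndex n₂) fun q₂ h₂ =>
    HasPolyAsymp.sum (trinomialIndex n₃) fun q₃ h₃ =>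
    HasPolyAsymp.sum (trinomialIndex n₄) fun q₄ h₄ => hterm q₁ h₁ q₂ h₂ q₃ h₃ q₄ h₄
  have hcoef : ∑ q₁ ∈ trinomialIndex n₁, ∑ q₂ ∈ trinomialIndex n₂, ∑ q₃ ∈ trinomialIndex n₃,
      ∑ q₄ ∈ trinomialIndex n₄, g q₁ q₂ q₃ q₄ =
      (∑ a ∈ Finset.range (n₁ + 1), ∑ c ∈ Finset.range (n₂ + 1), ∑ e ∈ Finset.range (n₃ + 1),
      ∑ f ∈ Finset.range (n₄ + 1), ((n₁.choose a : ℝ) * n₂.choose c * n₃.choose e * n₄.choose f) *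
        ((a + e).factorial * (n₁ - a + f).factorial * (c + (n₃ - e)).factorial *
          (n₂ - c + (n₄ - f)).factorial : ℝ)) *
        (1 / (n₁ + n₂ + n₃ + n₄ + 4).factorial * (6 / Real.pi ^ 2)) := by
    have hz : ∀ q₁ q₂ q₃ q₄, q₁.1 + q₂.1 + q₃.1 + q₄.1 ≠ 0 → g q₁ q₂ q₃ q₄ = 0 :=
      fun q₁ q₂ q₃ q₄ h => if_neg h
    rw [sum_trinomialIndex_of_eq_zero fun q₁ h => Finset.sum_eq_zero fun q₂ _ =>
      Finset.sum_eq_zero fun q₃ _ => Finset.sum_eq_zero fun q₄ _ => hz _ _ _ _ (by omega),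
      Finset.sum_mul]
    refine Finset.sum_congr rfl fun a _ => ?_
    rw [sum_trinomialIndex_of_eq_zero fun q₂ h =>
      Finset.sum_eq_zero fun q₃ _ => Finset.sum_eq_zero fun q₄ _ => hz _ _ _ _ (by omega),
      Finset.sum_mul]
    refine Finset.sum_congr rfl fun c _ => ?_
    rw [sum_trinomialIndex_of_eq_zero fun q₃ h =>
      Finset.sum_eq_zero fun q₄ _ => hz _ _ _ _ (by omega), Finset.sum_mul]
    refine Finset.sum_congr rfl fun e _ => ?_
    rw [sum_trinomialIndex_of_eq_zero fun q₄ h => hz _ _ _ _ (by omega), Finset.sum_mul]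
    refine Finset.sum_congr rfl fun f _ => ?_
    simp only [hg, trinomialCoeff, add_zero, if_true, Nat.choose_zero_right, Nat.sub_zero,
      Nat.cast_one, one_mul]
    ring
  rw [hcoef, sum_choose_mul_factorial] at hsum
  have hcongr := hsum.congr fun T _ => (sum_dGen_mul_dGen_eq_sum_trinomial n₁ n₂ n₃ n₄ T).symm
  convert! hcongr using 1
  ring

theorem divisor_log_correlation_polynomial (n₁ n₂ n₃ n₄ : ℕ) :
    ∃ P : Polynomial ℝ,
      P.natDegree = n₁ + n₂ + n₃ + n₄ + 4 ∧
      P.leadingCoeff =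
        6 / Real.pi ^ 2 *
          ((Nat.factorial n₁ : ℝ) * (Nat.factorial n₂ : ℝ) * (Nat.factorial n₃ : ℝ) *
              (Nat.factorial n₄ : ℝ) / (Nat.factorial (n₁ + n₂ + n₃ + n₄ + 4) : ℝ)) *
          ∑ a ∈ Finset.range (n₁ + 1), ∑ c ∈ Finset.range (n₂ + 1),
            ((Nat.choose (n₃ + 1 + a + c) n₃ : ℝ) *
              (Nat.choose (n₄ + 1 + n₁ + n₂ - a - c) n₄ : ℝ)) ∧
      ∀ ε : ℝ, 0 < ε → ∃ K : ℝ, 0 < K ∧ ∀ t : ℝ, 2 ≤ t →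
        |(∑ n ∈ Finset.Icc 1 ⌊t⌋₊, dGen n₁ n₂ n * dGen n₃ n₄ n / n) -
            P.eval (Real.log t)| ≤ K * t ^ (-(1:ℝ)/2 + ε) := by
  obtain ⟨P, hdeg, hcoeff, hP⟩ := hasPolyAsymp_sum_dGen_mul_dGen n₁ n₂ n₃ n₄
  have hsum : 0 < ∑ a ∈ Finset.range (n₁ + 1), ∑ c ∈ Finset.range (n₂ + 1),
      ((Nat.choose (n₃ + 1 + a + c) n₃ : ℝ) *
        (Nat.choose (n₄ + 1 + n₁ + n₂ - a - c) n₄ : ℝ)) := by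
    refine Finset.sum_pos (fun a ha => Finset.sum_pos (fun c hc => ?_) ⟨0, by simp⟩) ⟨0, by simp⟩
    rw [Finset.mem_range] at ha hc
    refine mul_pos ?_ ?_ <;> exact_mod_cast Nat.choose_pos (by omega)
  have hne : P.coeff (n₁ + n₂ + n₃ + n₄ + 4) ≠ 0 := by
    rw [hcoeff]
    have := Real.pi_pos
    positivity
  have hdeg' : P.natDegree = n₁ + n₂ + n₃ + n₄ + 4 :=
    le_antisymm hdeg (Polynomial.le_natDegree_of_ne_zero hne)
  refine ⟨P, hdeg', by rw [Polynomial.leadingCoeff, hdeg', hcoeff], fun ε hε => ?_⟩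
  obtain ⟨K, hK, h⟩ := hP ε hε
  refine ⟨K, hK, fun t ht => ?_⟩
  have ht0 : 0 < t := by linarith
  have := h (Real.log t) (Real.log_nonneg (by linarith))
  simp only [Real.exp_log ht0] at this
  rw [Real.rpow_def_of_pos ht0]
  refine this.trans (le_of_eq ?_)
  congr 2
  ring
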